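/- There are no rational numbers X, Y satisfying Y² = X⁶ + 18X⁵ + 75X⁴ + 120X³ + 120X² + 72X + 28. (Equivalently, the only rational points on the genus-two hyperelliptic curve C₁ defined by this equation are the two points at infinity.) -/

import Mathlib

open NumberField IsDedekindDomain

namespace C1

/-- The `24`-th cyclotomic field, which contains `√2`, `√3` and `√-1`. -/
abbrev L := CyclotomicField 24 ℚ

instance : IsCyclotomicExtension {24} ℚ L := CyclotomicField.isCyclotomicExtension 24 ℚ
instance : NumberField L := IsCyclotomicExtension.numberField {24} ℚ L
instance : IsGalois ℚ L := IsCyclotomicExtension.isGalois {24} ℚ L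

lemma isPrimitiveRoot_zeta : IsPrimitiveRoot (IsCyclotomicExtension.zeta 24 ℚ L) 24 :=
  IsCyclotomicExtension.zeta_spec 24 ℚ L

/-- A primitive `24`-th root of unity, as an algebraic integer. -/
noncomputable def z : 𝓞 L := isPrimitiveRoot_zeta.toInteger

lemma isPrimitiveRoot_z : IsPrimitiveRoot z 24 := isPrimitiveRoot_zeta.toInteger_isPrimitiveRoot

lemma z_pow_twelve : z ^ 12 = -1 := by
  have h := isPrimitiveRoot_z
  have h1 : (z ^ 12 - 1) * (z ^ 12 + 1) = 0 := by linear_combination h.pow_eq_one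
  rcases mul_eq_zero.1 h1 with h2 | h2
  · exact absurd (sub_eq_zero.1 h2) (h.pow_ne_one_of_pos_of_lt (by norm_num) (by norm_num))
  · exact eq_neg_of_add_eq_zero_left h2

lemma z_pow_eight : z ^ 8 = z ^ 4 - 1 := by
  have h := isPrimitiveRoot_z
  have h1 : (z ^ 4 + 1) * (z ^ 8 - z ^ 4 + 1) = 0 := by linear_combination z_pow_twelve
  rcases mul_eq_zero.1 h1 with h2 | h2
  · refine absurd ?_ (h.pow_ne_one_of_pos_of_lt (l := 8) (by norm_num) (by norm_num))
    linear_combination (z ^ 4 - 1) * h2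
  · linear_combination h2

/-- `√2` -/
noncomputable def al : 𝓞 L := z ^ 3 - z ^ 9
/-- `√3` -/
noncomputable def be : 𝓞 L := z ^ 2 - z ^ 10
/-- `√-1` -/
noncomputable def ii : 𝓞 L := -z ^ 6
/-- a cube root of unity -/
noncomputable def om : 𝓞 L := -z ^ 4
/-- a generator of the prime above `2` -/
noncomputable def p2 : 𝓞 L := 1 - z ^ 3
/-- a generator of one of the primes above `3` -/
noncomputable def p3 : 𝓞 L := 1 + z + z ^ 3
/-- a generator of the other prime above `3` -/
noncomputable def p3' : 𝓞 L := 1 - z ^ 11 - z ^ 9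

lemma al_sq : al ^ 2 = 2 := by
  unfold al; linear_combination (z ^ 6 - 2) * z_pow_twelve
lemma be_sq : be ^ 2 = 3 := by
  unfold be; linear_combination (z ^ 8 - 2) * z_pow_twelve - z_pow_eight
lemma ii_sq : ii ^ 2 = -1 := by
  unfold ii; linear_combination z_pow_twelve

lemma om_sq : om ^ 2 + om + 1 = 0 := by
  unfold om; linear_combination z_pow_eight
lemma two_mul_om : 2 * om = ii * be - 1 := by
  unfold om ii be; linear_combination (1 - z ^ 4 - z ^ 8) * z_pow_eight

lemma p2_pow_four : ∃ u : (𝓞 L)ˣ, p2 ^ 4 = 2 * u := by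
  refine ⟨⟨(2) * z ^ 1 + (-2) * z ^ 3 + (-2) * z ^ 5 + (3) * z ^ 6, (2) * z ^ 1 + (-2) * z ^ 3 + (-2) * z ^ 5 + (-3) * z ^ 6, ?_, ?_⟩, ?_⟩
  · linear_combination (-1+4*z^2-9*z^4) * z_pow_eight
  · linear_combination (-1+4*z^2-9*z^4) * z_pow_eight
  · simp only [p2]; linear_combination (1-4*z+z^4) * z_pow_eight

lemma p2_sq : ∃ u : (𝓞 L)ˣ, p2 ^ 2 = al * u := by
  refine ⟨⟨(-1) * z ^ 0 + (1) * z ^ 3 + (-1) * z ^ 6, (-1) * z ^ 0 + (-1) * z ^ 1 + (1) * z ^ 5 + (1) * z ^ 6, ?_, ?_⟩, ?_⟩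
  · linear_combination (z-z^3-z^4) * z_pow_eight
  · linear_combination (z-z^3-z^4) * z_pow_eight
  · simp only [p2, al]; linear_combination (1-z^3+z^4-z^7) * z_pow_eight

lemma p3_mul_p3' : ∃ u : (𝓞 L)ˣ, p3 * p3' = be * u := by
  refine ⟨⟨(1) * z ^ 0 + (1) * z ^ 1 + (2) * z ^ 2 + (1) * z ^ 3 + (-1) * z ^ 6 + (-1) * z ^ 7, (-1) * z ^ 0 + (2) * z ^ 2 + (-1) * z ^ 5 + (-1) * z ^ 6 + (1) * z ^ 7, ?_, ?_⟩, ?_⟩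
  · linear_combination (-2-z+z^3+2*z^4-z^6) * z_pow_eight
  · linear_combination (-2-z+z^3+2*z^4-z^6) * z_pow_eight
  · simp only [p3, p3', be]; linear_combination (1+z-z^2-z^4-z^6-z^8-z^9) * z_pow_eight

lemma p3_sq : ∃ u : (𝓞 L)ˣ, p3 ^ 2 = (1 - ii * al) * u := by
  refine ⟨⟨(1) * z ^ 0 + (2) * z ^ 1 + (1) * z ^ 2 + (1) * z ^ 3 + (-1) * z ^ 5 + (-1) * z ^ 6 + (-1) * z ^ 7, (-1) * z ^ 0 + (-1) * z ^ 1 + (2) * z ^ 3 + (1) * z ^ 4 + (-1) * z ^ 6 + (-1) * z ^ 7, ?_, ?_⟩, ?_⟩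
  · linear_combination (-2-3*z-3*z^2+2*z^4+2*z^5+z^6) * z_pow_eight
  · linear_combination (-2-3*z-3*z^2+2*z^4+2*z^5+z^6) * z_pow_eight
  · simp only [p3, ii, al]; linear_combination (z^3+2*z^4+z^5+2*z^6+2*z^7+2*z^8-z^12-z^13-z^14) * z_pow_eight

lemma p3'_sq : ∃ u : (𝓞 L)ˣ, p3' ^ 2 = (1 + ii * al) * u := by
  refine ⟨⟨(1) * z ^ 0 + (1) * z ^ 1 + (1) * z ^ 2 + (2) * z ^ 3 + (-1) * z ^ 7, (2) * z ^ 1 + (-1) * z ^ 3 + (-1) * z ^ 4 + (-1) * z ^ 5 + (1) * z ^ 6 + (1) * z ^ 7, ?_, ?_⟩, ?_⟩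
  · linear_combination (-1+2*z+2*z^2+z^3+z^4-z^5-z^6) * z_pow_eight
  · linear_combination (-1+2*z+2*z^2+z^3+z^4-z^5-z^6) * z_pow_eight
  · simp only [p3', ii, al]; linear_combination (-z-z^2-2*z^3-z^5-z^6-z^7-z^9+z^10+2*z^12+2*z^14) * z_pow_eight

lemma finrank_L : Module.finrank ℚ L = 8 := by
  rw [IsCyclotomicExtension.Rat.finrank 24 L]; decide

lemma discr_L : |discr L| = 5308416 := by
  have h := IsCyclotomicExtension.Rat.natAbs_discr 24 L
  have h1 : Nat.primeFactors 24 = {2, 3} := by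
    rw [show 24 = 2 ^ 3 * 3 ^ 1 by norm_num, Nat.primeFactors_mul (by norm_num) (by norm_num),
      Nat.primeFactors_prime_pow (by norm_num) Nat.prime_two,
      Nat.primeFactors_prime_pow (by norm_num) Nat.prime_three]
    rfl
  have h2 : Nat.totient 24 = 8 := by decide
  rw [h1, h2, Finset.prod_pair (by norm_num)] at h
  rw [Int.abs_eq_natAbs, h]
  norm_num

/-- Complex conjugation on `L`. -/
noncomputable def conjL : L ≃ₐ[ℚ] L :=
  IsCyclotomicExtension.fromZetaAut (n := 24) (K := ℚ) (isPrimitiveRoot_zeta.inv)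
    (Polynomial.cyclotomic.irreducible_rat (by norm_num))

lemma conjL_z : conjL (z : L) = (z : L)⁻¹ := by
  have := IsCyclotomicExtension.fromZetaAut_spec (n := 24) (K := ℚ) (isPrimitiveRoot_zeta.inv)
    (Polynomial.cyclotomic.irreducible_rat (by norm_num))
  exact this

/-- Complex conjugation on the ring of integers. -/
noncomputable def conjR : 𝓞 L ≃+* 𝓞 L := RingOfIntegers.mapRingEquiv conjL

lemma coe_conjR (x : 𝓞 L) : (conjR x : L) = conjL x := rfl

lemma conjR_z : conjR z = -z ^ 11 := by
  apply RingOfIntegers.coe_injective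
  change conjL (z : L) = algebraMap (𝓞 L) L _
  rw [conjL_z]
  have h : (z : L) ^ 12 = -1 := by exact_mod_cast congrArg (algebraMap (𝓞 L) L) z_pow_twelve
  have h0 : (z : L) ≠ 0 := by intro h0; rw [h0] at h; norm_num at h
  push_cast
  field_simp
  linear_combination h

lemma conjR_al : conjR al = al := by
  simp only [al, map_sub, map_pow, conjR_z]
  have h : (z ^ 12) ^ 2 = 1 := by rw [z_pow_twelve]; ring
  have h' : (z ^ 12) ^ 8 = 1 := by rw [z_pow_twelve]; ring
  linear_combination z ^ 3 * h' - z ^ 9 * h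
lemma conjR_be : conjR be = be := by
  simp only [be, map_sub, map_pow, conjR_z]
  have h : (z ^ 12) = -1 := z_pow_twelve
  have h' : (z ^ 12) ^ 9 = -1 := by rw [z_pow_twelve]; ring
  linear_combination z ^ 10 * h - z ^ 2 * h'
lemma conjR_ii : conjR ii = -ii := by
  simp only [ii, map_neg, map_pow, conjR_z]
  have h' : (z ^ 12) ^ 5 = -1 := by rw [z_pow_twelve]; ring
  linear_combination -z ^ 6 * h'

open Ideal

lemma absNorm_natCast (n : ℕ) : absNorm (span {(n : 𝓞 L)}) = n ^ 8 := by
  rw [Ideal.absNorm_span_natCast, ← finrank_L, RingOfIntegers.rank]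

lemma absNorm_two : absNorm (span {(2 : 𝓞 L)}) = 2 ^ 8 := by
  exact_mod_cast absNorm_natCast 2
lemma absNorm_three : absNorm (span {(3 : 𝓞 L)}) = 3 ^ 8 := by
  exact_mod_cast absNorm_natCast 3

lemma absNorm_p2 : absNorm (span {p2}) = 4 := by
  obtain ⟨u, hu⟩ := p2_pow_four
  have h : absNorm (span {p2}) ^ 4 = 4 ^ 4 := by
    rw [← map_pow, span_singleton_pow, hu, span_singleton_mul_right_unit u.isUnit, absNorm_two]; norm_num
  exact Nat.pow_left_injective (by norm_num) h

lemma absNorm_conjR (x : 𝓞 L) : absNorm (span {conjR x}) = absNorm (span {x}) := by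
  rw [absNorm_span_singleton, absNorm_span_singleton]
  congr 1
  have : ((Algebra.norm ℤ (conjR x) : ℤ) : ℚ) = Algebra.norm ℤ x := by
    rw [Algebra.coe_norm_int, Algebra.coe_norm_int, coe_conjR]
    exact Algebra.norm_eq_of_algEquiv conjL _
  exact_mod_cast this

lemma conjR_p3 : conjR p3 = p3' := by
  simp only [p3, p3', map_add, map_one, map_pow, conjR_z]
  have h' : (z ^ 12) ^ 2 = 1 := by rw [z_pow_twelve]; ring
  linear_combination -z ^ 9 * h'

lemma absNorm_p3' : absNorm (span {p3'}) = absNorm (span {p3}) := by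
  rw [← conjR_p3, absNorm_conjR]

lemma absNorm_be : absNorm (span {be}) = 3 ^ 4 := by
  have h : absNorm (span {be}) ^ 2 = (3 ^ 4) ^ 2 := by
    rw [← map_pow, span_singleton_pow, be_sq, absNorm_three]; norm_num
  exact Nat.pow_left_injective (by norm_num) h

lemma absNorm_p3 : absNorm (span {p3}) = 9 := by
  obtain ⟨u, hu⟩ := p3_mul_p3'
  have h : absNorm (span {p3}) ^ 2 = 9 ^ 2 := by
    rw [sq]
    nth_rw 2 [← absNorm_p3']
    rw [← map_mul, span_singleton_mul_span_singleton, hu, span_singleton_mul_right_unit u.isUnit,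
      absNorm_be]; norm_num
  exact Nat.pow_left_injective (by norm_num) h

lemma eq_span_of_mem {P : Ideal (𝓞 L)} {x : 𝓞 L} (hx : x ∈ P) (h0 : absNorm P ≠ 0)
    (h : absNorm P = absNorm (span {x})) : P = span {x} := by
  obtain ⟨J, hJ⟩ : P ∣ span {x} := Ideal.dvd_span_singleton.2 hx
  have h1 : absNorm J = 1 := by
    have := congrArg absNorm hJ
    rw [map_mul, ← h] at this
    exact Nat.eq_of_mul_eq_mul_left (Nat.pos_of_ne_zero h0) (by omega)
  rw [absNorm_eq_one_iff.1 h1, mul_top] at hJ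
  exact hJ.symm

lemma floor_minkowski_le : ⌊(4 / Real.pi) ^ InfinitePlace.nrComplexPlaces L *
      ((Module.finrank ℚ L).factorial / (Module.finrank ℚ L : ℝ) ^ (Module.finrank ℚ L) *
        √|(discr L : ℝ)|)⌋₊ ≤ 24 := by
  have h1 : InfinitePlace.nrComplexPlaces L = 4 := by
    rw [IsCyclotomicExtension.Rat.nrComplexPlaces_eq_totient_div_two 24]; decide
  have h2 : |(discr L : ℝ)| = 2304 ^ 2 := by
    have : ((|discr L| : ℤ) : ℝ) = (5308416 : ℤ) := by rw [discr_L]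
    push_cast at this; rw [this]; norm_num
  rw [h1, h2, finrank_L, Real.sqrt_sq (by norm_num)]
  apply Nat.le_of_lt_succ
  rw [Nat.floor_lt' (by norm_num)]
  have h3 : (4 / Real.pi) ^ 4 ≤ (4 / 3.1) ^ 4 := by
    have := Real.pi_gt_d2
    gcongr; linarith
  have h4 : (Nat.factorial 8 : ℝ) = 40320 := by norm_num [Nat.factorial]
  rw [h4]
  calc _ ≤ (4 / 3.1 : ℝ) ^ 4 * (40320 / (8 : ℕ) ^ 8 * 2304) := by gcongr
    _ < _ := by norm_num

lemma mem_of_pow_assoc {P : Ideal (𝓞 L)} [P.IsPrime] {x y : 𝓞 L} {n : ℕ} {u : (𝓞 L)ˣ}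
    (h : x ^ n = y * u) (hy : y ∈ P) : x ∈ P :=
  Ideal.IsPrime.mem_of_pow_mem ‹_› n (h ▸ P.mul_mem_right _ hy)

lemma eq_span_p2 {P : Ideal (𝓞 L)} [P.IsPrime] [P.LiesOver (span {((2 : ℕ) : ℤ)})] :
    P = span {p2} := by
  have : Fact (Nat.Prime 2) := ⟨Nat.prime_two⟩
  have : (span {((2 : ℕ) : ℤ)}).IsMaximal :=
    ((Ideal.span_singleton_prime (by norm_num)).2 (Nat.prime_iff_prime_int.1 Nat.prime_two)).isMaximal (by simp)
  have h1 : P.inertiaDeg ℤ = 2 := by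
    rw [IsCyclotomicExtension.Rat.inertiaDeg_eq 24 (p := 2) (k := 2) (m := 3) L P (by norm_num)
      (by norm_num)]
    exact orderOf_eq_prime (by decide) (by decide)
  have h2 : absNorm P = 4 := by
    have hmax : P.IsMaximal := Ideal.IsMaximal.of_liesOver_isMaximal P (span {((2 : ℕ) : ℤ)})
    have := natAbs_pow_inertiaDeg ((2 : ℕ) : ℤ) P
    rw [h1] at this; rw [← this]; norm_num
  have hm : (2 : 𝓞 L) ∈ P := by
    have := (Ideal.mem_of_liesOver P (span {((2 : ℕ) : ℤ)}) 2).1 (mem_span_singleton_self _)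
    simpa using this
  obtain ⟨u, hu⟩ := p2_pow_four
  exact eq_span_of_mem (mem_of_pow_assoc hu hm) (by omega) (by rw [h2, absNorm_p2])

lemma eq_span_p3 {P : Ideal (𝓞 L)} [P.IsPrime] [P.LiesOver (span {((3 : ℕ) : ℤ)})] :
    P = span {p3} ∨ P = span {p3'} := by
  have : Fact (Nat.Prime 3) := ⟨Nat.prime_three⟩
  have : (span {((3 : ℕ) : ℤ)}).IsMaximal :=
    ((Ideal.span_singleton_prime (by norm_num)).2 (Nat.prime_iff_prime_int.1 Nat.prime_three)).isMaximal (by simp)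
  have h1 : P.inertiaDeg ℤ = 2 := by
    rw [IsCyclotomicExtension.Rat.inertiaDeg_eq 24 (p := 3) (k := 0) (m := 8) L P (by norm_num)
      (by norm_num)]
    exact orderOf_eq_prime (by decide) (by decide)
  have h2 : absNorm P = 9 := by
    have hmax : P.IsMaximal := Ideal.IsMaximal.of_liesOver_isMaximal P (span {((3 : ℕ) : ℤ)})
    have := natAbs_pow_inertiaDeg ((3 : ℕ) : ℤ) P
    rw [h1] at this; rw [← this]; norm_num
  have hm : (3 : 𝓞 L) ∈ P := by
    have := (Ideal.mem_of_liesOver P (span {((3 : ℕ) : ℤ)}) 3).1 (mem_span_singleton_self _)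
    simpa using this
  have hb : be ∈ P := Ideal.IsPrime.mem_of_pow_mem ‹_› 2 (be_sq ▸ hm)
  obtain ⟨u, hu⟩ := p3_mul_p3'
  rcases Ideal.IsPrime.mem_or_mem ‹_› (hu ▸ P.mul_mem_right _ hb : p3 * p3' ∈ P) with h | h
  · exact Or.inl (eq_span_of_mem h (by omega) (by rw [h2, absNorm_p3]))
  · exact Or.inr (eq_span_of_mem h (by omega) (by rw [h2, absNorm_p3', absNorm_p3]))

instance : IsPrincipalIdealRing (𝓞 L) := by
  apply RingOfIntegers.isPrincipalIdealRing_of_isPrincipal_of_pow_le_of_mem_primesOver_of_mem_Icc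
  intro p hp hpp P hP hle
  have hle := hle.trans floor_minkowski_le
  have hp := (Finset.mem_Icc.1 hp).2.trans floor_minkowski_le
  have : P.IsPrime := hP.1
  have : P.LiesOver (span {(p : ℤ)}) := hP.2
  have : Fact p.Prime := ⟨hpp⟩
  by_cases h2 : p = 2
  · subst h2; exact ⟨p2, eq_span_p2⟩
  by_cases h3 : p = 3
  · subst h3; exact eq_span_p3.elim (fun h => ⟨p3, h⟩) (fun h => ⟨p3', h⟩)
  have hnd : ¬ p ∣ 24 := by
    intro h
    rw [show 24 = 2 ^ 3 * 3 by norm_num, hpp.dvd_mul] at h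
    rcases h with h | h
    · exact h2 ((Nat.prime_dvd_prime_iff_eq hpp Nat.prime_two).1 (hpp.dvd_of_dvd_pow h))
    · exact h3 ((Nat.prime_dvd_prime_iff_eq hpp Nat.prime_three).1 h)
  exfalso
  rw [IsCyclotomicExtension.Rat.inertiaDeg_eq_of_not_dvd (m := 24) p L P hnd] at hle
  have h5 : 5 ≤ p := by
    have := hpp.two_le
    rcases Nat.lt_or_ge p 5 with h | h
    · interval_cases p <;> simp_all
    · exact h
  have hu : IsUnit (p : ZMod 24) := by
    rw [ZMod.isUnit_iff_coprime]; exact (hpp.coprime_iff_not_dvd).2 hnd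
  have ho : orderOf (p : ZMod 24) = 1 := by
    have : 0 < orderOf (p : ZMod 24) := by
      obtain ⟨u, hu⟩ := hu
      rw [← hu, orderOf_units]; exact orderOf_pos u
    by_contra hne
    have : p ^ 2 ≤ p ^ orderOf (p : ZMod 24) := Nat.pow_le_pow_right (by omega) (by omega)
    nlinarith
  rw [orderOf_eq_one_iff] at ho
  interval_cases p <;> revert ho <;> decide

/-- The ring `(ℤ/9)[√2, √3]`, which is the residue ring of `𝓞 L` modulo the fourth power of the
prime generated by `p3`. -/
@[ext] structure A where
  (a b c d : ZMod 9)
deriving DecidableEq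

namespace A
instance : Zero A := ⟨⟨0, 0, 0, 0⟩⟩
instance : One A := ⟨⟨1, 0, 0, 0⟩⟩
instance : Add A := ⟨fun x y => ⟨x.a + y.a, x.b + y.b, x.c + y.c, x.d + y.d⟩⟩
instance : Neg A := ⟨fun x => ⟨-x.a, -x.b, -x.c, -x.d⟩⟩
instance : Sub A := ⟨fun x y => ⟨x.a - y.a, x.b - y.b, x.c - y.c, x.d - y.d⟩⟩
instance : Mul A := ⟨fun x y =>
  ⟨x.a * y.a + 2 * (x.b * y.b) + 3 * (x.c * y.c) + 6 * (x.d * y.d),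
   x.a * y.b + x.b * y.a + 3 * (x.c * y.d + x.d * y.c),
   x.a * y.c + x.c * y.a + 2 * (x.b * y.d + x.d * y.b),
   x.a * y.d + x.d * y.a + x.b * y.c + x.c * y.b⟩⟩

@[simp] lemma zero_a : (0 : A).a = 0 := rfl
@[simp] lemma zero_b : (0 : A).b = 0 := rfl
@[simp] lemma zero_c : (0 : A).c = 0 := rfl
@[simp] lemma zero_d : (0 : A).d = 0 := rfl
@[simp] lemma one_a : (1 : A).a = 1 := rfl
@[simp] lemma one_b : (1 : A).b = 0 := rfl
@[simp] lemma one_c : (1 : A).c = 0 := rfl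
@[simp] lemma one_d : (1 : A).d = 0 := rfl
variable (x y : A)
@[simp] lemma add_a : (x + y).a = x.a + y.a := rfl
@[simp] lemma add_b : (x + y).b = x.b + y.b := rfl
@[simp] lemma add_c : (x + y).c = x.c + y.c := rfl
@[simp] lemma add_d : (x + y).d = x.d + y.d := rfl
@[simp] lemma sub_a : (x - y).a = x.a - y.a := rfl
@[simp] lemma sub_b : (x - y).b = x.b - y.b := rfl
@[simp] lemma sub_c : (x - y).c = x.c - y.c := rfl
@[simp] lemma sub_d : (x - y).d = x.d - y.d := rfl
@[simp] lemma neg_a : (-x).a = -x.a := rfl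
@[simp] lemma neg_b : (-x).b = -x.b := rfl
@[simp] lemma neg_c : (-x).c = -x.c := rfl
@[simp] lemma neg_d : (-x).d = -x.d := rfl
@[simp] lemma mul_a : (x * y).a =
  x.a * y.a + 2 * (x.b * y.b) + 3 * (x.c * y.c) + 6 * (x.d * y.d) := rfl
@[simp] lemma mul_b : (x * y).b =
  x.a * y.b + x.b * y.a + 3 * (x.c * y.d + x.d * y.c) := rfl
@[simp] lemma mul_c : (x * y).c =
  x.a * y.c + x.c * y.a + 2 * (x.b * y.d + x.d * y.b) := rfl
@[simp] lemma mul_d : (x * y).d =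
  x.a * y.d + x.d * y.a + x.b * y.c + x.c * y.b := rfl

instance : CommRing A where
  add_assoc x y z := by ext <;> simp <;> ring
  zero_add x := by ext <;> simp
  add_zero x := by ext <;> simp
  add_comm x y := by ext <;> simp <;> ring
  neg_add_cancel x := by ext <;> simp
  sub_eq_add_neg x y := by ext <;> simp <;> ring
  mul_assoc x y z := by ext <;> simp <;> ring
  one_mul x := by ext <;> simp
  mul_one x := by ext <;> simp
  mul_comm x y := by ext <;> simp <;> ring
  zero_mul x := by ext <;> simp
  mul_zero x := by ext <;> simp
  left_distrib x y z := by ext <;> simp <;> ring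
  right_distrib x y z := by ext <;> simp <;> ring
  nsmul := nsmulRec
  zsmul := zsmulRec

instance : Nontrivial A := ⟨⟨0, 1, by decide⟩⟩

lemma nine_eq_zero : (9 : A) = 0 := by decide

end A

lemma cyclotomic_24 : Polynomial.cyclotomic 24 ℤ =
    Polynomial.X ^ 8 - Polynomial.X ^ 4 + 1 := by
  rw [show 24 = 12 * 2 by norm_num, ← Polynomial.cyclotomic_expand_eq_cyclotomic (p := 2)
    Nat.prime_two (by norm_num), show 12 = 6 * 2 by norm_num,
    ← Polynomial.cyclotomic_expand_eq_cyclotomic (p := 2) Nat.prime_two (by norm_num),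
    Polynomial.cyclotomic_six]
  simp only [map_add, map_sub, map_pow, Polynomial.expand_X, map_one]
  ring

/-- The image of `z` in `A`. -/
def zA : A := ⟨1, 7, 8, 7⟩

lemma aeval_minpoly_zA :
    Polynomial.aeval zA (minpoly ℤ isPrimitiveRoot_zeta.integralPowerBasis.gen) = 0 := by
  have h : minpoly ℤ (algebraMap (𝓞 L) L z) = minpoly ℤ z :=
    minpoly.algebraMap_eq RingOfIntegers.coe_injective z
  rw [IsPrimitiveRoot.integralPowerBasis_gen]
  change Polynomial.aeval zA (minpoly ℤ z) = 0
  have h2 : Polynomial.cyclotomic 24 ℤ = minpoly ℤ (algebraMap (𝓞 L) L z) := by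
    convert Polynomial.cyclotomic_eq_minpoly isPrimitiveRoot_zeta (by norm_num)
    · exact Subsingleton.elim _ _
    · rfl
  rw [← h, ← h2, cyclotomic_24]
  simp only [map_add, map_sub, map_pow, Polynomial.aeval_X, map_one]
  decide +kernel

/-- Reduction modulo the fourth power of the prime `p3`. -/
noncomputable def redR : 𝓞 L →ₐ[ℤ] A :=
  isPrimitiveRoot_zeta.integralPowerBasis.lift zA aeval_minpoly_zA

lemma redR_z : redR z = zA := by
  have := isPrimitiveRoot_zeta.integralPowerBasis.lift_gen zA aeval_minpoly_zA
  rwa [IsPrimitiveRoot.integralPowerBasis_gen] at this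

lemma redR_al : redR al = ⟨0, 1, 0, 0⟩ := by
  simp only [al, map_sub, map_pow, redR_z]; decide +kernel
lemma redR_be : redR be = ⟨0, 0, 1, 0⟩ := by
  simp only [be, map_sub, map_pow, redR_z]; decide +kernel
lemma redR_ii : redR ii = ⟨0, 2, 0, 0⟩ := by
  simp only [ii, map_neg, map_pow, redR_z]; decide +kernel
lemma redR_om : redR om = -zA ^ 4 := by
  simp only [om, map_neg, map_pow, redR_z]
lemma redR_p3_pow : (redR p3) ^ 4 = 0 := by
  simp only [p3, map_add, map_one, map_pow, redR_z]; decide +kernel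

lemma liesOver_of_mem {P : Ideal (𝓞 L)} [P.IsPrime] {p : ℕ} (hp : p.Prime)
    (h : (p : 𝓞 L) ∈ P) : P.LiesOver (span {(p : ℤ)}) := by
  have hmax : (span {(p : ℤ)}).IsMaximal :=
    ((Ideal.span_singleton_prime (by exact_mod_cast hp.ne_zero)).2
      (Nat.prime_iff_prime_int.1 hp)).isMaximal (by simpa using hp.ne_zero)
  refine ⟨hmax.eq_of_le ?_ ?_⟩
  · exact (Ideal.IsPrime.under ℤ P).ne_top
  · rw [span_singleton_le_iff_mem, Ideal.mem_under]
    simpa using h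

lemma prime_p3 : Prime p3 := by
  have hmax : (span {((3 : ℕ) : ℤ)}).IsMaximal :=
    ((Ideal.span_singleton_prime (by norm_num)).2
      (Nat.prime_iff_prime_int.1 Nat.prime_three)).isMaximal (by simp)
  obtain ⟨⟨P, _, _⟩⟩ := (span {((3 : ℕ) : ℤ)}).nonempty_primesOver (S := 𝓞 L)
  have h0 : p3 ≠ 0 := by
    intro h
    have := absNorm_p3
    rw [h] at this; simp at this
  rcases eq_span_p3 (P := P) with h | h
  · exact (span_singleton_prime h0).1 (h ▸ ‹P.IsPrime›)
  · have h1 : p3' ≠ 0 := by rw [← conjR_p3]; simpa using h0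
    have : Prime p3' := (span_singleton_prime h1).1 (h ▸ ‹P.IsPrime›)
    rw [← conjR_p3] at this
    exact (MulEquiv.prime_iff conjR.toMulEquiv).1 this

lemma isCoprime_p3 {x : 𝓞 L} (h : ¬ p3 ∣ x) : IsCoprime p3 x :=
  (prime_p3.irreducible.coprime_iff_not_dvd).2 h

lemma redR_isUnit {x : 𝓞 L} (h : ¬ p3 ∣ x) : IsUnit (redR x) := by
  obtain ⟨a, b, hab⟩ := isCoprime_p3 h
  have h1 := congrArg redR hab
  simp only [map_add, map_mul, map_one] at h1
  have h2 : IsNilpotent (-(redR a * redR p3)) :=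
    (((Commute.all _ _).isNilpotent_mul_left ⟨4, redR_p3_pow⟩)).neg
  refine isUnit_of_mul_isUnit_right (x := redR b) ?_
  have : redR b * redR x = 1 + (-(redR a * redR p3)) := by linear_combination h1
  rw [this]
  exact h2.isUnit_one_add

lemma redR_not_isUnit {x : 𝓞 L} (h : p3 ∣ x) : ¬ IsUnit (redR x) := by
  obtain ⟨y, rfl⟩ := h
  intro hu
  rw [map_mul] at hu
  have := (isUnit_of_mul_isUnit_left hu).pow 4
  rw [redR_p3_pow] at this
  exact not_isUnit_zero this

/-- The prime generated by `p3`. -/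
noncomputable def V3 : HeightOneSpectrum (𝓞 L) :=
  ⟨span {p3}, (span_singleton_prime prime_p3.ne_zero).2 prime_p3,
    by simpa using prime_p3.ne_zero⟩

/-- The valuation of `L` attached to `p3`. -/
noncomputable def v : Valuation L (WithZero (Multiplicative ℤ)) := V3.valuation L

/-- The inclusion of the ring of integers. -/
noncomputable def toL : 𝓞 L →+* L := algebraMap (𝓞 L) L

lemma toL_ofNat (n : ℕ) [n.AtLeastTwo] : toL (OfNat.ofNat n) = OfNat.ofNat n := map_ofNat toL n

lemma toL_injective : Function.Injective toL := RingOfIntegers.coe_injective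

/-- `x` is integral at `p3`, with reduction `t`. -/
def Cg (x : L) (t : A) : Prop :=
  ∃ a b : 𝓞 L, ¬ p3 ∣ b ∧ x * toL b = toL a ∧ redR b * t = redR a

lemma coe_ne_zero {b : 𝓞 L} (h : b ≠ 0) : toL b ≠ 0 := (map_ne_zero_iff toL toL_injective).2 h

lemma v_coe_eq_one {b : 𝓞 L} : v (toL b) = 1 ↔ ¬ p3 ∣ b := by
  change V3.valuation L (algebraMap (𝓞 L) L b) = 1 ↔ _
  rw [HeightOneSpectrum.valuation_eq_one_iff_notMem]
  exact not_congr mem_span_singleton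
lemma v_coe_lt_one {b : 𝓞 L} : v (toL b) < 1 ↔ p3 ∣ b := by
  change V3.valuation L (algebraMap (𝓞 L) L b) < 1 ↔ _
  rw [HeightOneSpectrum.valuation_lt_one_iff_mem]
  exact mem_span_singleton
lemma v_coe_le_one (b : 𝓞 L) : v (toL b) ≤ 1 := HeightOneSpectrum.valuation_le_one _ _

namespace Cg
lemma coe (a : 𝓞 L) : Cg (toL a) (redR a) := ⟨a, 1, by
  intro h; exact prime_p3.not_isUnit (isUnit_of_dvd_one h), by simp, by simp⟩

lemma unique {x : L} {s t : A} (hs : Cg x s) (ht : Cg x t) : s = t := by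
  obtain ⟨a, b, hb, hx, h⟩ := hs
  obtain ⟨a', b', hb', hx', h'⟩ := ht
  have e : a * b' = a' * b := by
    apply toL_injective
    rw [map_mul, map_mul]
    rw [← hx, ← hx']; ring
  have e' := congrArg redR e
  rw [map_mul, map_mul, ← h, ← h'] at e'
  have hu := (redR_isUnit hb).mul (redR_isUnit hb')
  apply hu.mul_left_cancel
  linear_combination e'

lemma add {x y : L} {s t : A} (hs : Cg x s) (ht : Cg y t) : Cg (x + y) (s + t) := by
  obtain ⟨a, b, hb, hx, h⟩ := hs
  obtain ⟨a', b', hb', hx', h'⟩ := ht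
  refine ⟨a * b' + a' * b, b * b', prime_p3.not_dvd_mul hb hb', ?_, ?_⟩
  · simp only [map_mul, map_add, map_neg]; rw [← hx, ← hx']; ring
  · simp only [map_add, map_mul, ← h, ← h']; ring

lemma mul {x y : L} {s t : A} (hs : Cg x s) (ht : Cg y t) : Cg (x * y) (s * t) := by
  obtain ⟨a, b, hb, hx, h⟩ := hs
  obtain ⟨a', b', hb', hx', h'⟩ := ht
  refine ⟨a * a', b * b', prime_p3.not_dvd_mul hb hb', ?_, ?_⟩
  · simp only [map_mul, map_add, map_neg]; rw [← hx, ← hx']; ring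
  · simp only [map_mul, ← h, ← h']; ring

lemma neg {x : L} {s : A} (hs : Cg x s) : Cg (-x) (-s) := by
  obtain ⟨a, b, hb, hx, h⟩ := hs
  refine ⟨-a, b, hb, ?_, ?_⟩
  · simp only [map_mul, map_add, map_neg]; rw [← hx]; ring
  · simp only [map_neg, ← h]; ring

lemma sub {x y : L} {s t : A} (hs : Cg x s) (ht : Cg y t) : Cg (x - y) (s - t) := by
  rw [sub_eq_add_neg, sub_eq_add_neg]; exact hs.add ht.neg

lemma intCast (n : ℤ) : Cg (n : L) (n : A) := by
  have := coe (n : 𝓞 L)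
  simpa using this
lemma natCast (n : ℕ) : Cg (n : L) (n : A) := by exact_mod_cast intCast n
lemma ofNat (n : ℕ) [n.AtLeastTwo] : Cg (OfNat.ofNat n : L) (OfNat.ofNat n : A) := by
  exact_mod_cast natCast n
lemma one : Cg 1 1 := by exact_mod_cast natCast 1
lemma zero : Cg 0 0 := by exact_mod_cast natCast 0

lemma pow {x : L} {s : A} (hs : Cg x s) (n : ℕ) : Cg (x ^ n) (s ^ n) := by
  induction n with
  | zero => simpa using one
  | succ n ih => rw [pow_succ, pow_succ]; exact ih.mul hs

lemma v_le_one {x : L} {s : A} (hs : Cg x s) : v x ≤ 1 := by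
  obtain ⟨a, b, hb, hx, h⟩ := hs
  have h1 := congrArg v hx
  rw [map_mul, v_coe_eq_one.2 hb, mul_one] at h1
  rw [h1]; exact v_coe_le_one a

lemma v_eq_one_iff {x : L} {s : A} (hs : Cg x s) : v x = 1 ↔ IsUnit s := by
  obtain ⟨a, b, hb, hx, h⟩ := hs
  have h1 := congrArg v hx
  rw [map_mul, v_coe_eq_one.2 hb, mul_one] at h1
  rw [h1, v_coe_eq_one]
  constructor
  · intro ha
    have := redR_isUnit ha
    rw [← h] at this; exact isUnit_of_mul_isUnit_right this
  · intro hu hd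
    exact redR_not_isUnit hd (h ▸ (redR_isUnit hb).mul hu)

lemma v_lt_one_iff {x : L} {s : A} (hs : Cg x s) : v x < 1 ↔ ¬ IsUnit s := by
  rw [← hs.v_eq_one_iff, lt_iff_le_and_ne]
  simp [hs.v_le_one]

lemma congr {x y : L} {s t : A} (hs : Cg x s) (h : x = y) (h' : s = t) : Cg y t := h ▸ h' ▸ hs

lemma inv {x : L} {s t : A} (hs : Cg x s) (h : s * t = 1) : Cg x⁻¹ t := by
  have hu : IsUnit s := IsUnit.of_mul_eq_one _ h
  have hv := hs.v_eq_one_iff.2 hu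
  obtain ⟨a, b, hb, hx, h'⟩ := hs
  have hx0 : x ≠ 0 := by rintro rfl; simp at hv
  have ha : ¬ p3 ∣ a := by
    rw [← v_coe_eq_one, ← hx, map_mul, hv, one_mul, v_coe_eq_one]; exact hb
  refine ⟨b, a, ha, ?_, ?_⟩
  · rw [← hx]; field_simp
  · linear_combination -t * h' + redR b * h
end Cg

lemma exists_Cg {x : L} (h : v x ≤ 1) : ∃ t, Cg x t := by
  obtain ⟨a, b, hab, hx⟩ := IsFractionRing.exists_reduced_fraction (A := 𝓞 L) x
  have hb0 : (b : 𝓞 L) ≠ 0 := nonZeroDivisors.coe_ne_zero b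
  have hx : x * toL b = toL a := by
    rw [← hx, IsFractionRing.mk'_eq_div]
    exact div_mul_cancel₀ _ (coe_ne_zero hb0)
  have hb : ¬ p3 ∣ (b : 𝓞 L) := by
    intro hd
    have h1 := congrArg v hx
    rw [map_mul] at h1
    have h2 : v (toL a) < 1 := by
      rw [← h1]; exact mul_lt_one_of_nonneg_of_lt_one_right h zero_le (v_coe_lt_one.2 hd)
    exact prime_p3.not_isUnit (hab (v_coe_lt_one.1 h2) hd)
  obtain ⟨u, hu⟩ := redR_isUnit hb
  exact ⟨↑u⁻¹ * redR a, a, b, hb, hx, by rw [← hu]; simp⟩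

/-- `√2` -/
noncomputable def α : L := toL al
/-- `√3` -/
noncomputable def β : L := toL be
/-- `√-1` -/
noncomputable def ι : L := toL ii
/-- a cube root of unity -/
noncomputable def ω : L := toL om

lemma α_sq : α ^ 2 = 2 := by
  have h := congrArg toL al_sq
  simp only [map_pow, map_add, map_mul, map_sub, map_neg, map_one, map_zero, toL_ofNat] at h; exact h
lemma β_sq : β ^ 2 = 3 := by
  have h := congrArg toL be_sq
  simp only [map_pow, map_add, map_mul, map_sub, map_neg, map_one, map_zero, toL_ofNat] at h; exact h
lemma ι_sq : ι ^ 2 = -1 := by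
  have h := congrArg toL ii_sq
  simp only [map_pow, map_add, map_mul, map_sub, map_neg, map_one, map_zero, toL_ofNat] at h; exact h
lemma ω_sq : ω ^ 2 + ω + 1 = 0 := by
  have h := congrArg toL om_sq
  simp only [map_pow, map_add, map_mul, map_sub, map_neg, map_one, map_zero, toL_ofNat] at h; exact h
lemma two_mul_ω : 2 * ω = ι * β - 1 := by
  have h := congrArg toL two_mul_om
  simp only [map_pow, map_add, map_mul, map_sub, map_neg, map_one, map_zero, toL_ofNat] at h; exact h
lemma ω_cube : ω ^ 3 = 1 := by linear_combination (ω - 1) * ω_sq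
lemma α_ne_zero : α ≠ 0 := by intro h; have := α_sq; rw [h] at this; norm_num at this
lemma β_ne_zero : β ≠ 0 := by intro h; have := β_sq; rw [h] at this; norm_num at this
lemma ι_ne_zero : ι ≠ 0 := by intro h; have := ι_sq; rw [h] at this; norm_num at this
lemma ω_ne_zero : ω ≠ 0 := by intro h; have := ω_sq; rw [h] at this; norm_num at this

@[simp] lemma conj_α : conjL α = α := congrArg toL conjR_al
@[simp] lemma conj_β : conjL β = β := congrArg toL conjR_be
@[simp] lemma conj_ι : conjL ι = -ι := by
  rw [ι, ← map_neg]; exact congrArg toL conjR_ii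
lemma conj_ω : conjL ω = ω ^ 2 := by
  have h : 2 * conjL ω = 2 * ω ^ 2 := by
    have := congrArg conjL two_mul_ω
    simp only [map_mul, map_sub, map_one, conj_ι, conj_β, map_ofNat] at this
    linear_combination this - 2 * ω_sq + two_mul_ω
  linear_combination h / 2

lemma Cg.α : Cg α ⟨0, 1, 0, 0⟩ := redR_al ▸ Cg.coe al
lemma Cg.β : Cg β ⟨0, 0, 1, 0⟩ := redR_be ▸ Cg.coe be
lemma Cg.ι : Cg ι ⟨0, 2, 0, 0⟩ := redR_ii ▸ Cg.coe ii
lemma Cg.ω : Cg ω ⟨4, 0, 0, 1⟩ := by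
  have h := redR_om ▸ Cg.coe om
  exact h.congr rfl (by decide +kernel)

lemma not_p3_dvd_p3' : ¬ p3 ∣ p3' := by
  intro h
  have hu : IsUnit (redR p3') := by
    refine IsUnit.of_mul_eq_one (⟨5, 0, 5, 2⟩ : A) ?_
    simp only [p3', map_sub, map_one, map_pow, redR_z]; decide +kernel
  exact redR_not_isUnit h hu

lemma v_coe_unit (u : (𝓞 L)ˣ) : v (toL u) = 1 := by
  rw [v_coe_eq_one]
  intro h
  exact prime_p3.not_isUnit (isUnit_of_dvd_unit h u.isUnit)

lemma v_β : v β = WithZero.exp (-1 : ℤ) := by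
  obtain ⟨u, hu⟩ := p3_mul_p3'
  have h := congrArg (fun x => v (toL x)) hu
  simp only [map_mul, v_coe_unit, mul_one, v_coe_eq_one.2 not_p3_dvd_p3'] at h
  rw [β, ← h]
  change V3.valuation L (algebraMap (𝓞 L) L p3) = _
  rw [HeightOneSpectrum.valuation_of_algebraMap]
  exact HeightOneSpectrum.intValuation_singleton _ prime_p3.ne_zero rfl

lemma v_three : v 3 = WithZero.exp (-2 : ℤ) := by
  rw [← β_sq, map_pow, v_β]; rfl

/-- The uniformizer `√3` in `A`. -/
def bA : A := ⟨0, 0, 1, 0⟩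

lemma bA_sq : bA ^ 2 = 3 := by decide

lemma A.ext_iff_mul (a b c d : ZMod 9) :
    (⟨a, b, c, d⟩ : A) = ⟨a, b, 0, 0⟩ + bA * ⟨c, d, 0, 0⟩ := by ext <;> simp [bA]

lemma ZMod.nine_mul_three {a : ZMod 9} (h : 3 * a = 0) : ∃ b, a = 3 * b := by
  revert a; decide +kernel

lemma A.three_mul_eq_zero {t : A} (h : 3 * t = 0) : ∃ s, t = 3 * s := by
  have h3 : (3 : A) = ⟨3, 0, 0, 0⟩ := by decide
  obtain ⟨a, b, c, d⟩ := t
  rw [h3, A.ext_iff] at h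
  simp only [A.mul_a, A.mul_b, A.mul_c, A.mul_d, zero_mul, mul_zero, add_zero, A.zero_a, A.zero_b,
    A.zero_c, A.zero_d] at h
  obtain ⟨ha, hb, hc, hd⟩ := h
  obtain ⟨a, rfl⟩ := ZMod.nine_mul_three ha
  obtain ⟨b, rfl⟩ := ZMod.nine_mul_three hb
  obtain ⟨c, rfl⟩ := ZMod.nine_mul_three hc
  obtain ⟨d, rfl⟩ := ZMod.nine_mul_three hd
  exact ⟨⟨a, b, c, d⟩, by rw [h3]; ext <;> simp⟩

lemma A.not_isUnit_bA_mul (s : A) : ¬ IsUnit (bA * s) := by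
  intro h
  have := (isUnit_of_mul_isUnit_left h).pow 4
  rw [show bA ^ 4 = 0 by decide +kernel] at this
  exact not_isUnit_zero this

lemma A.pow_eight_aux : ∀ a b : ZMod 9,
    (3 * a = 0 ∧ 3 * b = 0) ∨ 3 * ((⟨a, b, 0, 0⟩ : A) ^ 8 - 1) = 0 := by decide +kernel

lemma A.not_isUnit_iff {t : A} : ¬ IsUnit t ↔ ∃ s, t = bA * s := by
  constructor
  · intro h
    obtain ⟨a, b, c, d⟩ := t
    rcases A.pow_eight_aux a b with ⟨ha, hb⟩ | h8
    · obtain ⟨a, rfl⟩ := ZMod.nine_mul_three ha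
      obtain ⟨b, rfl⟩ := ZMod.nine_mul_three hb
      exact ⟨⟨c, d, a, b⟩, by ext <;> simp [bA]⟩
    · exfalso
      apply h
      obtain ⟨s, hs⟩ := A.three_mul_eq_zero h8
      obtain ⟨w, hw⟩ := sub_dvd_pow_sub_pow (⟨a, b, c, d⟩ : A) ⟨a, b, 0, 0⟩ 8
      rw [A.ext_iff_mul a b c d, add_sub_cancel_left] at hw
      rw [A.ext_iff_mul a b c d]
      refine isUnit_pow_iff (n := 8) (by norm_num) |>.1 ?_
      have : (⟨a, b, 0, 0⟩ + bA * ⟨c, d, 0, 0⟩ : A) ^ 8 =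
          1 + bA * (bA * s + ⟨c, d, 0, 0⟩ * w) := by
        linear_combination hw + hs - s * bA_sq
      rw [this]
      exact IsNilpotent.isUnit_one_add
        (Commute.isNilpotent_mul_right (Commute.all _ _) ⟨4, by decide +kernel⟩)
  · rintro ⟨s, rfl⟩; exact A.not_isUnit_bA_mul s

lemma A.pow_eight {t : A} (h : IsUnit t) : ∃ s, t ^ 8 = 1 + bA * s := by
  have h1 : ¬ IsUnit (t ^ 8 - 1) := by
    obtain ⟨a, b, c, d⟩ := t
    rcases A.pow_eight_aux a b with ⟨ha, hb⟩ | h8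
    · exfalso
      obtain ⟨a, rfl⟩ := ZMod.nine_mul_three ha
      obtain ⟨b, rfl⟩ := ZMod.nine_mul_three hb
      refine A.not_isUnit_iff.2 ⟨⟨c, d, a, b⟩, ?_⟩ h
      ext <;> simp [bA]
    · obtain ⟨s, hs⟩ := A.three_mul_eq_zero h8
      obtain ⟨w, hw⟩ := sub_dvd_pow_sub_pow (⟨a, b, c, d⟩ : A) ⟨a, b, 0, 0⟩ 8
      rw [A.ext_iff_mul a b c d, add_sub_cancel_left] at hw
      rw [A.ext_iff_mul a b c d]
      refine A.not_isUnit_iff.2 ⟨bA * s + ⟨c, d, 0, 0⟩ * w, ?_⟩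
      linear_combination hw + hs - s * bA_sq
  obtain ⟨s, hs⟩ := A.not_isUnit_iff.1 h1
  exact ⟨s, by rw [← hs]; ring⟩

/-- `24`-th powers of units are trivial modulo the third power of the prime. -/
lemma A.pow_24 {t : A} (h : IsUnit t) : bA * t ^ 24 = bA := by
  obtain ⟨s, hs⟩ := A.pow_eight h
  rw [show 24 = 8 * 3 by norm_num, pow_mul, hs]
  have h3 := bA_sq
  have h9 := A.nine_eq_zero
  linear_combination (3 * s + 3 * bA * s ^ 2 + (bA ^ 2 + 3) * s ^ 3) * bA_sq + (s + bA * s ^ 2 + s ^ 3) * h9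

/-- Reductions of products of powers of a system of units. -/
def g8 (a b c e f : Fin 3) : A :=
  (⟨4, 0, 0, 1⟩ ^ a.1 * ⟨1, 1, 0, 0⟩ ^ b.1 * ⟨0, 1, 1, 0⟩ ^ c.1 * ⟨2, 0, 1, 0⟩ ^ e.1 *
    ⟨0, 1, 0, 0⟩ ^ f.1) ^ 8

lemma g8_indep : ∀ b c e f : Fin 3, bA * g8 0 b c e f = bA → b = 0 ∧ c = 0 ∧ e = 0 ∧ f = 0 := by
  decide +kernel
lemma g8_om : ∀ a : Fin 3, bA * g8 a 0 0 0 0 = bA → a = 0 := by decide +kernel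

/-- `ω` as a unit. -/
noncomputable def e0 : (𝓞 L)ˣ := ⟨om, om ^ 2, by linear_combination (om - 1) * om_sq,
  by linear_combination (om - 1) * om_sq⟩
/-- `1 + √2` as a unit. -/
noncomputable def e1 : (𝓞 L)ˣ := ⟨1 + al, al - 1, by linear_combination al_sq,
  by linear_combination al_sq⟩
/-- `√2 + √3` as a unit. -/
noncomputable def e2 : (𝓞 L)ˣ := ⟨al + be, be - al, by linear_combination be_sq - al_sq,
  by linear_combination be_sq - al_sq⟩
/-- `2 + √3` as a unit. -/
noncomputable def e3 : (𝓞 L)ˣ := ⟨2 + be, 2 - be, by linear_combination -be_sq,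
  by linear_combination -be_sq⟩

/-- Complex conjugation on units. -/
noncomputable def conjU : (𝓞 L)ˣ →* (𝓞 L)ˣ := Units.map (conjR : 𝓞 L →* 𝓞 L)

lemma conjU_e0 : conjU e0 = e0⁻¹ := by
  ext
  change toL (conjR om) = toL (om ^ 2)
  rw [map_pow]; exact conj_ω
lemma conjU_e1 : conjU e1 = e1 := by
  ext; change toL (conjR (1 + al)) = toL (1 + al); rw [map_add, map_one, conjR_al]
lemma conjU_e2 : conjU e2 = e2 := by
  ext; change toL (conjR (al + be)) = toL (al + be); rw [map_add, conjR_be, conjR_al]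
lemma conjU_e3 : conjU e3 = e3 := by
  ext; change toL (conjR (2 + be)) = toL (2 + be); rw [map_add, conjR_be, map_ofNat]

lemma redR_units_pow_24 (w : (𝓞 L)ˣ) : bA * (redR (w : 𝓞 L)) ^ 24 = bA :=
  A.pow_24 (w.isUnit.map redR)

lemma fin_three (n : ℤ) : ∃ (m : Fin 3) (k : ℤ), n = m.1 + 3 * k := by
  refine ⟨⟨(n % 3).toNat, by omega⟩, n / 3, ?_⟩
  simp only; omega

/-- The subgroup-like family of products of the chosen units. -/
noncomputable def eprod (a b c e : ℤ) : (𝓞 L)ˣ := e0 ^ a * e1 ^ b * e2 ^ c * e3 ^ e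

lemma eprod_mul (a b c e a' b' c' e' : ℤ) :
    eprod a b c e * eprod a' b' c' e' = eprod (a + a') (b + b') (c + c') (e + e') := by
  simp only [eprod, zpow_add]
  simp only [mul_comm, mul_left_comm, mul_assoc]

lemma eprod_cube (a b c e : ℤ) : eprod (3 * a) (3 * b) (3 * c) (3 * e) = (eprod a b c e) ^ 3 := by
  simp only [eprod, mul_comm (3 : ℤ), zpow_mul, mul_pow]; rfl

lemma eprod_nat (a b c e : ℕ) : redR (eprod a b c e : (𝓞 L)ˣ) =
    ⟨4, 0, 0, 1⟩ ^ a * ⟨1, 1, 0, 0⟩ ^ b * ⟨0, 1, 1, 0⟩ ^ c * ⟨2, 0, 1, 0⟩ ^ e := by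
  have h0 : redR (e0 : 𝓞 L) = ⟨4, 0, 0, 1⟩ := by
    change redR om = _; rw [redR_om]; decide +kernel
  have h1 : redR (e1 : 𝓞 L) = ⟨1, 1, 0, 0⟩ := by
    change redR (1 + al) = _; rw [map_add, redR_al, map_one]; decide +kernel
  have h2 : redR (e2 : 𝓞 L) = ⟨0, 1, 1, 0⟩ := by
    change redR (al + be) = _; rw [map_add, redR_al, redR_be]; decide +kernel
  have h3 : redR (e3 : 𝓞 L) = ⟨2, 0, 1, 0⟩ := by
    change redR (2 + be) = _; rw [map_add, redR_be, map_ofNat]; decide +kernel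
  simp only [eprod, zpow_natCast, Units.val_mul, Units.val_pow_eq_pow_val, map_mul, map_pow, h0, h1,
    h2, h3]

lemma eprod_fin_cube {a b c e : Fin 3} {w : (𝓞 L)ˣ}
    (h : eprod a.1 b.1 c.1 e.1 = w ^ 3) : bA * g8 a b c e 0 = bA := by
  have h1 := redR_units_pow_24 w
  have h2 := congrArg (fun u : (𝓞 L)ˣ => redR (u : 𝓞 L)) h
  simp only [eprod_nat, Units.val_pow_eq_pow_val, map_pow] at h2
  rw [show redR (w : 𝓞 L) ^ 24 = (redR (w : 𝓞 L) ^ 3) ^ 8 from pow_mul _ 3 8, ← h2] at h1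
  simpa [g8] using h1

lemma eprod_real_cube {b c e : ℤ} {w : (𝓞 L)ˣ} (h : eprod 0 b c e = w ^ 3) :
    3 ∣ b ∧ 3 ∣ c ∧ 3 ∣ e := by
  obtain ⟨b, k, rfl⟩ := fin_three b
  obtain ⟨c, l, rfl⟩ := fin_three c
  obtain ⟨e, m, rfl⟩ := fin_three e
  have h1 : eprod (0 : Fin 3).1 b.1 c.1 e.1 = (w * (eprod 0 k l m)⁻¹) ^ 3 := by
    rw [mul_pow, ← h, inv_pow, ← eprod_cube, eq_mul_inv_iff_mul_eq, eprod_mul]; simp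
  obtain ⟨rfl, rfl, rfl, -⟩ := g8_indep _ _ _ _ (eprod_fin_cube h1)
  simp

lemma eprod_conj (a b c e : ℤ) :
    eprod a b c e * conjU (eprod a b c e) = eprod 0 (2 * b) (2 * c) (2 * e) := by
  have : conjU (eprod a b c e) = eprod (-a) b c e := by
    simp only [eprod, map_mul, map_zpow, conjU_e0, conjU_e1, conjU_e2, conjU_e3, inv_zpow', zpow_neg]
  rw [this, eprod_mul]; congr 1 <;> ring

lemma eprod_eq_cube {a b c e : ℤ} {w : (𝓞 L)ˣ} (h : eprod a b c e = w ^ 3) :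
    3 ∣ a ∧ 3 ∣ b ∧ 3 ∣ c ∧ 3 ∣ e := by
  have h1 : eprod 0 (2 * b) (2 * c) (2 * e) = (w * conjU w) ^ 3 := by
    rw [← eprod_conj a, h, map_pow, mul_pow]
  obtain ⟨hb, hc, he⟩ := eprod_real_cube h1
  obtain ⟨b, rfl⟩ : 3 ∣ b := by omega
  obtain ⟨c, rfl⟩ : 3 ∣ c := by omega
  obtain ⟨e, rfl⟩ : 3 ∣ e := by omega
  obtain ⟨a, k, rfl⟩ := fin_three a
  have h2 : eprod a.1 (0 : Fin 3).1 (0 : Fin 3).1 (0 : Fin 3).1 = (w * (eprod k b c e)⁻¹) ^ 3 := by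
    rw [mul_pow, ← h, inv_pow, ← eprod_cube, eq_mul_inv_iff_mul_eq, eprod_mul]; simp
  have := g8_om _ (eprod_fin_cube h2)
  subst this
  simp

lemma exists_eq_mul_cube {G I J : Type*} [CommGroup G] [Fintype I] [Fintype J]
    (f : I → G) (g : J → G) (hf : ∀ u, ∃ i w, u = f i * w ^ 3)
    (hg : ∀ j j' w, g j = g j' * w ^ 3 → j = j') (hc : Fintype.card J = Fintype.card I) (u : G) :
    ∃ j w, u = g j * w ^ 3 := by
  choose F W hF using hf
  have hinj : Function.Injective (fun j => F (g j)) := by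
    intro j j' h
    apply hg j j' ((W (g j')) ⁻¹ * W (g j))
    have h1 := hF (g j)
    have h2 := hF (g j')
    simp only at h
    rw [h] at h1
    calc g j = f (F (g j')) * W (g j) ^ 3 := h1
      _ = f (F (g j')) * W (g j') ^ 3 * ((W (g j'))⁻¹ * W (g j)) ^ 3 := by
        rw [mul_pow, ← mul_assoc, inv_pow, mul_inv_cancel_right]
      _ = _ := by rw [← h2]
  obtain ⟨j, hj⟩ := ((Fintype.bijective_iff_injective_and_card _).2 ⟨hinj, hc⟩).2 (F u)
  refine ⟨j, (W (g j))⁻¹ * W u, ?_⟩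
  simp only at hj
  have h1 := hF (g j)
  rw [hj] at h1
  calc u = f (F u) * W u ^ 3 := hF u
    _ = f (F u) * W (g j) ^ 3 * ((W (g j))⁻¹ * W u) ^ 3 := by
      rw [mul_pow, ← mul_assoc, inv_pow, mul_inv_cancel_right]
    _ = _ := by rw [← h1]

lemma units_rank : Units.rank L = 3 := by
  have h1 : InfinitePlace.nrComplexPlaces L = 4 := by
    rw [IsCyclotomicExtension.Rat.nrComplexPlaces_eq_totient_div_two 24]; decide
  have h2 := InfinitePlace.card_add_two_mul_card_eq_rank L
  rw [h1, finrank_L] at h2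
  rw [Units.rank, InfinitePlace.card_eq_nrRealPlaces_add_nrComplexPlaces, h1]
  omega

lemma units_mod_cubes (u : (𝓞 L)ˣ) : ∃ a b c e : ℤ, ∃ w, u = eprod a b c e * w ^ 3 := by
  obtain ⟨ζ, hζ⟩ := IsCyclic.exists_generator (α := Units.torsion L)
  let f : Fin 3 × (Fin (Units.rank L) → Fin 3) → (𝓞 L)ˣ :=
    fun i => (ζ : (𝓞 L)ˣ) ^ i.1.1 * ∏ k, Units.fundSystem L k ^ (i.2 k).1
  let g : Fin 3 × Fin 3 × Fin 3 × Fin 3 → (𝓞 L)ˣ :=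
    fun j => eprod j.1.1 j.2.1.1 j.2.2.1.1 j.2.2.2.1
  have hf : ∀ u, ∃ i w, u = f i * w ^ 3 := by
    intro u
    obtain ⟨⟨t, x⟩, hx, -⟩ := Units.exist_unique_eq_mul_prod L u
    obtain ⟨n, hn⟩ := Subgroup.mem_zpowers_iff.1 (hζ t)
    obtain ⟨m, k, rfl⟩ := fin_three n
    choose y l hy using fun i => fin_three (x i)
    refine ⟨⟨m, y⟩, (ζ : (𝓞 L)ˣ) ^ k * ∏ i, Units.fundSystem L i ^ (l i), ?_⟩
    rw [hx, ← hn]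
    simp only [f]
    simp_rw [hy, zpow_add, mul_comm (3 : ℤ), zpow_mul]
    rw [Finset.prod_mul_distrib]
    push_cast
    rw [mul_pow, ← Finset.prod_pow]
    simp only [zpow_natCast, zpow_ofNat]
    exact mul_mul_mul_comm _ _ _ _
  have hg : ∀ j j' w, g j = g j' * w ^ 3 → j = j' := by
    rintro ⟨a, b, c, e⟩ ⟨a', b', c', e'⟩ w h
    have h1 : eprod (a.1 - a'.1) (b.1 - b'.1) (c.1 - c'.1) (e.1 - e'.1) = w ^ 3 := by
      apply mul_left_cancel (a := eprod a'.1 b'.1 c'.1 e'.1)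
      rw [← h, eprod_mul]; simp [g]
    obtain ⟨ha, hb, hc, he⟩ := eprod_eq_cube h1
    simp only [Prod.mk.injEq, Fin.ext_iff]; omega
  obtain ⟨j, w, hw⟩ := exists_eq_mul_cube f g hf hg (by simp [units_rank]) u
  exact ⟨_, _, _, _, w, hw⟩

/-- The valuation of `x` is a multiple of three at every prime not dividing six. -/
def CubeVal (x : L) : Prop :=
  ∀ P : HeightOneSpectrum (𝓞 L), P.valuation L 6 = 1 → ∃ w, P.valuation L x = w ^ 3

namespace CubeVal

lemma mul {x y : L} (hx : CubeVal x) (hy : CubeVal y) : CubeVal (x * y) := fun P hP => by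
  obtain ⟨w, hw⟩ := hx P hP
  obtain ⟨w', hw'⟩ := hy P hP
  exact ⟨w * w', by rw [map_mul, hw, hw', mul_pow]⟩

lemma inv {x : L} (hx : CubeVal x) : CubeVal x⁻¹ := fun P hP => by
  obtain ⟨w, hw⟩ := hx P hP
  exact ⟨w⁻¹, by rw [map_inv₀, hw, inv_pow]⟩

lemma div {x y : L} (hx : CubeVal x) (hy : CubeVal y) : CubeVal (x / y) :=
  div_eq_mul_inv x y ▸ hx.mul hy.inv

lemma cube (x : L) : CubeVal (x ^ 3) := fun P _ => ⟨P.valuation L x, map_pow _ _ _⟩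

lemma of_mul_eq_pow {x y : L} {n : ℕ} (hx : ∃ a, x = toL a) (hy : ∃ a, y = toL a)
    (h : x * y = 6 ^ n) : CubeVal x := by
  obtain ⟨a, rfl⟩ := hx
  obtain ⟨b, rfl⟩ := hy
  intro P hP
  have h1 : P.valuation L (toL a) * P.valuation L (toL b) = 1 := by
    rw [← map_mul, h, map_pow, hP, one_pow]
  have h2 : P.valuation L (toL a) = 1 :=
    eq_one_of_one_le_mul_left (P.valuation_le_one a) (P.valuation_le_one b) h1.ge
  exact ⟨1, by rw [h2, one_pow]⟩

end CubeVal

noncomputable def δ₁ : L := 1 + ι * α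
noncomputable def δ₂ : L := 1 - ι * α

lemma δ₁_mul_δ₂ : δ₁ * δ₂ = 3 := by
  simp only [δ₁, δ₂]; linear_combination -α ^ 2 * ι_sq + α_sq
lemma δ₁_ne_zero : δ₁ ≠ 0 := left_ne_zero_of_mul (b := δ₂) (by rw [δ₁_mul_δ₂]; norm_num)
lemma δ₂_ne_zero : δ₂ ≠ 0 := right_ne_zero_of_mul (a := δ₁) (by rw [δ₁_mul_δ₂]; norm_num)

/-- Products of a unit, powers of the primes above six, and a cube. -/
def Good (x : L) : Prop :=
  ∃ (u : (𝓞 L)ˣ) (f g h : ℤ) (y : L), y ≠ 0 ∧ x = toL u * α ^ f * δ₁ ^ g * δ₂ ^ h * y ^ 3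

namespace Good

lemma mul {x y : L} (hx : Good x) (hy : Good y) : Good (x * y) := by
  obtain ⟨u, f, g, h, c, hc, rfl⟩ := hx
  obtain ⟨u', f', g', h', c', hc', rfl⟩ := hy
  refine ⟨u * u', f + f', g + g', h + h', c * c', mul_ne_zero hc hc', ?_⟩
  rw [zpow_add₀ α_ne_zero, zpow_add₀ δ₁_ne_zero, zpow_add₀ δ₂_ne_zero, Units.val_mul, map_mul]
  ring

lemma cube {x : L} (hx : x ≠ 0) : Good (x ^ 3) := ⟨1, 0, 0, 0, x, hx, by simp⟩

lemma unit (u : (𝓞 L)ˣ) : Good (toL u) := ⟨u, 0, 0, 0, 1, one_ne_zero, by simp⟩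

lemma toL_unit_inv (u : (𝓞 L)ˣ) : toL (u⁻¹ : (𝓞 L)ˣ) = (toL u)⁻¹ := by
  apply eq_inv_of_mul_eq_one_left
  rw [← map_mul, Units.inv_mul, map_one]

lemma inv {x : L} (hx : Good x) : Good x⁻¹ := by
  obtain ⟨u, f, g, h, c, hc, rfl⟩ := hx
  refine ⟨u⁻¹, -f, -g, -h, c⁻¹, inv_ne_zero hc, ?_⟩
  rw [toL_unit_inv, zpow_neg, zpow_neg, zpow_neg]
  simp only [mul_inv, inv_pow]

lemma of_sq {x : L} (h0 : x ≠ 0) (hx : Good (x ^ 2)) : Good x := by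
  have := (cube h0).mul hx.inv
  rwa [show x ^ 3 * (x ^ 2)⁻¹ = x by field_simp] at this

lemma α : Good α := ⟨1, 1, 0, 0, 1, one_ne_zero, by simp⟩
lemma δ₁ : Good δ₁ := ⟨1, 0, 1, 0, 1, one_ne_zero, by simp⟩
lemma δ₂ : Good δ₂ := ⟨1, 0, 0, 1, 1, one_ne_zero, by simp⟩

lemma p2_ne_zero : p2 ≠ 0 := fun h => by
  obtain ⟨u, hu⟩ := p2_pow_four
  rw [h] at hu
  exact mul_ne_zero two_ne_zero u.ne_zero (by rw [← hu]; ring)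

lemma p2 : Good (toL p2) := by
  obtain ⟨u, hu⟩ := p2_sq
  refine of_sq (coe_ne_zero p2_ne_zero) ?_
  rw [← map_pow, hu, map_mul]
  exact α.mul (unit u)

lemma toL_δ₁ : toL (1 + ii * al) = C1.δ₁ := by rw [map_add, map_mul, map_one]; rfl
lemma toL_δ₂ : toL (1 - ii * al) = C1.δ₂ := by rw [map_sub, map_mul, map_one]; rfl

lemma p3 : Good (toL p3) := by
  obtain ⟨u, hu⟩ := p3_sq
  refine of_sq (coe_ne_zero prime_p3.ne_zero) ?_
  rw [← map_pow, hu, map_mul, toL_δ₂]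
  exact δ₂.mul (unit u)

lemma p3' : Good (toL p3') := by
  obtain ⟨u, hu⟩ := p3'_sq
  refine of_sq (coe_ne_zero fun h => not_p3_dvd_p3' (h ▸ dvd_zero _)) ?_
  rw [← map_pow, hu, map_mul, toL_δ₁]
  exact δ₁.mul (unit u)

end Good

lemma good_of_prime_dvd_six {q : 𝓞 L} (hq : Prime q) (h6 : q ∣ 6) : Good (toL q) := by
  have hP : (Ideal.span {q}).IsPrime := (Ideal.span_singleton_prime hq.ne_zero).2 hq
  have key : ∀ {p : 𝓞 L}, Good (toL p) → Ideal.span {q} = Ideal.span {p} → Good (toL q) := by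
    intro p hp h
    obtain ⟨u, rfl⟩ := (Ideal.span_singleton_eq_span_singleton.1 h).symm
    rw [map_mul]; exact hp.mul (Good.unit u)
  rw [show (6 : 𝓞 L) = (2 : ℕ) * (3 : ℕ) by norm_num] at h6
  rcases hq.dvd_or_dvd h6 with h | h
  · have := liesOver_of_mem (P := Ideal.span {q}) Nat.prime_two (Ideal.mem_span_singleton.2 h)
    exact key Good.p2 eq_span_p2
  · have := liesOver_of_mem (P := Ideal.span {q}) Nat.prime_three (Ideal.mem_span_singleton.2 h)
    rcases eq_span_p3 (P := Ideal.span {q}) with h | h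
    · exact key Good.p3 h
    · exact key Good.p3' h

lemma cube_dvd_of_cubeVal {n q : 𝓞 L} (hn : n ≠ 0) (hq : Prime q) (h6 : ¬ q ∣ 6) (hqn : q ∣ n)
    (h : CubeVal (toL n)) : q ^ 3 ∣ n := by
  let P : HeightOneSpectrum (𝓞 L) := ⟨Ideal.span {q},
    (Ideal.span_singleton_prime hq.ne_zero).2 hq, by simpa using hq.ne_zero⟩
  have h6' : P.valuation L 6 = 1 := by
    rw [← toL_ofNat 6]
    refine le_antisymm (P.valuation_le_one _) (not_lt.1 fun hlt => h6 ?_)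
    exact Ideal.mem_span_singleton.1 ((P.valuation_lt_one_iff_mem _).1 hlt)
  obtain ⟨w, hw⟩ := h P h6'
  have hlt : P.valuation L (toL n) < 1 :=
    (P.valuation_lt_one_iff_mem _).2 (Ideal.mem_span_singleton.2 hqn)
  have hw0 : w ≠ 0 := by
    rintro rfl
    rw [zero_pow three_ne_zero, map_eq_zero] at hw
    exact coe_ne_zero hn hw
  obtain ⟨k, rfl⟩ : ∃ k : ℤ, w = WithZero.exp k := ⟨WithZero.log w, (WithZero.exp_log hw0).symm⟩
  rw [hw, ← WithZero.exp_nsmul, ← WithZero.exp_zero, WithZero.exp_lt_exp] at hlt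
  have : P.valuation L (toL n) ≤ WithZero.exp (-((3 : ℕ) : ℤ)) := by
    rw [hw, ← WithZero.exp_nsmul, WithZero.exp_le_exp]
    simp only [nsmul_eq_mul] at hlt ⊢
    push_cast at hlt ⊢; omega
  have hd : P.asIdeal ^ 3 ∣ Ideal.span {n} := (P.intValuation_le_pow_iff_dvd n 3).1 <| by
    rwa [← P.valuation_of_algebraMap (K := L)]
  rwa [Ideal.span_singleton_pow, Ideal.span_singleton_dvd_span_singleton_iff_dvd] at hd

lemma good_toL {n : 𝓞 L} (hn : n ≠ 0) (h : CubeVal (toL n)) : Good (toL n) := by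
  revert hn h
  refine WellFounded.induction (C := fun n => n ≠ 0 → CubeVal (toL n) → Good (toL n)) (wellFounded_dvdNotUnit (α := 𝓞 L)) n ?_
  clear n; intro n ih hn h
  by_cases hu : IsUnit n
  · obtain ⟨u, rfl⟩ := hu; exact Good.unit u
  obtain ⟨q, hq, m, rfl⟩ := WfDvdMonoid.exists_irreducible_factor hu hn
  have hq' := hq.prime
  have hm := right_ne_zero_of_mul hn
  by_cases h6 : q ∣ 6
  · have h1 : CubeVal (toL q) := by
      obtain ⟨r, hr⟩ := h6
      exact CubeVal.of_mul_eq_pow (n := 1) ⟨q, rfl⟩ ⟨r, rfl⟩ (by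
        rw [← map_mul, ← hr, toL_ofNat, pow_one])
    have h2 : CubeVal (toL m) := by
      have := h.div h1
      rwa [map_mul, mul_div_cancel_left₀ _ (coe_ne_zero hq'.ne_zero)] at this
    rw [map_mul]
    exact (good_of_prime_dvd_six hq' h6).mul
      (ih m ⟨hm, q, hq.not_isUnit, mul_comm _ _⟩ hm h2)
  · obtain ⟨m', hm'⟩ := cube_dvd_of_cubeVal hn hq' h6 (dvd_mul_right _ _) h
    rw [hm'] at hn h ih ⊢
    have hm0 := right_ne_zero_of_mul hn
    have h2 : CubeVal (toL m') := by
      have := h.div (CubeVal.cube (toL q))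
      rwa [map_mul, map_pow, mul_div_cancel_left₀ _ (pow_ne_zero _ (coe_ne_zero hq'.ne_zero))]
        at this
    rw [map_mul, map_pow]
    refine (Good.cube (coe_ne_zero hq'.ne_zero)).mul (ih m' ⟨hm0, q ^ 3, ?_, mul_comm _ _⟩ hm0 h2)
    exact fun hu => hq.not_isUnit (isUnit_pow_iff three_ne_zero |>.1 hu)

lemma good_of_cubeVal {x : L} (hx : x ≠ 0) (h : CubeVal x) : Good x := by
  obtain ⟨n, d, hd, hnd⟩ := IsFractionRing.div_surjective (A := 𝓞 L) x
  change toL n / toL d = x at hnd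
  have hd0 : d ≠ 0 := nonZeroDivisors.ne_zero hd
  have hn0 : n ≠ 0 := by rintro rfl; apply hx; rw [← hnd, map_zero, zero_div]
  have hd1 := coe_ne_zero hd0
  have h1 : x = toL (n * d ^ 2) * ((toL d) ^ 3)⁻¹ := by
    rw [← hnd, map_mul, map_pow]; field_simp
  have h2 : toL (n * d ^ 2) = x * toL d ^ 3 := by rw [h1]; field_simp
  rw [h1]
  refine Good.mul (good_toL (mul_ne_zero hn0 (pow_ne_zero _ hd0)) ?_) (Good.cube hd1).inv
  rw [h2]; exact h.mul (CubeVal.cube _)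

lemma toL_eprod (a b c e : ℤ) : toL (eprod a b c e : (𝓞 L)ˣ) =
    ω ^ a * (1 + α) ^ b * (α + β) ^ c * (2 + β) ^ e := by
  have hz : ∀ (u : (𝓞 L)ˣ) (n : ℤ), toL ((u ^ n : (𝓞 L)ˣ) : 𝓞 L) = toL u ^ n := by
    intro u n
    exact (congrArg Units.val (map_zpow (Units.map (toL : 𝓞 L →* L)) u n)).trans
      (Units.val_zpow_eq_zpow_val _ _)
  simp only [eprod, Units.val_mul, map_mul, hz]
  have h1 : toL e1 = 1 + α := by change toL (1 + al) = _; rw [map_add, map_one]; rfl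
  have h2 : toL e2 = α + β := by change toL (al + be) = _; rw [map_add]; rfl
  have h3 : toL e3 = 2 + β := by change toL (2 + be) = _; rw [map_add, map_ofNat]; rfl
  rw [h1, h2, h3]; rfl

theorem exists_eq_of_cubeVal {x : L} (hx : x ≠ 0) (h : CubeVal x) :
    ∃ (a b c e f g k : ℤ) (y : L), y ≠ 0 ∧
      x = ω ^ a * (1 + α) ^ b * (α + β) ^ c * (2 + β) ^ e * α ^ f * δ₁ ^ g * δ₂ ^ k * y ^ 3 := by
  obtain ⟨u, f, g, k, y, hy, rfl⟩ := good_of_cubeVal hx h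
  obtain ⟨a, b, c, e, w, rfl⟩ := units_mod_cubes u
  refine ⟨a, b, c, e, f, g, k, toL w * y, mul_ne_zero (coe_ne_zero w.ne_zero) hy, ?_⟩
  rw [Units.val_mul, map_mul, toL_eprod, Units.val_pow_eq_pow_val, map_pow]
  ring

lemma conj_δ₁ : conjL δ₁ = δ₂ := by simp only [δ₁, δ₂, map_add, map_mul, map_one, conj_ι, conj_α]; ring
lemma conj_δ₂ : conjL δ₂ = δ₁ := by simp only [δ₁, δ₂, map_sub, map_mul, map_one, conj_ι, conj_α]; ring
lemma conj_conj (x : L) : conjL (conjL x) = x := by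
  have h : (conjL.toAlgHom.comp conjL.toAlgHom : L →ₐ[ℚ] L) = AlgHom.id ℚ L := by
    apply (isPrimitiveRoot_zeta.powerBasis ℚ).algHom_ext
    rw [IsPrimitiveRoot.powerBasis_gen]
    change conjL (conjL (z : L)) = (z : L)
    rw [conjL_z, map_inv₀, conjL_z, inv_inv]
  exact DFunLike.congr_fun h x

lemma Cg.δ₁ : Cg δ₁ ⟨5, 0, 0, 0⟩ :=
  (Cg.one.add (Cg.ι.mul Cg.α)).congr rfl (by decide +kernel)

lemma v_δ₁ : v δ₁ = 1 := Cg.δ₁.v_eq_one_iff.2 (IsUnit.of_mul_eq_one (2 : A) (by decide +kernel))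

lemma v_δ₂ : v δ₂ = WithZero.exp (-2 : ℤ) := by
  have := congrArg v δ₁_mul_δ₂
  rwa [map_mul, v_δ₁, one_mul, v_three] at this

lemma v_ω : v ω = 1 := by
  have h : v ω ^ 3 = 1 := by rw [← map_pow, ω_cube, map_one]
  exact (pow_eq_one_iff_of_nonneg zero_le three_ne_zero).1 h

lemma v_α : v α = 1 := Cg.α.v_eq_one_iff.2 (IsUnit.of_mul_eq_one (⟨0, 5, 0, 0⟩ : A) (by decide +kernel))

lemma v_eq_one_of_pow {x : L} {n : ℕ} (hn : n ≠ 0) (h : v (x ^ n) = 1) : v x = 1 :=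
  (pow_eq_one_iff_of_nonneg zero_le hn).1 (map_pow v x n ▸ h)

lemma v_eprod (a b c e : ℤ) : v (ω ^ a * (1 + α) ^ b * (α + β) ^ c * (2 + β) ^ e) = 1 := by
  rw [← toL_eprod, v_coe_unit]

lemma eprod_ne_zero (a b c e : ℤ) : ω ^ a * (1 + α) ^ b * (α + β) ^ c * (2 + β) ^ e ≠ 0 :=
  (map_ne_zero v).1 (by rw [v_eprod]; exact one_ne_zero)

lemma exists_v_eq_exp {x : L} (hx : x ≠ 0) : ∃ n : ℤ, v x = WithZero.exp n :=
  ⟨WithZero.log (v x), (WithZero.exp_log ((map_ne_zero v).2 hx)).symm⟩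

theorem exists_eq_of_mul_conj_eq_one {ρ : L} (h : ρ * conjL ρ = 1) (hQ : CubeVal ρ) :
    ∃ (a f : Fin 3) (y : L), y ≠ 0 ∧ ρ = ω ^ a.1 * (δ₁ / δ₂) ^ f.1 * y ^ 3 := by
  have h0 : ρ ≠ 0 := left_ne_zero_of_mul_eq_one h
  obtain ⟨a, b, c, e, f, g, k, y, hy, hρ⟩ := exists_eq_of_cubeVal h0 hQ
  have hy' : conjL y ≠ 0 := (map_ne_zero _).2 hy
  have hE := eprod_ne_zero 0 b c e
  set E : L := ω ^ (0 : ℤ) * (1 + α) ^ b * (α + β) ^ c * (2 + β) ^ e with hE_def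
  have hcE : conjL E = E := by
    simp only [hE_def, map_mul, map_zpow₀, map_add, map_one, conj_α, conj_β, map_ofNat, zpow_zero]
  have h1 : ρ = ω ^ a * E * α ^ f * δ₁ ^ g * δ₂ ^ k * y ^ 3 := by
    rw [hρ, hE_def, zpow_zero, one_mul]; ring
  have h2 : conjL ρ = (ω ^ 2) ^ a * E * α ^ f * δ₂ ^ g * δ₁ ^ k * conjL y ^ 3 := by
    rw [h1]; simp only [map_mul, map_zpow₀, hcE, conj_ω, conj_α, conj_δ₁, conj_δ₂, map_pow]
  have hω := ω_ne_zero
  have hα := α_ne_zero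
  have hd1 := δ₁_ne_zero
  have hd2 := δ₂_ne_zero
  have hω3 : (ω ^ 2) ^ a = (ω ^ a)⁻¹ := by
    rw [← inv_zpow]; congr 1; exact eq_inv_of_mul_eq_one_left (by linear_combination ω_cube)
  have h3 : ρ = ω ^ a * (δ₁ / δ₂) ^ (k - g) * (conjL y * ω ^ (-a) / y * ρ) ^ 3 := by
    have h4 : ρ ^ 2 = ω ^ a * ω ^ a * (δ₁ / δ₂) ^ (g - k) * (y / conjL y) ^ 3 := by
      have : ρ ^ 2 = ρ / conjL ρ := by
        rw [eq_div_iff ((map_ne_zero _).2 h0)]; linear_combination ρ * h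
      rw [this, h2, hω3, h1, zpow_sub₀ (div_ne_zero hd1 hd2), div_zpow, div_zpow]
      field_simp
    have hX := zpow_ne_zero a hω
    have hD := zpow_ne_zero (g - k) (div_ne_zero hd1 hd2)
    rw [← neg_sub g k, zpow_neg, zpow_neg]
    generalize (δ₁ / δ₂) ^ (g - k) = D at *
    generalize ω ^ a = X at *
    have hρ2 := pow_ne_zero 2 h0
    calc ρ = ρ * (ρ ^ 2 / ρ ^ 2) := by rw [div_self hρ2, mul_one]
      _ = ρ * (ρ ^ 2 / (X * X * D * (y / conjL y) ^ 3)) := by rw [← h4]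
      _ = _ := by field_simp
  have hc : conjL y * ω ^ (-a) / y * ρ ≠ 0 := by positivity
  generalize conjL y * ω ^ (-a) / y * ρ = c at *
  obtain ⟨a', l, rfl⟩ := fin_three a
  obtain ⟨f', m, hm⟩ := fin_three (k - g)
  refine ⟨a', f', ω ^ l * (δ₁ / δ₂) ^ m * c, by positivity, ?_⟩
  rw [h3, hm, zpow_add₀ hω, zpow_add₀ (div_ne_zero hd1 hd2), mul_comm (3 : ℤ), mul_comm (3 : ℤ),
    zpow_mul, zpow_mul, zpow_natCast, zpow_natCast]
  simp only [mul_pow]; norm_cast; ring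

/-- Valuation of an element of the form `ω ^ a * (δ₁ / δ₂) ^ f * y ^ 3`. -/
lemma v_eq_exp_of_eq {ρ y : L} {a f : ℕ} (hy : y ≠ 0) (h : ρ = ω ^ a * (δ₁ / δ₂) ^ f * y ^ 3) :
    ∃ n : ℤ, v ρ = WithZero.exp (2 * f + 3 * n) := by
  obtain ⟨n, hn⟩ := exists_v_eq_exp hy
  refine ⟨n, ?_⟩
  rw [h, map_mul, map_mul, map_pow, map_pow, map_pow, v_ω, map_div₀, v_δ₁, v_δ₂, hn, one_pow,
    one_mul, one_div, ← WithZero.exp_neg, ← WithZero.exp_nsmul, ← WithZero.exp_nsmul,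
    ← WithZero.exp_add]
  congr 1; simp only [nsmul_eq_mul]; push_cast; ring

/-- An element of value one, fixed by conjugation, with cube valuations and an admissible residue,
is a cube. -/
theorem exists_eq_cube {x : L} {t : A} (hx : conjL x = x) (hv : v x = 1) (hQ : CubeVal x)
    (ht : Cg (x ^ 8) t) (hb : bA * t = bA) : ∃ c, conjL c = c ∧ x = c ^ 3 := by
  have h0 : x ≠ 0 := (map_ne_zero v).1 (by rw [hv]; exact one_ne_zero)
  obtain ⟨a, b, c, e, f, g, k, y, hy, hρ⟩ := exists_eq_of_cubeVal h0 hQ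
  have hy' : conjL y ≠ 0 := (map_ne_zero _).2 hy
  have hE := eprod_ne_zero 0 b c e
  have hω := ω_ne_zero
  have hα := α_ne_zero
  have hd1 := δ₁_ne_zero
  have hd2 := δ₂_ne_zero
  have hωa : (ω ^ 2) ^ a = (ω ^ a)⁻¹ := by
    rw [← inv_zpow]; congr 1; exact eq_inv_of_mul_eq_one_left (by linear_combination ω_cube)
  obtain ⟨w, hw, hcw, h1⟩ : ∃ w, w ≠ 0 ∧ conjL w = w ∧
      x = (ω ^ (0 : ℤ) * (1 + α) ^ b * (α + β) ^ c * (2 + β) ^ e) * α ^ f * 3 ^ (-(g + k)) *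
        w ^ 3 := by
    set E : L := ω ^ (0 : ℤ) * (1 + α) ^ b * (α + β) ^ c * (2 + β) ^ e with hE_def
    have hcE : conjL E = E := by
      simp only [hE_def, map_mul, map_zpow₀, map_add, map_one, conj_α, conj_β, map_ofNat, zpow_zero]
    have h1 : x = ω ^ a * E * α ^ f * δ₁ ^ g * δ₂ ^ k * y ^ 3 := by
      rw [hρ, hE_def, zpow_zero, one_mul]; ring
    have h2 : x = (ω ^ a)⁻¹ * E * α ^ f * δ₂ ^ g * δ₁ ^ k * conjL y ^ 3 := by
      rw [← hx, h1]
      simp only [map_mul, map_zpow₀, hcE, conj_ω, conj_α, conj_δ₁, conj_δ₂, map_pow, hωa]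
    have h3 : x ^ 2 = (E * α ^ f) ^ 2 * 3 ^ (g + k) * (y * conjL y) ^ 3 := by
      rw [← δ₁_mul_δ₂, mul_zpow, zpow_add₀ hd1, zpow_add₀ hd2]
      calc x ^ 2 = x * x := sq x
        _ = (ω ^ a * E * α ^ f * δ₁ ^ g * δ₂ ^ k * y ^ 3) *
            ((ω ^ a)⁻¹ * E * α ^ f * δ₂ ^ g * δ₁ ^ k * conjL y ^ 3) := by rw [← h1, ← h2]
        _ = (ω ^ a * (ω ^ a)⁻¹) * ((E * α ^ f) ^ 2 * (δ₁ ^ g * δ₁ ^ k * (δ₂ ^ g * δ₂ ^ k)) *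
            (y * conjL y) ^ 3) := by ring
        _ = _ := by rw [mul_inv_cancel₀ (zpow_ne_zero a hω), one_mul]
    refine ⟨x / (E * α ^ f * (y * conjL y)), by positivity, ?_, ?_⟩
    · simp only [map_div₀, map_mul, map_zpow₀, hx, hcE, conj_α, conj_conj]
      rw [mul_comm (conjL y)]
    · have hx2 := pow_ne_zero 2 h0
      rw [zpow_neg]
      have hT := zpow_ne_zero (g + k) (three_ne_zero (α := L))
      generalize (3 : L) ^ (g + k) = T at *
      calc x = x * (x ^ 2 / x ^ 2) := by rw [div_self hx2, mul_one]
        _ = x * (x ^ 2 / ((E * α ^ f) ^ 2 * T * (y * conjL y) ^ 3)) := by rw [← h3]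
        _ = _ := by field_simp
  obtain ⟨n, hn⟩ := exists_v_eq_exp hw
  obtain ⟨m, hm⟩ : ∃ m : ℤ, -(g + k) = 3 * m := by
    have := congrArg v h1
    rw [map_mul, map_mul, map_mul, v_eprod, map_zpow₀, map_zpow₀, map_pow, v_α, v_three, hv, hn,
      one_zpow, one_mul, one_mul, ← WithZero.exp_zsmul, ← WithZero.exp_nsmul, ← WithZero.exp_add,
      ← WithZero.exp_zero, WithZero.exp_inj] at this
    simp only [zsmul_eq_mul, nsmul_eq_mul] at this
    push_cast at this
    have h3 : (3 : ℤ) ∣ -(g + k) := by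
      have : 2 * (-(g + k)) = 3 * n := by linarith
      omega
    exact h3
  obtain ⟨b', kb, rfl⟩ := fin_three b
  obtain ⟨c', kc, rfl⟩ := fin_three c
  obtain ⟨e', ke, rfl⟩ := fin_three e
  obtain ⟨f', kf, rfl⟩ := fin_three f
  set y' : L := (ω ^ (0 : ℤ) * (1 + α) ^ kb * (α + β) ^ kc * (2 + β) ^ ke) * α ^ kf * 3 ^ m * w
  have hcy : conjL y' = y' := by
    simp only [y', map_mul, map_zpow₀, map_add, map_one, conj_α, conj_β, map_ofNat, zpow_zero, hcw]
  have n1 : 1 + α ≠ 0 := by simpa using eprod_ne_zero 0 1 0 0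
  have n2 : α + β ≠ 0 := by simpa using eprod_ne_zero 0 0 1 0
  have n3 : 2 + β ≠ 0 := by simpa using eprod_ne_zero 0 0 0 1
  have h2 : x = (1 + α) ^ b'.1 * (α + β) ^ c'.1 * (2 + β) ^ e'.1 * α ^ f'.1 * y' ^ 3 := by
    rw [h1, hm, zpow_add₀ n1, zpow_add₀ n2, zpow_add₀ n3, zpow_add₀ hα]
    simp only [y', mul_comm (3 : ℤ), zpow_mul, zpow_natCast, zpow_zero, mul_pow]
    norm_cast; ring
  have cg1 : Cg (1 + α) ⟨1, 1, 0, 0⟩ := (Cg.one.add Cg.α).congr rfl (by decide +kernel)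
  have cg2 : Cg (α + β) ⟨0, 1, 1, 0⟩ := (Cg.α.add Cg.β).congr rfl (by decide +kernel)
  have cg3 : Cg (2 + β) ⟨2, 0, 1, 0⟩ := ((Cg.ofNat 2).add Cg.β).congr rfl (by decide +kernel)
  have hvy : v y' = 1 := by
    apply v_eq_one_of_pow (n := 3) three_ne_zero
    have := congrArg v h2
    have e1 : v (1 + α) = 1 := by simpa using v_eprod 0 1 0 0
    have e2 : v (α + β) = 1 := by simpa using v_eprod 0 0 1 0
    have e3 : v (2 + β) = 1 := by simpa using v_eprod 0 0 0 1
    simp only [map_mul, map_pow, e1, e2, e3, v_α, one_pow, one_mul, hv] at this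
    rw [map_pow, ← this]
  obtain ⟨s, hs⟩ := exists_Cg hvy.le
  have hsu := A.pow_24 (hs.v_eq_one_iff.1 hvy)
  have h3 : Cg (x ^ 8) (g8 0 b' c' e' f' * s ^ 24) := by
    refine ((((((cg1.pow b'.1).mul (cg2.pow c'.1)).mul (cg3.pow e'.1)).mul (Cg.α.pow f'.1)).mul
      (hs.pow 3)).pow 8).congr (by rw [h2]) ?_
    simp only [g8, Fin.val_zero, pow_zero, one_mul]; ring
  have h4 : bA * g8 0 b' c' e' f' = bA := by
    rw [ht.unique h3] at hb
    calc bA * g8 0 b' c' e' f' = (bA * s ^ 24) * g8 0 b' c' e' f' := by rw [hsu]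
      _ = bA * (g8 0 b' c' e' f' * s ^ 24) := by ring
      _ = _ := hb
  obtain ⟨rfl, rfl, rfl, rfl⟩ := g8_indep _ _ _ _ h4
  exact ⟨y', hcy, by simpa using h2⟩

/-- The coefficient `η = δ / β` of the auxiliary elliptic curves. -/
noncomputable def η : L := 4 * α * β - 16 + 4 * α

/-- The coefficient of the auxiliary elliptic curves `g (g² + 1) = δ Z³` and
`τ (1 - τ²) = δ W³`. -/
noncomputable def δ : L := β * η

lemma η_mul : η * ((-16 - 4 * α - 4 * α * β) * (2 + β)) = 64 := by
  simp only [η]; linear_combination (-16 * β^3 - 64 * β^2 - 80 * β - 32) * α_sq + (-32 * β - 128) * β_sq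

lemma η_ne_zero : η ≠ 0 := left_ne_zero_of_mul (b := (-16 - 4 * α - 4 * α * β) * (2 + β)) (by
  rw [η_mul]; norm_num)

lemma δ_ne_zero : δ ≠ 0 := mul_ne_zero β_ne_zero η_ne_zero

@[simp] lemma conj_η : conjL η = η := by
  simp only [η, map_add, map_sub, map_mul, conj_α, conj_β, map_ofNat]
@[simp] lemma conj_δ : conjL δ = δ := by rw [δ, map_mul, conj_β, conj_η]

/-- The reduction of `η`. -/
def ηA : A := ⟨2, 4, 0, 4⟩
/-- The reduction of `ι`. -/
def iA : A := ⟨0, 2, 0, 0⟩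

lemma Cg.η : Cg η ηA :=
  (((((Cg.ofNat 4).mul Cg.α).mul Cg.β).sub (Cg.ofNat 16)).add ((Cg.ofNat 4).mul Cg.α)).congr rfl
    (by decide +kernel)

lemma isUnit_ηA : IsUnit ηA := IsUnit.of_mul_eq_one (⟨4, 7, 2, 6⟩ : A) (by decide +kernel)

lemma v_η : v η = 1 := Cg.η.v_eq_one_iff.2 isUnit_ηA

lemma valuation_eq_one_of_mul_eq_pow {P : HeightOneSpectrum (𝓞 L)} (hP : P.valuation L 6 = 1)
    {a b : 𝓞 L} {n : ℕ} (h : toL a * toL b = 6 ^ n) : P.valuation L (toL a) = 1 := by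
  have h1 : P.valuation L (toL a) * P.valuation L (toL b) = 1 := by
    rw [← map_mul, h, map_pow, hP, one_pow]
  exact eq_one_of_one_le_mul_left (P.valuation_le_one a) (P.valuation_le_one b) h1.ge

lemma valuation_two {P : HeightOneSpectrum (𝓞 L)} (hP : P.valuation L 6 = 1) :
    P.valuation L 2 = 1 := by
  rw [← toL_ofNat]
  refine valuation_eq_one_of_mul_eq_pow hP (b := 3) (n := 1) ?_
  rw [toL_ofNat, toL_ofNat]; norm_num

lemma valuation_δ {P : HeightOneSpectrum (𝓞 L)} (hP : P.valuation L 6 = 1) :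
    P.valuation L δ = 1 := by
  have h1 : δ = toL (be * (4 * al * be - 16 + 4 * al)) := by
    simp only [map_mul, map_add, map_sub]; rfl
  rw [h1]
  refine valuation_eq_one_of_mul_eq_pow hP
    (b := be * ((-16 - 4 * al - 4 * al * be) * (2 + be)) * 243) (n := 6) ?_
  rw [← h1]
  simp only [map_mul, map_add, map_sub, map_neg]
  change δ * (β * ((-16 - 4 * α - 4 * α * β) * (2 + β)) * 243) = 6 ^ 6
  rw [δ]; linear_combination 243 * β ^ 2 * η_mul + 64 * 243 * β_sq

lemma valuation_ι (P : HeightOneSpectrum (𝓞 L)) : P.valuation L ι = 1 := by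
  have h : P.valuation L ι ^ 4 = 1 := by
    rw [← map_pow, show ι ^ 4 = 1 by linear_combination (ι ^ 2 - 1) * ι_sq, map_one]
  exact (pow_eq_one_iff_of_nonneg zero_le (by norm_num)).1 h

/-- If `s (1 - s²)` is a cube up to a unit then `(1 + s) / (1 - s)` has cube valuation. -/
lemma exists_valuation_eq_cube {w : Valuation L (WithZero (Multiplicative ℤ))} {s ε Z : L}
    (h : s * ((1 + s) * (1 - s)) = ε * Z ^ 3) (hε : w ε = 1) (h2 : w 2 = 1) :
    ∃ y, w ((1 + s) / (1 - s)) = y ^ 3 := by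
  have hprod : w s * (w (1 + s) * w (1 - s)) = w Z ^ 3 := by
    rw [← map_mul, ← map_mul, h, map_mul, hε, one_mul, map_pow]
  rw [map_div₀]
  rcases lt_or_ge 1 (w s) with hs | hs
  · have hs' : w 1 < w s := by rwa [map_one]
    have h1 : w (1 + s) = w s := w.map_add_eq_of_lt_right hs'
    have h2 : w (1 - s) = w s := w.map_sub_eq_of_lt_right hs'
    refine ⟨1, ?_⟩
    rw [h1, h2, div_self (zero_lt_one' (WithZero (Multiplicative ℤ)) |>.trans hs).ne', one_pow]
  · have l1 : w (1 + s) ≤ 1 := (w.map_add _ _).trans (by simp [hs])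
    have l2 : w (1 - s) ≤ 1 := (w.map_sub _ _).trans (by simp [hs])
    have key : ∀ {x y : L}, x + y = 2 → w x < 1 → w y ≤ 1 → w y = 1 := by
      intro x y hxy hx hy
      refine le_antisymm hy (not_lt.1 fun hlt => ?_)
      have := w.map_add_lt hx hlt
      rw [hxy, h2] at this
      exact lt_irrefl _ this
    have hs1 : ∀ {x : L}, (x = 1 + s ∨ x = 1 - s) → w x < 1 → w s = 1 := by
      rintro x (rfl | rfl) hx
      · refine le_antisymm hs (not_lt.1 fun hlt => ?_)
        have := w.map_sub_lt hx hlt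
        rw [add_sub_cancel_right, map_one] at this
        exact lt_irrefl _ this
      · refine le_antisymm hs (not_lt.1 fun hlt => ?_)
        have := w.map_add_lt hx hlt
        rw [sub_add_cancel, map_one] at this
        exact lt_irrefl _ this
    rcases l1.lt_or_eq with h1 | h1
    · refine ⟨w Z, ?_⟩
      rw [key (by ring) h1 l2, hs1 (Or.inl rfl) h1, one_mul, mul_one] at hprod
      rw [key (by ring) h1 l2, hprod, div_one]
    · rcases l2.lt_or_eq with h3 | h3
      · refine ⟨(w Z)⁻¹, ?_⟩
        rw [h1, hs1 (Or.inr rfl) h3, one_mul, one_mul] at hprod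
        rw [h1, hprod, inv_pow, one_div]
      · exact ⟨1, by rw [h1, h3]; simp⟩

lemma cubeVal_ratio_g {g Z : L} (h : g * (g ^ 2 + 1) = δ * Z ^ 3) :
    CubeVal ((1 + ι * g) / (1 - ι * g)) := fun P hP => by
  refine exists_valuation_eq_cube (ε := ι * δ) (Z := Z) ?_ ?_ (valuation_two hP)
  · linear_combination ι * h - ι * g ^ 3 * ι_sq
  · rw [map_mul, valuation_δ hP, valuation_ι, one_mul]

lemma cubeVal_ratio_τ {τ W : L} (h : τ * (1 - τ ^ 2) = δ * W ^ 3) :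
    CubeVal ((1 + τ) / (1 - τ)) := fun P hP => by
  refine exists_valuation_eq_cube (ε := δ) (Z := W) ?_ (valuation_δ hP) (valuation_two hP)
  linear_combination h

namespace Cg

lemma div {x y : L} {s t : A} (hx : Cg x s) (hy : Cg y t) (ht : IsUnit t) :
    ∃ r, Cg (x / y) r ∧ r * t = s := by
  obtain ⟨t', ht'⟩ := ht.exists_right_inv
  exact ⟨s * t', div_eq_mul_inv x y ▸ hx.mul (hy.inv ht'), by linear_combination s * ht'⟩

lemma div_β {x : L} {s : A} (hx : Cg x s) (hs : ¬ IsUnit s) : ∃ r, Cg (x / C1.β) r ∧ bA * r = s := by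
  have h0 : v x ≤ WithZero.exp (-1 : ℤ) := by
    have h := hx.v_lt_one_iff.2 hs
    by_cases hx0 : x = 0
    · rw [hx0, map_zero]; exact zero_le
    obtain ⟨n, hn⟩ := exists_v_eq_exp hx0
    rw [hn, ← WithZero.exp_zero, WithZero.exp_lt_exp] at h
    rw [hn, WithZero.exp_le_exp]; omega
  have h1 : v (x / C1.β) ≤ 1 := by
    rw [map_div₀, v_β]; exact div_le_one_of_le₀ h0 zero_le
  obtain ⟨r, hr⟩ := exists_Cg h1
  refine ⟨r, hr, Cg.unique ((Cg.β.mul hr).congr ?_ rfl) hx⟩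
  have := β_ne_zero
  field_simp

end Cg

/-- Congruence modulo the uniformizer implies congruence of cubes modulo its square. -/
lemma A.three_mul_pow_three {t ε : A} (h : 3 * bA * t = 3 * bA * ε) : 3 * t ^ 3 = 3 * ε ^ 3 := by
  obtain ⟨w, hw⟩ : ∃ w, t - ε = bA * w := by
    rw [← A.not_isUnit_iff]
    intro hu
    obtain ⟨r, hr⟩ := hu.exists_right_inv
    have : 3 * bA = 0 := by linear_combination r * h - 3 * bA * hr
    exact absurd this (by decide +kernel)
  have h9 := A.nine_eq_zero
  rw [show t = ε + bA * w by linear_combination hw]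
  linear_combination (ε ^ 2 * bA * w + ε * w ^ 2 * bA ^ 2) * h9 + (3 * bA * w ^ 3) * bA_sq +
    (bA * w ^ 3) * h9

/-- The reduction of `ω`. -/
def omA : A := ⟨4, 0, 0, 1⟩

lemma iA_sq : iA ^ 2 = -1 := by decide +kernel

namespace A

/-- Congruence modulo the annihilator of `c`. -/
def Eqv (c x y : A) : Prop := c * x = c * y

instance (c x y : A) : Decidable (Eqv c x y) := inferInstanceAs (Decidable (c * x = c * y))

namespace Eqv
lemma rfl {c x : A} : Eqv c x x := Eq.refl _
lemma symm {c x y : A} (h : Eqv c x y) : Eqv c y x := Eq.symm h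
lemma trans {c x y z : A} (h : Eqv c x y) (h' : Eqv c y z) : Eqv c x z := Eq.trans h h'
lemma mul {c x y x' y' : A} (h : Eqv c x y) (h' : Eqv c x' y') : Eqv c (x * x') (y * y') := by
  unfold Eqv at *; linear_combination x' * h + y * h'
lemma sub {c x y x' y' : A} (h : Eqv c x y) (h' : Eqv c x' y') : Eqv c (x - x') (y - y') := by
  unfold Eqv at *; linear_combination h - h'
lemma pow {c x y : A} (h : Eqv c x y) (n : ℕ) : Eqv c (x ^ n) (y ^ n) := by
  induction n with
  | zero => rw [pow_zero, pow_zero]; exact rfl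
  | succ n ih => rw [pow_succ, pow_succ]; exact ih.mul h
end Eqv

lemma not_eqv_near : ∀ a j : Fin 3, ¬ Eqv bA (ηA ^ 8) ((omA ^ a.1 * (25 * (iA + bA * (((j.1 : ℕ) : A) - 1) * ηA) *
    (1 - iA * (iA + bA * (((j.1 : ℕ) : A) - 1) * ηA)) ^ 2)) ^ 8) := by
  decide +kernel

lemma false_of_near {s q t r : A} {a : Fin 3} (j : Fin 3) (ht : 3 * t ^ 3 = 3 * (((j.1 : ℕ) : A) - 1))
    (hs : s = iA + bA * q) (hE : s * (s ^ 2 + 1) = bA * ηA * t ^ 3) (hr : IsUnit r)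
    (hρ : ηA = omA ^ a.1 * (25 * s * (1 - iA * s) ^ 2) * r ^ 3) : False := by
  have h9 := nine_eq_zero
  generalize hε : ((j.1 : ℕ) : A) - 1 = ε at ht
  have h1 : Eqv bA s (iA + bA * ε * ηA) := by
    have h3q : 3 * q = 3 * ηA * ε := by
      rw [hs] at hE
      linear_combination bA * hE + ηA * ht
        + (-bA * iA - 3 * q * bA ^ 2) * iA_sq
        + (ηA * t ^ 3 + 2 * q - 3 * q ^ 2 * iA * bA - q ^ 3 * (bA ^ 2 + 3)) * bA_sq
        + (q - q ^ 2 * iA * bA - q ^ 3) * h9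
    unfold Eqv
    rw [hs]; linear_combination h3q + (q - ε * ηA) * bA_sq
  have h2 : Eqv bA (ηA ^ 8) ((omA ^ a.1 * (25 * s * (1 - iA * s) ^ 2)) ^ 8) := by
    rw [hρ, mul_pow _ (r ^ 3), ← pow_mul]
    refine (Eqv.rfl.mul (?_ : Eqv bA _ 1)).trans (by rw [mul_one]; exact Eqv.rfl)
    unfold Eqv; rw [mul_one]; exact pow_24 hr
  refine not_eqv_near a j (h2.trans (Eqv.pow (Eqv.rfl.mul ?_) 8))
  rw [hε]
  exact (Eqv.rfl.mul h1).mul ((Eqv.rfl.sub (Eqv.rfl.mul h1)).pow 2)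

lemma not_eqv_small : ∀ a j : Fin 3, j ≠ 1 →
    ¬ Eqv 3 ((1 + iA * (bA * ηA * (((j.1 : ℕ) : A) - 1))) ^ 8)
      ((omA ^ a.1 * (1 - iA * (bA * ηA * (((j.1 : ℕ) : A) - 1)))) ^ 8) := by
  decide +kernel

lemma false_of_small {s q t r : A} {a j : Fin 3} (hj : j ≠ 1)
    (ht : 3 * t ^ 3 = 3 * (((j.1 : ℕ) : A) - 1))
    (hs : s = bA * q) (hE : s * (s ^ 2 + 1) = bA * ηA * t ^ 3) (hr : IsUnit r)
    (hρ : 1 + iA * s = omA ^ a.1 * r ^ 3 * (1 - iA * s)) : False := by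
  have h9 := nine_eq_zero
  generalize hε : ((j.1 : ℕ) : A) - 1 = ε at ht
  have h1 : Eqv 3 s (bA * ηA * ε) := by
    unfold Eqv
    rw [hs] at hE ⊢
    linear_combination 3 * hE + bA * ηA * ht - 3 * bA * q ^ 3 * bA_sq - bA * q ^ 3 * h9
  have h2 : Eqv 3 ((1 + iA * s) ^ 8) ((omA ^ a.1 * (1 - iA * s)) ^ 8) := by
    have hr24 := pow_24 hr
    unfold Eqv
    rw [hρ]
    linear_combination bA * (omA ^ a.1 * (1 - iA * s)) ^ 8 * hr24 -
      ((omA ^ a.1 * r ^ 3 * (1 - iA * s)) ^ 8 - (omA ^ a.1 * (1 - iA * s)) ^ 8) * bA_sq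
  have h3 : Eqv 3 (iA * s) (iA * (bA * ηA * ε)) := Eqv.rfl.mul h1
  have h4 : Eqv 3 (1 + iA * s) (1 + iA * (bA * ηA * ε)) := by
    unfold Eqv at *; linear_combination h3
  refine not_eqv_small a j hj ?_
  rw [hε]
  exact (h4.pow 8).symm.trans (h2.trans ((Eqv.rfl.mul (Eqv.rfl.sub h3)).pow 8))

end A

lemma A.isUnit_add_bA_mul {x y q : A} (h : x = y + bA * q) (hy : IsUnit y) : IsUnit x := by
  by_contra hx
  obtain ⟨s, hs⟩ := A.not_isUnit_iff.1 hx
  apply A.not_isUnit_bA_mul (s - q)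
  convert hy using 1
  linear_combination hs.symm.trans h

lemma v_le_one_of_curve {g Z : L} {t : A} (hE : g * (g ^ 2 + 1) = δ * Z ^ 3) (hZ : Cg Z t) :
    v g ≤ 1 := by
  by_contra! hg
  have h1 : v (g ^ 2 + 1) = v g ^ 2 := by
    rw [v.map_add_eq_of_lt_left, map_pow]
    rw [map_one, map_pow]; exact one_lt_pow₀ hg two_ne_zero
  have h2 : v (δ * Z ^ 3) ≤ 1 := ((Cg.β.mul Cg.η).mul (hZ.pow 3)).v_le_one
  rw [← hE, map_mul, h1, ← pow_succ'] at h2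
  exact absurd h2 (not_le.2 (one_lt_pow₀ hg three_ne_zero))

lemma ratio_mul_conj {g : L} (hg : conjL g = g) (h0 : g ^ 2 + 1 ≠ 0) :
    (1 + ι * g) / (1 - ι * g) * conjL ((1 + ι * g) / (1 - ι * g)) = 1 := by
  have h1 : (1 + ι * g) * (1 - ι * g) ≠ 0 := by
    rwa [show (1 + ι * g) * (1 - ι * g) = g ^ 2 + 1 by linear_combination -g ^ 2 * ι_sq]
  have h2 := left_ne_zero_of_mul h1
  have h3 := right_ne_zero_of_mul h1
  simp only [map_div₀, map_add, map_sub, map_mul, map_one, conj_ι, hg]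
  rw [neg_mul, sub_neg_eq_add, ← sub_eq_add_neg, div_mul_div_comm, mul_comm (1 - ι * g)]
  exact div_self h1

lemma curve_factor_ne_zero {g Z : L} (hE : g * (g ^ 2 + 1) = δ * Z ^ 3) (hZ0 : Z ≠ 0) :
    g ≠ 0 ∧ g ^ 2 + 1 ≠ 0 := by
  have h : g * (g ^ 2 + 1) ≠ 0 := by rw [hE]; exact mul_ne_zero δ_ne_zero (pow_ne_zero _ hZ0)
  exact ⟨left_ne_zero_of_mul h, right_ne_zero_of_mul h⟩

/-- No points on the curve with `g` close to `ι`. -/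
lemma false_of_near {g Z : L} {s t : A} (hg : conjL g = g) (hZ0 : Z ≠ 0)
    (hE : g * (g ^ 2 + 1) = δ * Z ^ 3) (hgs : Cg g s) (hZ : Cg Z t) (hs : ¬ IsUnit (s - iA))
    (j : Fin 3) (ht : 3 * t ^ 3 = 3 * (((j.1 : ℕ) : A) - 1)) : False := by
  obtain ⟨q, hq⟩ := A.not_isUnit_iff.1 hs
  have hs' : s = iA + bA * q := by linear_combination hq
  obtain ⟨hg0, hg1⟩ := curve_factor_ne_zero hE hZ0
  obtain ⟨a, f, y, hy, hρ⟩ := exists_eq_of_mul_conj_eq_one (ratio_mul_conj hg hg1)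
    (cubeVal_ratio_g hE)
  have hEA : s * (s ^ 2 + 1) = bA * ηA * t ^ 3 :=
    (hgs.mul ((hgs.pow 2).add Cg.one)).unique (((Cg.β.mul Cg.η).mul (hZ.pow 3)).congr hE.symm rfl)
  have us : IsUnit s := A.isUnit_add_bA_mul hs' (IsUnit.of_mul_eq_one (-iA) (by decide +kernel))
  have um : IsUnit (1 - iA * s) := A.isUnit_add_bA_mul (y := 2) (q := -iA * q)
    (by rw [hs']; linear_combination -iA_sq) (IsUnit.of_mul_eq_one 5 (by decide +kernel))
  have hm : Cg (1 - ι * g) (1 - iA * s) := Cg.one.sub (Cg.ι.mul hgs)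
  have vg := hgs.v_eq_one_iff.2 us
  have vm := hm.v_eq_one_iff.2 um
  have hm0 : 1 - ι * g ≠ 0 := (map_ne_zero v).1 (by rw [vm]; exact one_ne_zero)
  have h1 : g * (1 - ι * g) ^ 2 * ((1 + ι * g) / (1 - ι * g)) = β * η * Z ^ 3 := by
    rw [← δ, ← hE]; field_simp; linear_combination -g ^ 2 * ι_sq
  obtain rfl : f = 1 := by
    obtain ⟨m, hvZ⟩ := exists_v_eq_exp hZ0
    obtain ⟨n, hn⟩ := v_eq_exp_of_eq hy hρ
    have h2 := congrArg v h1
    rw [map_mul, map_mul, map_pow, vg, vm, hn, map_mul, map_mul, map_pow, v_β, v_η, hvZ, one_pow,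
      one_mul, one_mul, mul_one, ← WithZero.exp_nsmul, ← WithZero.exp_add, WithZero.exp_inj] at h2
    simp only [nsmul_eq_mul] at h2
    push_cast at h2
    have := f.2
    rw [Fin.ext_iff]; simp only [Fin.val_one]; omega
  have hβ := β_ne_zero
  have hd := δ₂_ne_zero
  have h2 : η = ω ^ a.1 * (δ₁ ^ 2 * g * (1 - ι * g) ^ 2) * (y / (β * Z)) ^ 3 := by
    rw [hρ, Fin.val_one, pow_one] at h1
    have h3 : δ₁ / δ₂ = δ₁ ^ 2 / 3 := by rw [← δ₁_mul_δ₂]; field_simp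
    rw [h3] at h1
    field_simp at h1 ⊢
    linear_combination -h1 + η * Z ^ 3 * β * β_sq
  have vY : v (y / (β * Z)) = 1 := by
    apply v_eq_one_of_pow (n := 3) three_ne_zero
    have := congrArg v h2
    rw [map_mul, map_mul, map_pow, v_ω, map_mul, map_mul, map_pow, map_pow, v_δ₁, vg, vm, v_η] at this
    simpa using this.symm
  obtain ⟨r, hr⟩ := exists_Cg vY.le
  have hr' := hr.v_eq_one_iff.1 vY
  refine A.false_of_near (a := a) j ht hs' hEA hr' (Cg.η.unique ?_)
  exact (((Cg.ω.pow a.1).mul (((Cg.δ₁.pow 2).mul hgs).mul (hm.pow 2))).mul (hr.pow 3)).congr h2.symm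
    (by rw [show (⟨5, 0, 0, 0⟩ : A) ^ 2 = 25 by decide +kernel]; rfl)

/-- The ratio attached to a point with `g` small. -/
lemma exists_ratio_of_small {g Z : L} {s : A} (hg : conjL g = g) (hZ0 : Z ≠ 0)
    (hE : g * (g ^ 2 + 1) = δ * Z ^ 3) (hgs : Cg g s) (hs : ¬ IsUnit s) :
    ∃ (a : Fin 3) (y : L) (r : A), (1 + ι * g) / (1 - ι * g) = ω ^ a.1 * y ^ 3 ∧ Cg y r ∧ IsUnit r ∧
      1 + iA * s = omA ^ a.1 * r ^ 3 * (1 - iA * s) := by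
  obtain ⟨q, hs'⟩ := A.not_isUnit_iff.1 hs
  obtain ⟨hg0, hg1⟩ := curve_factor_ne_zero hE hZ0
  obtain ⟨a, f, y, hy, hρ⟩ := exists_eq_of_mul_conj_eq_one (ratio_mul_conj hg hg1)
    (cubeVal_ratio_g hE)
  have up : IsUnit (1 + iA * s) := A.isUnit_add_bA_mul (y := 1) (q := iA * q)
    (by rw [hs']; ring) isUnit_one
  have um : IsUnit (1 - iA * s) := A.isUnit_add_bA_mul (y := 1) (q := -iA * q)
    (by rw [hs']; ring) isUnit_one
  have hm : Cg (1 - ι * g) (1 - iA * s) := Cg.one.sub (Cg.ι.mul hgs)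
  have hp : Cg (1 + ι * g) (1 + iA * s) := Cg.one.add (Cg.ι.mul hgs)
  have vρ : v ((1 + ι * g) / (1 - ι * g)) = 1 := by
    rw [map_div₀, hp.v_eq_one_iff.2 up, hm.v_eq_one_iff.2 um, div_one]
  obtain rfl : f = 0 := by
    obtain ⟨n, hn⟩ := v_eq_exp_of_eq hy hρ
    rw [vρ, ← WithZero.exp_zero, WithZero.exp_inj] at hn
    have := f.2
    rw [Fin.ext_iff]; simp only [Fin.val_zero]; omega
  rw [Fin.val_zero, pow_zero, mul_one] at hρ
  have vy : v y = 1 := by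
    apply v_eq_one_of_pow (n := 3) three_ne_zero
    have := congrArg v hρ
    rw [vρ, map_mul, map_pow, v_ω, one_pow, one_mul] at this
    exact this.symm
  obtain ⟨r, hr⟩ := exists_Cg vy.le
  refine ⟨a, y, r, hρ, hr, hr.v_eq_one_iff.1 vy, hp.unique ?_⟩
  have hm0 : 1 - ι * g ≠ 0 := (map_ne_zero v).1 (by
    rw [hm.v_eq_one_iff.2 um]; exact one_ne_zero)
  exact (((Cg.ω.pow a.1).mul (hr.pow 3)).mul hm).congr (by rw [← hρ]; field_simp) rfl

lemma A.not_isUnit_of_curve {s x : A} (hE : s * (s ^ 2 + 1) = bA * x) :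
    ¬ IsUnit s ∨ ¬ IsUnit (s - iA) ∨ ¬ IsUnit (-s - iA) := by
  by_contra! h
  obtain ⟨h1, h2, h3⟩ := h
  apply A.not_isUnit_bA_mul (-x)
  convert (h1.mul h2).mul h3 using 1
  linear_combination hE - s * iA_sq

lemma reduced_curve {g Z : L} {s t : A} (hE : g * (g ^ 2 + 1) = δ * Z ^ 3) (hgs : Cg g s)
    (hZ : Cg Z t) : s * (s ^ 2 + 1) = bA * ηA * t ^ 3 :=
  (hgs.mul ((hgs.pow 2).add Cg.one)).unique (((Cg.β.mul Cg.η).mul (hZ.pow 3)).congr hE.symm rfl)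

/-- A point on the curve with integral `Z` whose reduction is small or prime has `g` small. -/
lemma not_isUnit_of_point {g Z : L} {s t : A} (hg : conjL g = g) (hZ0 : Z ≠ 0)
    (hE : g * (g ^ 2 + 1) = δ * Z ^ 3) (hgs : Cg g s) (hZ : Cg Z t)
    (j : Fin 3) (ht : 3 * t ^ 3 = 3 * (((j.1 : ℕ) : A) - 1)) : ¬ IsUnit s := by
  have hEA := reduced_curve hE hgs hZ
  rcases A.not_isUnit_of_curve (hEA.trans (mul_assoc _ _ _)) with h | h | h
  · exact h
  · exact (false_of_near hg hZ0 hE hgs hZ h j ht).elim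
  · refine (false_of_near (g := -g) (Z := -Z) (by rw [map_neg, hg]) (neg_ne_zero.2 hZ0)
      (by linear_combination -hE) hgs.neg hZ.neg h (2 - j) ?_).elim
    have : ((((2 - j : Fin 3)).1 : ℕ) : A) - 1 = -(((j.1 : ℕ) : A) - 1) := by
      clear ht; revert j; decide +kernel
    rw [this]; linear_combination -ht

theorem no_unit_point {g Z : L} {t : A} (hg : conjL g = g)
    (hE : g * (g ^ 2 + 1) = δ * Z ^ 3) (hZ : Cg Z t)
    (ht : 3 * bA * t = 3 * bA ∨ 3 * bA * t = -(3 * bA)) : False := by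
  obtain ⟨s, hgs⟩ := exists_Cg (v_le_one_of_curve hE hZ)
  obtain ⟨j, hj1, hj⟩ : ∃ j : Fin 3, j ≠ 1 ∧ 3 * t ^ 3 = 3 * (((j.1 : ℕ) : A) - 1) := by
    rcases ht with ht | ht
    · refine ⟨2, by decide, (A.three_mul_pow_three (ε := 1) (by rw [ht, mul_one])).trans ?_⟩
      decide +kernel
    · refine ⟨0, by decide, (A.three_mul_pow_three (ε := -1) (by rw [ht]; ring)).trans ?_⟩
      decide +kernel
  have hZ0 : Z ≠ 0 := by
    rintro rfl
    rw [hZ.unique Cg.zero] at ht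
    revert ht; decide +kernel
  have hs := not_isUnit_of_point hg hZ0 hE hgs hZ j hj
  obtain ⟨q, hs'⟩ := A.not_isUnit_iff.1 hs
  obtain ⟨a, y, r, -, -, hr, h⟩ := exists_ratio_of_small hg hZ0 hE hgs hs
  exact A.false_of_small hj1 hj hs' (reduced_curve hE hgs hZ) hr h

lemma ω_sq_add : ω ^ 2 + ω + 1 = 0 := by
  have h2 : (2 : L) ≠ 0 := two_ne_zero
  have h := two_mul_ω
  have : 4 * (ω ^ 2 + ω + 1) = 0 := by
    linear_combination (2 * ω + ι * β + 1) * h + β ^ 2 * ι_sq - β_sq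
  simpa using this

lemma v_ω_sub_one : v (ω - 1) = WithZero.exp (-1 : ℤ) := by
  have h : (ω - 1) ^ 2 = -(3 * ω) := by linear_combination ω_sq_add
  have h2 := congrArg v h
  have h0 : ω - 1 ≠ 0 := by
    intro h0
    rw [h0] at h
    have := ω_ne_zero
    simp_all
  obtain ⟨n, hn⟩ := exists_v_eq_exp h0
  rw [map_pow, Valuation.map_neg, map_mul, v_ω, v_three, hn, mul_one, ← WithZero.exp_nsmul,
    WithZero.exp_inj, nsmul_eq_mul] at h2
  rw [hn, WithZero.exp_inj]
  push_cast at h2; omega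

lemma v_ω_pow_sub : ∀ {i j : Fin 3}, i ≠ j → v (ω ^ i.1 - ω ^ j.1) = WithZero.exp (-1 : ℤ) := by
  have key : ∀ {x : L} (n : ℕ), x = ω ^ n * (ω - 1) ∨ x = -(ω ^ n * (ω - 1)) →
      v x = WithZero.exp (-1 : ℤ) := by
    rintro x n (rfl | rfl) <;> simp [v_ω, v_ω_sub_one]
  have h := ω_sq_add
  have h3 := ω_cube
  intro i j hij
  fin_cases i <;> fin_cases j <;> simp only [ne_eq, not_true_eq_false] at hij
  · exact key 0 (Or.inr (by simp))
  · exact key 2 (Or.inl (by simp only; linear_combination -h3))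
  · exact key 0 (Or.inl (by simp))
  · exact key 1 (Or.inr (by simp only; ring))
  · exact key 2 (Or.inr (by simp only; linear_combination h3))
  · exact key 1 (Or.inl (by simp only; ring))

lemma cube_sub_cube (c u : L) :
    c ^ 3 - u ^ 3 = (c - ω ^ 0 * u) * (c - ω ^ 1 * u) * (c - ω ^ 2 * u) := by
  linear_combination (c ^ 2 * u - ω * c * u ^ 2) * ω_sq_add + u ^ 3 * ω_cube

/-- A cube close to `u ^ 3` is the cube of an element close to `u`, up to a cube root of unity. -/
lemma exists_close_root (c : L) {u : L} (hu : v u = 1) :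
    ∃ j : Fin 3, v (c - ω ^ j.1 * u) * v 3 ≤ v (c ^ 3 - u ^ 3) := by
  obtain ⟨j, -, hj⟩ := Finset.exists_min_image (Finset.univ : Finset (Fin 3))
    (fun j => v (c - ω ^ j.1 * u)) ⟨0, Finset.mem_univ _⟩
  have h3 : v 3 = WithZero.exp (-1 : ℤ) * WithZero.exp (-1 : ℤ) := by
    rw [v_three, ← WithZero.exp_add]; rfl
  have key : ∀ i, i ≠ j → WithZero.exp (-1 : ℤ) ≤ v (c - ω ^ i.1 * u) := by
    intro i hi
    have h : v ((c - ω ^ j.1 * u) - (c - ω ^ i.1 * u)) = WithZero.exp (-1 : ℤ) := by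
      rw [← v_ω_pow_sub hi, show (c - ω ^ j.1 * u) - (c - ω ^ i.1 * u) = (ω ^ i.1 - ω ^ j.1) * u by ring,
        map_mul, hu, mul_one]
    rw [← h]
    exact (v.map_sub _ _).trans (max_le (hj i (Finset.mem_univ _)) le_rfl)
  refine ⟨j, ?_⟩
  have hp := cube_sub_cube c u
  rw [hp, map_mul, map_mul, h3]
  fin_cases j
  · rw [mul_assoc]
    exact mul_le_mul' le_rfl (mul_le_mul' (key 1 (by decide)) (key 2 (by decide)))
  · rw [mul_comm (v (c - ω ^ 0 * u)), mul_assoc]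
    exact mul_le_mul' le_rfl (mul_le_mul' (key 0 (by decide)) (key 2 (by decide)))
  · rw [mul_comm (v _ * v _)]
    exact mul_le_mul' le_rfl (mul_le_mul' (key 0 (by decide)) (key 1 (by decide)))

lemma A.not_isUnit_sub_one {r : A} (h : r ^ 3 = 1) : ¬ IsUnit (r - 1) := by
  intro hu
  apply A.not_isUnit_bA_mul (bA * (-r ^ 2 + r))
  convert hu.pow 3 using 1
  linear_combination (-r ^ 2 + r) * bA_sq - h

lemma v_lt_one_of_le_β {x y : L} (hx : v x ≤ v (β * y)) (hy : v y ≤ 1) : v x < 1 := by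
  refine hx.trans_lt ?_
  rw [map_mul, v_β]
  refine (mul_le_mul' le_rfl hy).trans_lt ?_
  rw [mul_one, ← WithZero.exp_zero, WithZero.exp_lt_exp]; omega

lemma exists_eq_mul_of_v_le {x y : L} (h : v x ≤ v y) : ∃ q, v q ≤ 1 ∧ x = y * q := by
  by_cases hy : y = 0
  · refine ⟨0, by simp, ?_⟩
    rw [hy, map_zero, le_zero_iff, map_eq_zero] at h
    rw [h, mul_zero]
  · exact ⟨x / y, by rw [map_div₀]; exact div_le_one_of_le₀ h zero_le, by field_simp⟩

lemma A.omA_indep : ∀ a : Fin 3, bA * (omA ^ a.1) ^ 8 = bA → a = 0 := by decide +kernel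

/-- Halving of a point on the curve with small `Z`. -/
lemma exists_half {g Z z₀ : L} {t : A} (k : ℕ) (hg : conjL g = g) (hZ : conjL Z = Z)
    (hE : g * (g ^ 2 + 1) = δ * Z ^ 3) (hZz : Z = β * (3 ^ k * z₀)) (hz : Cg z₀ t)
    (ht : 3 * t = 3 ∨ 3 * t = -3) : ∃ τ W w₀ : L, conjL τ = τ ∧ conjL W = W ∧
      τ * (1 - τ ^ 2) = δ * W ^ 3 ∧ W = 3 ^ k * w₀ ∧ Cg w₀ t ∧ v τ ≤ v (β * 27 ^ k) := by
  have h9 := A.nine_eq_zero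
  have hβ := β_ne_zero
  have h3k : Cg (3 ^ k : L) (3 ^ k : A) := (Cg.ofNat 3).pow k
  have hZt : Cg Z (bA * (3 ^ k * t)) := hZz ▸ Cg.β.mul (h3k.mul hz)
  have h30 : Cg (3 : L) 3 := Cg.ofNat 3
  have hz0 : z₀ ≠ 0 := by
    rintro rfl
    rw [hz.unique Cg.zero] at ht
    revert ht; decide +kernel
  have hZ0 : Z ≠ 0 := by
    rw [hZz]
    exact mul_ne_zero hβ (mul_ne_zero (pow_ne_zero _ three_ne_zero) hz0)
  obtain ⟨hg0, hg1⟩ := curve_factor_ne_zero hE hZ0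
  obtain ⟨s, hgs⟩ := exists_Cg (v_le_one_of_curve hE hZt)
  have hs := not_isUnit_of_point hg hZ0 hE hgs hZt 1 (by
    rw [show (((1 : Fin 3).1 : ℕ) : A) - 1 = 0 by decide +kernel]
    linear_combination 3 * bA * (3 ^ k * t) ^ 3 * bA_sq + bA * (3 ^ k * t) ^ 3 * h9)
  have us : IsUnit (s ^ 2 + 1) := by
    obtain ⟨q, rfl⟩ := A.not_isUnit_iff.1 hs
    exact A.isUnit_add_bA_mul (y := 1) (q := q * (bA * q)) (by ring) isUnit_one
  have hs0 : s = 0 := by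
    have h := reduced_curve hE hgs hZt
    have h2 : s * (s ^ 2 + 1) = 0 := by
      rw [h]
      linear_combination ηA * (3 ^ k * t) ^ 3 * (bA ^ 2 * bA_sq + 3 * bA_sq + h9)
    obtain ⟨u, hu⟩ := us.exists_right_inv
    linear_combination u * h2 - s * hu
  subst hs0
  have hgu := ((hgs.pow 2).add Cg.one).v_eq_one_iff.2 us
  have hgv : v g ≤ v (9 * 27 ^ k) := by
    have h : g * (g ^ 2 + 1) = 9 * 27 ^ k * (η * z₀ ^ 3) := by
      rw [hE, hZz, δ, show (27 : L) ^ k = (3 ^ k) ^ 3 by rw [← pow_mul, mul_comm, pow_mul]; norm_num]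
      linear_combination η * (3 ^ k * z₀) ^ 3 * (β ^ 2 + 3) * β_sq
    have h2 := congrArg v h
    rw [map_mul, hgu, mul_one, map_mul] at h2
    rw [h2]
    exact mul_le_of_le_one_right' (Cg.η.mul (hz.pow 3)).v_le_one
  obtain ⟨a, y, r, hρ, hr, hur, hA⟩ := exists_ratio_of_small hg hZ0 hE hgs hs
  obtain rfl : a = 0 := by
    apply A.omA_indep
    have h24 := A.pow_24 hur
    have h1 : 1 = omA ^ a.1 * r ^ 3 := by linear_combination hA
    have h8 := congrArg (· ^ 8) h1
    simp only [one_pow] at h8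
    linear_combination -(omA ^ a.1) ^ 8 * h24 - bA * h8
  rw [Fin.val_zero, pow_zero, one_mul] at hρ
  set ρ := (1 + ι * g) / (1 - ι * g) with hρd
  have hρm : ρ * conjL ρ = 1 := ratio_mul_conj hg hg1
  have hm : Cg (1 - ι * g) (1 - iA * 0) := Cg.one.sub (Cg.ι.mul hgs)
  have vm := hm.v_eq_one_iff.2 (by rw [mul_zero, sub_zero]; exact isUnit_one)
  have hm0 : 1 - ι * g ≠ 0 := (map_ne_zero v).1 (by rw [vm]; exact one_ne_zero)
  have vι : v ι = 1 := Cg.ι.v_eq_one_iff.2 (IsUnit.of_mul_eq_one (-iA) (by decide +kernel))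
  have v2 : v (2 : L) = 1 := (Cg.ofNat 2).v_eq_one_iff.2 (IsUnit.of_mul_eq_one 5 (by decide +kernel))
  have hρ1 : v (ρ - 1) = v g := by
    rw [show ρ - 1 = 2 * ι * g / (1 - ι * g) by rw [hρd]; field_simp; ring, map_div₀, vm, map_mul,
      map_mul, vι, v2]
    simp
  have hC3 : (y ^ 2 * conjL y) ^ 3 = ρ := by
    have h := congrArg conjL hρ
    rw [map_pow] at h
    calc (y ^ 2 * conjL y) ^ 3 = (y ^ 3) ^ 2 * conjL y ^ 3 := by ring
      _ = ρ * (ρ * conjL ρ) := by rw [← h, ← hρ]; ring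
      _ = ρ := by rw [hρm, mul_one]
  have hy1 : y ^ 2 * conjL y * conjL (y ^ 2 * conjL y) = 1 := by
    have h := congrArg conjL hρ
    rw [map_pow] at h
    rw [map_mul, map_pow, conj_conj]
    calc y ^ 2 * conjL y * (conjL y ^ 2 * y) = y ^ 3 * conjL y ^ 3 := by ring
      _ = 1 := by rw [← h, ← hρ, hρm]
  obtain ⟨j, hj⟩ := exists_close_root (y ^ 2 * conjL y) (u := 1) (map_one v)
  rw [hC3, one_pow, hρ1, mul_one] at hj
  obtain ⟨C, hC, hC1, hCv⟩ : ∃ C, C ^ 3 = ρ ∧ C * conjL C = 1 ∧ v (C - 1) ≤ v (3 * 27 ^ k) := by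
    have h3 : (ω ^ j.1) ^ 3 = 1 := by rw [← pow_mul, mul_comm, pow_mul, ω_cube, one_pow]
    refine ⟨(ω ^ j.1) ^ 2 * (y ^ 2 * conjL y), ?_, ?_, ?_⟩
    · rw [mul_pow, hC3]; linear_combination ρ * ((ω ^ j.1) ^ 3 + 1) * h3
    · rw [map_mul, map_pow, map_pow, conj_ω]
      linear_combination (ω ^ j.1) ^ 6 * hy1 + ((ω ^ j.1) ^ 3 + 1) * h3
    · rw [show (ω ^ j.1) ^ 2 * (y ^ 2 * conjL y) - 1 = (ω ^ j.1) ^ 2 * (y ^ 2 * conjL y - ω ^ j.1) by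
        linear_combination h3, map_mul, map_pow, map_pow, v_ω, one_pow, one_pow, one_mul]
      have h := hj.trans hgv
      rw [show (9 : L) * 27 ^ k = 3 * 27 ^ k * 3 by ring, map_mul v (3 * 27 ^ k)] at h
      refine le_of_mul_le_mul_right h ?_
      rw [v_three]; exact WithZero.exp_pos
  have h27 : v ((27 : L) ^ k) ≤ 1 := ((Cg.ofNat 27).pow k).v_le_one
  have hC0 : C ≠ 0 := left_ne_zero_of_mul_eq_one hC1
  have vC : v (C + 1) = 1 := by
    rw [show C + 1 = 2 + (C - 1) by ring, v.map_add_eq_of_lt_left, v2]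
    rw [v2]
    refine v_lt_one_of_le_β (y := β * 27 ^ k) (hCv.trans_eq (congrArg v ?_)) ?_
    · linear_combination -27 ^ k * β_sq
    · rw [map_mul]; exact mul_le_one' Cg.β.v_le_one h27
  have hC10 : C + 1 ≠ 0 := (map_ne_zero v).1 (by rw [vC]; exact one_ne_zero)
  have hι := ι_ne_zero
  have hι2 := ι_sq
  obtain ⟨τ, hτ⟩ : ∃ τ, τ = (C - 1) / (β * ι * (C + 1)) := ⟨_, rfl⟩
  have hτC : β * ι * τ * (C + 1) = C - 1 := by rw [hτ]; field_simp
  have hτv : v τ ≤ v (β * 27 ^ k) := by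
    have h := congrArg v hτC
    rw [map_mul, vC, mul_one, map_mul, map_mul, vι, mul_one] at h
    rw [← h, show (3 : L) * 27 ^ k = β * (β * 27 ^ k) by linear_combination -27 ^ k * β_sq,
      map_mul v β (β * 27 ^ k)] at hCv
    refine le_of_mul_le_mul_left hCv ?_
    rw [v_β]; exact WithZero.exp_pos
  have hτσ : conjL τ = τ := by
    have h : conjL C = C⁻¹ := eq_inv_of_mul_eq_one_right hC1
    rw [hτ, map_div₀, map_mul, map_mul, map_sub, map_add, map_one, conj_β, conj_ι, h]
    have : C⁻¹ + 1 ≠ 0 := by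
      rw [show C⁻¹ + 1 = (C + 1) / C by field_simp; ring]; exact div_ne_zero hC10 hC0
    have h1C : 1 + C ≠ 0 := by rwa [add_comm]
    field_simp
    ring
  have hgτ : g * (1 - 9 * τ ^ 2) = 3 * β * τ * (1 - τ ^ 2) := by
    have hu : 1 + β * ι * τ = C * (1 - β * ι * τ) := by linear_combination hτC
    have hρ' : (1 + ι * g) = C ^ 3 * (1 - ι * g) := by rw [hC, hρd]; field_simp
    have h : (1 + β * ι * τ) ^ 3 * (1 - ι * g) = (1 - β * ι * τ) ^ 3 * (1 + ι * g) := by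
      rw [hu, hρ']; ring
    have h2 : 2 * ι * (g * (1 - 9 * τ ^ 2)) = 2 * ι * (3 * β * τ * (1 - τ ^ 2)) := by
      linear_combination -h + (-6 * ι * τ ^ 2 * β ^ 2 * g + 2 * ι * β ^ 3 * τ ^ 3) * hι2 +
        (6 * ι * τ ^ 2 * g - 2 * ι * β * τ ^ 3) * β_sq
    exact mul_left_cancel₀ (mul_ne_zero two_ne_zero hι) h2
  obtain ⟨τ', hτ', hτq⟩ := exists_eq_mul_of_v_le hτv
  obtain ⟨b, hb⟩ := exists_Cg ((mul_le_one' (h27) hτ').trans' (map_mul v _ _).le)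
  have hτb : Cg τ (bA * b) := (Cg.β.mul hb).congr (by rw [hτq]; ring) rfl
  have h1 : Cg (1 - 9 * τ ^ 2) 1 :=
    (Cg.one.sub ((Cg.ofNat 9).mul (hτb.pow 2))).congr rfl (by
      change 1 - (9 : A) * _ = 1; linear_combination -(bA * b) ^ 2 * h9)
  have h2 : Cg (1 + 3 * τ ^ 2) 1 :=
    (Cg.one.add ((Cg.ofNat 3).mul (hτb.pow 2))).congr rfl (by
      change 1 + (3 : A) * _ = 1; linear_combination 3 * b ^ 2 * bA_sq + b ^ 2 * h9)
  have n1 : 1 - 9 * τ ^ 2 ≠ 0 := (map_ne_zero v).1 (by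
    rw [h1.v_eq_one_iff.2 isUnit_one]; exact one_ne_zero)
  have n2 : 1 + 3 * τ ^ 2 ≠ 0 := (map_ne_zero v).1 (by
    rw [h2.v_eq_one_iff.2 isUnit_one]; exact one_ne_zero)
  refine ⟨τ, Z * (1 - 9 * τ ^ 2) / (β * (1 + 3 * τ ^ 2)), z₀ * (1 - 9 * τ ^ 2) / (1 + 3 * τ ^ 2),
    hτσ, ?_, ?_, ?_, ?_, hτv⟩
  · simp only [map_div₀, map_mul, map_sub, map_add, map_pow, map_one, map_ofNat, hτσ, hZ, conj_β]
  · have h : δ * Z ^ 3 * (1 - 9 * τ ^ 2) ^ 3 =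
        τ * (1 - τ ^ 2) * β ^ 3 * (1 + 3 * τ ^ 2) ^ 3 := by
      have hM : g * (g ^ 2 + 1) * (1 - 9 * τ ^ 2) ^ 3 = g * (1 - 9 * τ ^ 2) *
        ((g * (1 - 9 * τ ^ 2)) ^ 2 + (1 - 9 * τ ^ 2) ^ 2) := by ring
      rw [← hE, hM, hgτ]
      linear_combination (τ * (1 - τ ^ 2) * β * (27 * τ ^ 2 * (1 - τ ^ 2) ^ 2
        - (1 + 3 * τ ^ 2) ^ 3)) * β_sq
    rw [div_pow, mul_pow Z, ← mul_div_assoc, ← mul_assoc, h,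
      eq_div_iff (pow_ne_zero 3 (mul_ne_zero hβ n2))]
    ring
  · rw [hZz]; field_simp
  · obtain ⟨r', hr', h⟩ := (hz.mul h1).div h2 isUnit_one
    exact hr'.congr rfl (by linear_combination h)

lemma Cg.ne_zero {x : L} {s : A} (h : Cg x s) (hs : IsUnit s) : x ≠ 0 :=
  (map_ne_zero v).1 (by rw [h.v_eq_one_iff.2 hs]; exact one_ne_zero)

lemma A.isUnit_two : IsUnit (2 : A) := IsUnit.of_mul_eq_one 5 (by decide +kernel)

/-- The intermediate curve maps back to the original one near the origin. -/
lemma exists_descent {τ W w₀ : L} {t : A} (k : ℕ) (hτ : conjL τ = τ) (hW : conjL W = W)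
    (hE : τ * (1 - τ ^ 2) = δ * W ^ 3) (hWw : W = 3 ^ (k + 1) * w₀) (hw : Cg w₀ t)
    (hv : v τ ≤ v (β * 27 ^ (k + 1))) :
    ∃ g Z z₀ : L, ∃ t', conjL g = g ∧ conjL Z = Z ∧ g * (g ^ 2 + 1) = δ * Z ^ 3 ∧
      Z = β * (3 ^ k * z₀) ∧ Cg z₀ t' ∧ 3 * t' = 3 * t := by
  have h9 := A.nine_eq_zero
  have hβ := β_ne_zero
  obtain ⟨q, hq, hτq⟩ := exists_eq_mul_of_v_le hv
  obtain ⟨b, hb⟩ := exists_Cg (x := 3 ^ k * 3 ^ k * 3 ^ k * q) (by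
    rw [map_mul]
    exact mul_le_one' ((((Cg.ofNat 3).pow k).mul ((Cg.ofNat 3).pow k)).mul ((Cg.ofNat 3).pow k)).v_le_one hq)
  have hτ0 : Cg τ 0 := (((Cg.ofNat 9).mul ((Cg.ofNat 3).mul (Cg.β.mul hb))).congr (by
    rw [hτq, pow_succ, show (27 : L) ^ k = 3 ^ k * 3 ^ k * 3 ^ k by
      rw [← mul_pow, ← mul_pow]; norm_num]
    ring) (by change (9 : A) * _ = 0; rw [h9, zero_mul]))
  have hm : Cg (1 - τ) 1 := (Cg.one.sub hτ0).congr rfl (by ring)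
  have hp : Cg (1 + τ) 1 := (Cg.one.add hτ0).congr rfl (by ring)
  have hm0 := hm.ne_zero isUnit_one
  have hp0 := hp.ne_zero isUnit_one
  obtain ⟨r, hr, hr1⟩ := hp.div hm isUnit_one
  rw [mul_one] at hr1
  subst hr1
  obtain ⟨c, hcσ, hc⟩ := exists_eq_cube (x := (1 + τ) / (1 - τ)) (by simp [hτ])
    (hr.v_eq_one_iff.2 isUnit_one) (cubeVal_ratio_τ hE) (hr.pow 8) (by rw [one_pow, mul_one])
  have vc : v c = 1 := v_eq_one_of_pow (n := 3) three_ne_zero (by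
    rw [← hc]; exact hr.v_eq_one_iff.2 isUnit_one)
  obtain ⟨r, hcr⟩ := exists_Cg vc.le
  have hr3 : r ^ 3 = 1 := ((hcr.pow 3).congr hc.symm rfl).unique hr
  have hru := A.not_isUnit_sub_one hr3
  obtain ⟨q, hq⟩ := A.not_isUnit_iff.1 hru
  obtain ⟨s, hs, -⟩ := (hcr.sub Cg.one).div_β hru
  have hc1 : Cg (c + 1) (r + 1) := hcr.add Cg.one
  have uc1 : IsUnit (r + 1) := A.isUnit_add_bA_mul (y := 2) (q := q) (by linear_combination hq)
    A.isUnit_two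
  have hc0 := hc1.ne_zero uc1
  obtain ⟨s, hgs, -⟩ := hs.div hc1 uc1
  obtain ⟨g, hg⟩ : ∃ g, g = (c - 1) / β / (c + 1) := ⟨_, rfl⟩
  rw [← hg] at hgs
  have hgσ : conjL g = g := by rw [hg]; simp [hcσ]
  have hgc : β * g * (c + 1) = c - 1 := by rw [hg]; field_simp
  have n1 : Cg (1 + 9 * g ^ 2) 1 := (Cg.one.add ((Cg.ofNat 9).mul (hgs.pow 2))).congr rfl (by
    change 1 + (9 : A) * _ = 1; rw [h9, zero_mul, add_zero])
  have n2 : Cg (1 - 3 * g ^ 2) (1 - 3 * s ^ 2) := Cg.one.sub ((Cg.ofNat 3).mul (hgs.pow 2))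
  have u2 : IsUnit (1 - 3 * s ^ 2) := A.isUnit_add_bA_mul (y := 1) (q := -bA * s ^ 2)
    (by linear_combination s ^ 2 * bA_sq) isUnit_one
  have n1' := n1.ne_zero isUnit_one
  have n2' := n2.ne_zero u2
  have hτg : τ * (1 + 9 * g ^ 2) = 3 * β * g * (1 + g ^ 2) := by
    have h1 : 1 + β * g = c * (1 - β * g) := by linear_combination hgc
    have h2 : 1 + τ = c ^ 3 * (1 - τ) := by rw [← hc]; field_simp
    have h3 : (1 + β * g) ^ 3 * (1 - τ) = (1 - β * g) ^ 3 * (1 + τ) := by rw [h1, h2]; ring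
    have h4 : 2 * (τ * (1 + 9 * g ^ 2)) = 2 * (3 * β * g * (1 + g ^ 2)) := by
      linear_combination -h3 + (-6 * τ * g ^ 2 + 2 * β * g ^ 3) * β_sq
    exact mul_left_cancel₀ two_ne_zero h4
  have hEW : δ * W ^ 3 * (1 + 9 * g ^ 2) ^ 3 =
      g * (g ^ 2 + 1) * (β * (1 - 3 * g ^ 2)) ^ 3 := by
    have h : τ * (1 - τ ^ 2) * (1 + 9 * g ^ 2) ^ 3 = τ * (1 + 9 * g ^ 2) *
      ((1 + 9 * g ^ 2) ^ 2 - (τ * (1 + 9 * g ^ 2)) ^ 2) := by ring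
    rw [← hE, h, hτg]
    linear_combination (-(β * g * (1 + g ^ 2)) * (27 * g ^ 2 * (1 + g ^ 2) ^ 2
      + (1 - 3 * g ^ 2) ^ 3)) * β_sq
  obtain ⟨t', ht', hq'⟩ := (hw.mul n1).div n2 u2
  refine ⟨g, W * (1 + 9 * g ^ 2) / (β * (1 - 3 * g ^ 2)), _, t', hgσ, ?_, ?_, ?_, ht', ?_⟩
  · simp only [map_div₀, map_mul, map_sub, map_add, map_pow, map_one, map_ofNat, hgσ, hW, conj_β]
  · rw [div_pow, mul_pow W, ← mul_div_assoc, ← mul_assoc, hEW,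
      eq_div_iff (pow_ne_zero 3 (mul_ne_zero hβ n2'))]
  · rw [hWw, mul_div_assoc', mul_div_assoc', div_eq_div_iff (mul_ne_zero hβ n2') n2']
    linear_combination -(3 ^ k * w₀ * (1 + 9 * g ^ 2) * (1 - 3 * g ^ 2)) * β_sq
  · linear_combination 3 * hq' + t' * s ^ 2 * h9

/-- The Hesse-type map from a diagonal cubic to the curve. -/
lemma curve_of_cubic {a b c x y z w X Y : L} (hX : X = b * y ^ 2 - a * x * z)
    (hY : Y = a * x ^ 2 - b * y * z) (habc : a + b + c = 0)
    (hw : a * b * c = 2 * δ * w ^ 3) (h : a * x ^ 3 + b * y ^ 3 + c * z ^ 3 = 0) (hD : X - Y ≠ 0) :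
    (X + Y) / ((X - Y) * β) * (((X + Y) / ((X - Y) * β)) ^ 2 + 1) =
      δ * (-2 * w * (z ^ 2 - x * y) / ((X - Y) * β)) ^ 3 := by
  have hβ := β_ne_zero
  have h1 : X ^ 3 + Y ^ 3 + a * b * c * (z ^ 2 - x * y) ^ 3 = 0 := by
    obtain rfl : c = -a - b := by linear_combination habc
    rw [hX, hY]
    linear_combination (a ^ 2 * x ^ 3 + b ^ 2 * y ^ 3 + a * b * z ^ 3 - 3 * a * b * x * y * z) * h
  clear hX hY
  generalize z ^ 2 - x * y = T at h1
  have h0 : (X - Y) * β ≠ 0 := mul_ne_zero hD hβ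
  have h3 : (X + Y) / ((X - Y) * β) * (((X + Y) / ((X - Y) * β)) ^ 2 + 1) =
      (X + Y) * ((X + Y) ^ 2 + 3 * (X - Y) ^ 2) / ((X - Y) * β) ^ 3 := by
    field_simp
    linear_combination (X + Y) * (X - Y) ^ 2 * β_sq
  rw [h3, div_pow, ← mul_div_assoc]
  congr 1
  linear_combination 4 * h1 - 4 * T ^ 3 * hw

/-- The `τ`-coordinate of an auxiliary point near the origin of the intermediate curve. -/
noncomputable def τG : L := (-8163 - 66072 * α - 39239 * β - 13915 * α * β) / 197641

/-- The `W`-coordinate of the auxiliary point. -/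
noncomputable def WG : L := (-52558 - 65355 * α - 100060 * β - 1389 * α * β) / 790564

lemma curve_τG : τG * (1 - τG ^ 2) = δ * WG ^ 3 := by
  have h1 := α_sq
  have h2 := β_sq
  have h1' : α ^ 3 = 2 * α := by linear_combination α * h1
  have h2' : β ^ 3 = 3 * β := by linear_combination β * h2
  have h2'' : β ^ 4 = 9 := by linear_combination (β ^ 2 + 3) * h2
  have h2b : β ^ 5 = 9 * β := by linear_combination (β ^ 3 + 3 * β) * h2
  have h1'' : α ^ 4 = 4 := by linear_combination (α ^ 2 + 2) * h1
  unfold τG WG δ η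
  field_simp
  ring_nf
  simp only [h1, h2, h1', h2', h2'', h1'', h2b]
  ring

lemma conj_τG : conjL τG = τG := by
  simp only [τG, map_div₀, map_sub, map_neg, map_mul, map_ofNat, conj_α, conj_β]

lemma conj_WG : conjL WG = WG := by
  simp only [WG, map_div₀, map_sub, map_neg, map_mul, map_ofNat, conj_α, conj_β]

lemma Cg.τG : Cg τG ⟨0, 6, 1, 8⟩ := by
  have h9 := A.nine_eq_zero
  have h0 : Cg ((197641 : L)⁻¹) 1 :=
    (Cg.ofNat 197641).inv (by linear_combination 21960 * h9)
  have h1 : Cg (8163 : L) 0 := (Cg.ofNat 8163).congr rfl (by linear_combination 907 * h9)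
  have h2 : Cg (66072 : L) 3 := (Cg.ofNat 66072).congr rfl (by linear_combination 7341 * h9)
  have h3 : Cg (39239 : L) 8 := (Cg.ofNat 39239).congr rfl (by linear_combination 4359 * h9)
  have h4 : Cg (13915 : L) 1 := (Cg.ofNat 13915).congr rfl (by linear_combination 1546 * h9)
  exact ((((h1.neg.sub (h2.mul Cg.α)).sub (h3.mul Cg.β)).sub ((h4.mul Cg.α).mul Cg.β)).mul h0).congr
    (by rw [C1.τG, div_eq_mul_inv]) (by decide +kernel)

lemma Cg.WG : Cg WG ⟨5, 3, 5, 6⟩ := by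
  have h9 := A.nine_eq_zero
  have h0 : Cg ((790564 : L)⁻¹) 7 :=
    (Cg.ofNat 790564).inv (by linear_combination 614883 * h9)
  have h1 : Cg (52558 : L) 7 := (Cg.ofNat 52558).congr rfl (by linear_combination 5839 * h9)
  have h2 : Cg (65355 : L) 6 := (Cg.ofNat 65355).congr rfl (by linear_combination 7261 * h9)
  have h3 : Cg (100060 : L) 7 := (Cg.ofNat 100060).congr rfl (by linear_combination 11117 * h9)
  have h4 : Cg (1389 : L) 3 := (Cg.ofNat 1389).congr rfl (by linear_combination 154 * h9)
  exact ((((h1.neg.sub (h2.mul Cg.α)).sub (h3.mul Cg.β)).sub ((h4.mul Cg.α).mul Cg.β)).mul h0).congr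
    (by rw [C1.WG, div_eq_mul_inv]) (by decide +kernel)

namespace A

lemma isUnit_of_congr {x y : A} (h : 3 * bA * x = 3 * bA * y) (hy : IsUnit y) : IsUnit x := by
  by_contra hx
  obtain ⟨s, rfl⟩ := A.not_isUnit_iff.1 hx
  obtain ⟨u, hu⟩ := hy.exists_right_inv
  have h9 := A.nine_eq_zero
  have : 3 * bA = 0 := by
    linear_combination 3 * s * u * bA_sq + s * u * h9 - u * h - 3 * bA * hu
  exact absurd this (by decide +kernel)

lemma not_isUnit_of_congr {x : A} (h : 3 * bA * x = 0) : ¬ IsUnit x := by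
  intro hx
  obtain ⟨u, hu⟩ := hx.exists_right_inv
  have : 3 * bA = 0 := by linear_combination u * h - 3 * bA * hu
  exact absurd this (by decide +kernel)

lemma cube_of_congr {t : A} (h : 3 * bA * t = -(3 * bA)) : bA * t ^ 3 = -bA := by
  obtain ⟨x, hx⟩ := not_isUnit_iff.1 (not_isUnit_of_congr (x := t + 1) (by linear_combination h))
  obtain rfl : t = bA * x - 1 := by linear_combination hx
  have h9 := A.nine_eq_zero
  linear_combination (bA ^ 2 * x ^ 3 + 3 * x ^ 3 - 3 * bA * x ^ 2 + 3 * x) * bA_sq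
    + (x ^ 3 - bA * x ^ 2 + x) * h9

end A

/-- Points near the origin of the intermediate curve are congruent to the auxiliary point. -/
lemma Cg.τ_of_half {τ W : L} {t : A} (hE : τ * (1 - τ ^ 2) = δ * W ^ 3) (hw : Cg W t)
    (ht : 3 * t = -3) (hv : v τ ≤ v C1.β) : Cg τ ⟨0, 6, 1, 8⟩ := by
  have h9 := A.nine_eq_zero
  obtain ⟨q, hq, rfl⟩ := exists_eq_mul_of_v_le hv
  obtain ⟨b, hb⟩ := exists_Cg hq
  have hs : Cg (C1.β * q) (bA * b) := Cg.β.mul hb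
  have hA : bA * b * (1 - (bA * b) ^ 2) = bA * ηA * t ^ 3 :=
    (hs.mul (Cg.one.sub (hs.pow 2))).unique (((Cg.β.mul Cg.η).mul (hw.pow 3)).congr hE.symm rfl)
  have ht3 := A.cube_of_congr (t := t) (by linear_combination bA * ht)
  have h1 : bA * b = -(bA * ηA) + 3 * bA * b ^ 3 := by
    linear_combination hA + ηA * ht3 + bA * b ^ 3 * bA_sq
  have h2 : 3 * bA * b = 3 * bA * (-ηA) := by
    linear_combination 3 * h1 + bA * b ^ 3 * h9
  have h3 := A.three_mul_pow_three h2
  refine hs.congr rfl ?_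
  rw [h1, show 3 * bA * b ^ 3 = bA * (3 * b ^ 3) by ring, h3]
  decide +kernel

lemma false_of_half_neg {τ W : L} {t : A} (hτ : conjL τ = τ) (hW : conjL W = W)
    (hE : τ * (1 - τ ^ 2) = δ * W ^ 3) (hw : Cg W t) (ht : 3 * t = -3) (hv : v τ ≤ v β) :
    False := by
  have h9 := A.nine_eq_zero
  have hβ := β_ne_zero
  have hδ := δ_ne_zero
  have hτs := Cg.τ_of_half hE hw ht hv
  obtain ⟨s, hs⟩ : ∃ s : A, s = ⟨0, 6, 1, 8⟩ := ⟨_, rfl⟩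
  obtain ⟨u, hu⟩ : ∃ u : A, u = ⟨5, 3, 5, 6⟩ := ⟨_, rfl⟩
  have hG := Cg.τG
  have hWG := Cg.WG
  rw [← hs] at hτs hG
  rw [← hu] at hWG
  have im : (1 - s) * ⟨1, 0, 7, 5⟩ = 1 := by rw [hs]; decide +kernel
  have ip : (1 + s) * ⟨1, 6, 8, 1⟩ = 1 := by rw [hs]; decide +kernel
  have iu : u * ⟨8, 6, 1, 0⟩ = 1 := by rw [hu]; decide +kernel
  have hm := Cg.one.sub hτs
  have hp := Cg.one.add hτs
  have hGm := Cg.one.sub hG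
  have hGp := Cg.one.add hG
  have um := IsUnit.of_mul_eq_one _ im
  have up := IsUnit.of_mul_eq_one _ ip
  have m0 := hm.ne_zero um
  have p0 := hp.ne_zero up
  have Gm0 := hGm.ne_zero um
  have Gp0 := hGp.ne_zero up
  have WG0 := hWG.ne_zero (IsUnit.of_mul_eq_one _ iu)
  obtain ⟨x, hx⟩ : ∃ x, x = (1 + τ) / (1 - τ) / ((1 + τG) / (1 - τG)) := ⟨_, rfl⟩
  have hx1 : Cg x 1 := ((hp.mul (hm.inv im)).mul (hGm.mul (hGp.inv ip))).congr
    (by rw [hx]; field_simp) (by linear_combination ip * ((1 - s) * ⟨1, 0, 7, 5⟩) + im)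
  obtain ⟨c, hcσ, hc⟩ := exists_eq_cube (x := x) (by rw [hx]; simp [hτ, conj_τG])
    (hx1.v_eq_one_iff.2 isUnit_one)
    (hx ▸ (cubeVal_ratio_τ hE).div (cubeVal_ratio_τ curve_τG)) (hx1.pow 8) (by rw [one_pow, mul_one])
  have hcx : c ^ 3 * ((1 - τ) * (1 + τG)) = (1 + τ) * (1 - τG) := by
    rw [← hc, hx]; field_simp
  have vc : v c = 1 := v_eq_one_of_pow (n := 3) three_ne_zero (by
    rw [← hc]; exact hx1.v_eq_one_iff.2 isUnit_one)
  obtain ⟨r, hcr⟩ := exists_Cg vc.le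
  have hr3 : r ^ 3 = 1 := ((hcr.pow 3).congr hc.symm rfl).unique hx1
  have hc0 : c ≠ 0 := hcr.ne_zero (hcr.v_eq_one_iff.1 vc)
  obtain ⟨z, hz⟩ : ∃ z, z = W * (1 - τG) / (WG * (1 - τ) * c) := ⟨_, rfl⟩
  have hzσ : conjL z = z := by rw [hz]; simp [hτ, hW, hcσ, conj_τG, conj_WG]
  have hzs : Cg z (t * ⟨8, 6, 1, 0⟩ * r ^ 2) :=
    (((hw.mul hGm).mul (hWG.inv iu)).mul ((hm.inv im).mul (hcr.inv (t := r ^ 2)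
      (by linear_combination hr3)))).congr (by rw [hz]; field_simp)
      (by linear_combination t * ⟨8, 6, 1, 0⟩ * r ^ 2 * im)
  have hcub : (1 + τG) * c ^ 3 + -(1 - τG) * 1 ^ 3 + -(2 * τG) * z ^ 3 = 0 := by
    have h1 : z * (WG * (1 - τ) * c) = W * (1 - τG) := by rw [hz]; field_simp
    have h2 : z ^ 3 * (τG * (1 - τG ^ 2)) * (1 - τ) ^ 3 * c ^ 3 = τ * (1 - τ ^ 2) * (1 - τG) ^ 3 := by
      rw [hE, curve_τG]
      calc _ = δ * (z * (WG * (1 - τ) * c)) ^ 3 := by ring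
        _ = _ := by rw [h1]; ring
    have h3 : z ^ 3 * τG * (1 - τ) = τ * (1 - τG) := by
      refine mul_left_cancel₀ (mul_ne_zero (pow_ne_zero 2 Gm0) (mul_ne_zero m0 p0)) ?_
      linear_combination h2 - z ^ 3 * τG * (1 - τG) * (1 - τ) ^ 2 * hcx
    refine (mul_eq_zero.1 ?_).resolve_right m0
    linear_combination hcx - 2 * h3
  obtain ⟨X, hX⟩ : ∃ X, X = -(1 - τG) * 1 ^ 2 - (1 + τG) * c * z := ⟨_, rfl⟩
  obtain ⟨Y, hY⟩ : ∃ Y, Y = (1 + τG) * c ^ 2 - -(1 - τG) * 1 * z := ⟨_, rfl⟩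
  generalize hw' : t * ⟨8, 6, 1, 0⟩ * r ^ 2 = w at hzs
  have hXY : Cg (X - Y) (-(1 - s) * 1 ^ 2 - (1 + s) * r * w - ((1 + s) * r ^ 2 - -(1 - s) * 1 * w)) := by
    rw [hX, hY]
    exact ((hGm.neg.mul (Cg.one.pow 2)).sub ((hGp.mul hcr).mul hzs)).sub
      ((hGp.mul (hcr.pow 2)).sub ((hGm.neg.mul Cg.one).mul hzs))
  have hr1 : 3 * bA * r = 3 * bA := by
    obtain ⟨q, hq⟩ := A.not_isUnit_iff.1 (A.not_isUnit_sub_one hr3)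
    linear_combination 3 * bA * hq + 3 * q * bA_sq + q * h9
  have hs0 : 3 * bA * s = 0 := by rw [hs]; decide +kernel
  have hi : 3 * bA * ⟨8, 6, 1, 0⟩ = -(3 * bA) := by decide +kernel
  have hi2 : (3 : A) * ⟨8, 6, 1, 0⟩ ^ 2 = 3 + 3 * bA := by decide +kernel
  have hu1 : 3 * bA * u = -(3 * bA) := by rw [hu]; decide +kernel
  generalize (⟨8, 6, 1, 0⟩ : A) = i at hw' hi hi2
  have hw1 : 3 * bA * w = 3 * bA := by
    rw [← hw']
    linear_combination bA * i * r ^ 2 * ht - r ^ 2 * hi + (r + 1) * hr1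
  have hw2 : 3 * (w ^ 2 - r) = 3 * bA := by
    rw [← hw']
    linear_combination (t - 1) * i ^ 2 * r ^ 4 * ht + r ^ 4 * hi2 + (3 + 3 * bA) * r * hr3 + hr1
  generalize hd : (-(1 - s) * 1 ^ 2 - (1 + s) * r * w - ((1 + s) * r ^ 2 - -(1 - s) * 1 * w)) = d at hXY
  have hd1 : 3 * bA * d = 3 * bA * (-4) := by
    rw [← hd]
    linear_combination (-w - r - 1) * hr1 - 2 * hw1 + (1 - r * w - r ^ 2 + w) * hs0
  have hdu : IsUnit d := A.isUnit_of_congr hd1 (IsUnit.of_mul_eq_one 2 (by decide +kernel))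
  obtain ⟨d', hd'⟩ := hdu.exists_right_inv
  have hD := hXY.ne_zero hdu
  have hT := (hzs.pow 2).sub hcr
  obtain ⟨q, hTq, hq⟩ := hT.div_β (A.not_isUnit_of_congr (by linear_combination bA * hw2 + 3 * bA_sq + h9))
  have hq1 : 3 * bA * q = 3 * bA := by linear_combination 3 * hq + hw2
  refine no_unit_point (g := (X + Y) / ((X - Y) * β)) (t := -2 * u * q * d') ?_
    (curve_of_cubic (w := WG) hX hY (by ring) (by linear_combination 2 * curve_τG) hcub hD)
    (((((Cg.ofNat 2).neg.mul hWG).mul hTq).mul (hXY.inv hd')).congr ?_ rfl) (Or.inl ?_)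
  · rw [hX, hY]
    simp only [map_div₀, map_mul, map_add, map_sub, map_neg, map_pow, map_one, conj_τG, hcσ, hzσ, conj_β]
  · rw [mul_one]; field_simp
  · have h : 3 * bA * d' = -(3 * bA) := by
      linear_combination d' * hd1 - 3 * bA * hd' - bA * d' * h9
    linear_combination -2 * q * d' * hu1 + 2 * d' * hq1 + 2 * h - bA * h9

/-- Three-divisibility does not occur on the intermediate curve. -/
theorem false_of_half {τ W : L} {t : A} (hτ : conjL τ = τ) (hW : conjL W = W)
    (hE : τ * (1 - τ ^ 2) = δ * W ^ 3) (hw : Cg W t) (ht : 3 * t = 3 ∨ 3 * t = -3)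
    (hv : v τ ≤ v β) : False := by
  rcases ht with ht | ht
  · exact false_of_half_neg (τ := -τ) (W := -W) (by rw [map_neg, hτ]) (by rw [map_neg, hW])
      (by linear_combination -hE) hw.neg (by linear_combination -ht) (by rwa [Valuation.map_neg])
  · exact false_of_half_neg hτ hW hE hw ht hv

theorem false_of_level (k : ℕ) : ∀ {g Z z₀ : L} {t : A}, conjL g = g → conjL Z = Z →
    g * (g ^ 2 + 1) = δ * Z ^ 3 → Z = β * (3 ^ k * z₀) → Cg z₀ t → 3 * t = 3 ∨ 3 * t = -3 →
    False := by
  induction k with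
  | zero =>
    intro g Z z₀ t hg hZ hE hZz hz ht
    obtain ⟨τ, W, w₀, hτ, hW, hE', hWw, hw, hv⟩ := exists_half 0 hg hZ hE hZz hz ht
    rw [pow_zero, one_mul] at hWw
    rw [pow_zero, mul_one] at hv
    exact false_of_half hτ hW hE' (hWw ▸ hw) ht hv
  | succ k ih =>
    intro g Z z₀ t hg hZ hE hZz hz ht
    obtain ⟨τ, W, w₀, hτ, hW, hE', hWw, hw, hv⟩ := exists_half (k + 1) hg hZ hE hZz hz ht
    obtain ⟨g', Z', z', t', hg', hZ', hE'', hZz', hz', ht'⟩ :=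
      exists_descent k hτ hW hE' hWw hw hv
    exact ih hg' hZ' hE'' hZz' hz' (by rwa [ht'])

lemma exists_cube_of_mul {w : Valuation L (WithZero (Multiplicative ℤ))} {u u' n : L}
    (h : w u * w u' = w n ^ 3) (h1 : w u = 1 ∨ w u' = 1) : ∃ y, w u = y ^ 3 := by
  rcases h1 with h1 | h1
  · exact ⟨1, by rw [h1, one_pow]⟩
  · exact ⟨w n, by rw [← h, h1, mul_one]⟩

lemma valuation_toL_le (P : HeightOneSpectrum (𝓞 L)) (n : 𝓞 L) : P.valuation L (toL n) ≤ 1 :=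
  P.valuation_le_one n

lemma valuation_intCast_le (P : HeightOneSpectrum (𝓞 L)) (n : ℤ) : P.valuation L (n : L) ≤ 1 := by
  have h := valuation_toL_le P n
  rwa [map_intCast] at h

/-- `a² - 2b²` and `8b²(a + eb)` have no common prime factor away from `6`. -/
lemma false_of_common {P : HeightOneSpectrum (𝓞 L)} (hP : P.valuation L 6 = 1) {a b : ℤ}
    (hab : IsCoprime a b) (hN : P.valuation L ((a : L) ^ 2 - 2 * (b : L) ^ 2) < 1) {e : L} (he : e = 1 ∨ e = 2)
    (hs : P.valuation L (8 * (b : L) ^ 2 * (a + e * b)) < 1) : False := by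
  have h2 := valuation_two hP
  have key : ∀ {x y : L}, P.valuation L x < 1 → P.valuation L y < 1 → P.valuation L (x - y) < 1 :=
    fun hx hy => ((P.valuation L).map_sub _ _).trans_lt (max_lt hx hy)
  have hmul : ∀ {x y : L}, P.valuation L x < 1 → P.valuation L y ≤ 1 → P.valuation L (x * y) < 1 :=
    fun hx hy => by rw [map_mul]; exact mul_lt_one_of_lt_of_le hx hy
  have hsq : ∀ {x : L}, P.valuation L (x ^ 2) < 1 → P.valuation L x < 1 := fun {x} hx => by
    by_contra! h; rw [map_pow] at hx; exact absurd (one_le_pow₀ h) (not_le.2 hx)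
  have vb2 := (map_pow (P.valuation L) (b : L) 2).le.trans (pow_le_one₀ zero_le (valuation_intCast_le P b))
  have hb : P.valuation L (b : L) < 1 := by
    by_contra! hb
    have hb1 := le_antisymm (valuation_intCast_le P b) hb
    rw [show (8 : L) = 2 ^ 3 by norm_num, map_mul, map_mul, map_pow, map_pow, h2, hb1] at hs
    simp only [one_pow, one_mul] at hs
    have h3 : P.valuation L ((a : L) - e * b) ≤ 1 := by
      refine ((P.valuation L).map_sub _ _).trans (max_le (valuation_intCast_le P a) ?_)
      rcases he with rfl | rfl
      · rw [one_mul, hb1]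
      · rw [map_mul, h2, hb1, one_mul]
    have h4 := key (hmul hs h3) hN
    rcases he with rfl | rfl
    · rw [show ((a : L) + 1 * b) * (a - 1 * b) - (a ^ 2 - 2 * b ^ 2) = b ^ 2 by ring, map_pow, hb1,
        one_pow] at h4
      exact lt_irrefl _ h4
    · rw [show ((a : L) + 2 * b) * (a - 2 * b) - (a ^ 2 - 2 * b ^ 2) = -(2 * b ^ 2) by ring,
        Valuation.map_neg, map_mul, map_pow, hb1, h2, one_pow, mul_one] at h4
      exact lt_irrefl _ h4
  have ha : P.valuation L (a : L) < 1 := by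
    apply hsq
    have h := key hN (y := -2 * b * (b : L)) (by
      rw [show -2 * (b : L) * b = b * -(2 * b) by ring]
      refine hmul hb ?_
      rw [Valuation.map_neg, map_mul, h2, one_mul]; exact valuation_intCast_le P b)
    rwa [show (a : L) ^ 2 - 2 * b ^ 2 - -2 * b * b = a ^ 2 by ring] at h
  obtain ⟨r, s, hrs⟩ := hab
  have h := key (hmul ha (valuation_intCast_le P r)) (y := -(b * (s : L)))
    (by rw [Valuation.map_neg]; exact hmul hb (valuation_intCast_le P s))
  rw [show (a : L) * r - -(b * s) = ((r * a + s * b : ℤ) : L) by push_cast; ring, hrs] at h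
  simp at h

/-- The cube parts of the descent: a sum and product criterion. -/
lemma cubeVal_of_factor {a b : ℤ} (hab : IsCoprime a b) {e c u u' : L} (he : e = 1 ∨ e = 2)
    (hu : ∃ x, u = toL x) (hu' : ∃ x, u' = toL x)
    (hc : ∀ P : HeightOneSpectrum (𝓞 L), P.valuation L 6 = 1 → P.valuation L c = 1)
    (hprod : u * u' = c * ((a : L) ^ 2 - 2 * b ^ 2) ^ 3)
    {d : L} (hd : ∀ P : HeightOneSpectrum (𝓞 L), P.valuation L 6 = 1 → P.valuation L d = 1)
    (hsum : ∃ m : ℤ, u + u' = d * (((a : L) ^ 2 - 2 * b ^ 2) * m + 8 * b ^ 2 * (a + e * b))) : CubeVal u := by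
  intro P hP
  obtain ⟨x, rfl⟩ := hu
  obtain ⟨x', rfl⟩ := hu'
  have hm : P.valuation L (toL x) * P.valuation L (toL x') =
      P.valuation L ((a : L) ^ 2 - 2 * b ^ 2) ^ 3 := by
    rw [← map_mul, hprod, map_mul, hc P hP, one_mul, map_pow]
  refine exists_cube_of_mul hm ?_
  by_contra! h
  have h1 := lt_of_le_of_ne (valuation_toL_le P x) h.1
  have h2 := lt_of_le_of_ne (valuation_toL_le P x') h.2
  have hN : P.valuation L ((a : L) ^ 2 - 2 * (b : L) ^ 2) < 1 := by
    by_contra! h3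
    exact absurd (one_le_pow₀ h3) (not_le.2 (hm ▸ mul_lt_one_of_lt_of_le h1 h2.le))
  obtain ⟨m, hm'⟩ := hsum
  have h3 : P.valuation L (((a : L) ^ 2 - 2 * b ^ 2) * m + 8 * b ^ 2 * (a + e * b)) < 1 := by
    have := ((P.valuation L).map_add _ _).trans_lt (max_lt h1 h2)
    rwa [hm', map_mul, hd P hP, one_mul] at this
  refine false_of_common hP hab hN he ?_
  have h4 : P.valuation L (((a : L) ^ 2 - 2 * b ^ 2) * m) < 1 := by
    rw [map_mul]; exact mul_lt_one_of_lt_of_le hN (valuation_intCast_le P m)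
  have h5 := ((P.valuation L).map_sub _ _).trans_lt (max_lt h3 h4)
  rwa [add_sub_cancel_left] at h5

/-- The second coordinate of the descent. -/
noncomputable def x₁ (a b y : ℤ) : L :=
  (a ^ 3 + 3 * a ^ 2 * b + 6 * a * b ^ 2 + 2 * b ^ 3) +
    (y - (a ^ 3 + 3 * a ^ 2 * b + 6 * a * b ^ 2 + 2 * b ^ 3)) * ((β - 1) / 2)

/-- The third coordinate of the descent. -/
noncomputable def x₂ (a b y : ℤ) : L :=
  (a ^ 3 + 6 * a ^ 2 * b + 6 * a * b ^ 2 + 4 * b ^ 3) +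
    (y - (a ^ 3 + 6 * a ^ 2 * b + 6 * a * b ^ 2 + 4 * b ^ 3)) * (α * β - 2)

lemma conj_x₁ (a b y : ℤ) : conjL (x₁ a b y) = x₁ a b y := by
  simp only [x₁, map_add, map_sub, map_mul, map_pow, map_div₀, map_one, map_ofNat, map_intCast, conj_β]

lemma conj_x₂ (a b y : ℤ) : conjL (x₂ a b y) = x₂ a b y := by
  simp only [x₂, map_add, map_sub, map_mul, map_pow, map_ofNat, map_intCast, conj_α, conj_β]

lemma cubic_relation {a b y : ℤ} (h : y ^ 2 = a ^ 6 + 18 * a ^ 5 * b + 75 * a ^ 4 * b ^ 2 + 120 * a ^ 3 * b ^ 3 +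
    120 * a ^ 2 * b ^ 4 + 72 * a * b ^ 5 + 28 * b ^ 6) :
    2 * (β - α) * (a + α * b) ^ 3 * x₁ a b y +
    2 * α * (1 - β) * (a + α * b) ^ 3 * x₂ a b y + 2 * β * (α - 1) * x₁ a b y * x₂ a b y = 0 := by
  have h' := congrArg (Int.cast : ℤ → L) h
  push_cast at h'
  have h2 := α_sq
  have h3 := β_sq
  have e : ((a : L) + α * b) ^ 3 = a ^ 3 + 6 * a * b ^ 2 + α * (3 * a ^ 2 * b + 2 * b ^ 3) := by
    linear_combination (3 * a * b ^ 2 + α * b ^ 3) * h2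
  obtain ⟨S, hS⟩ : ∃ S : L, S = a ^ 3 + 6 * a * b ^ 2 := ⟨_, rfl⟩
  obtain ⟨B, hB⟩ : ∃ B : L, B = 3 * a ^ 2 * b + 2 * b ^ 3 := ⟨_, rfl⟩
  have hx : x₁ a b y = S + B + (y - S - B) * ((β - 1) / 2) := by rw [x₁, hS, hB]; ring
  have hy : x₂ a b y = S + 2 * B + (y - S - 2 * B) * (α * β - 2) := by rw [x₂, hS, hB]; ring
  have hh : (y : L) ^ 2 = 2 * (S + 2 * B) ^ 2 - (S + B) ^ 2 := by rw [h', hS, hB]; ring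
  rw [e, ← hS, ← hB, hx, hy]
  have key : 2 * (β - α) * (S + α * B) * (S + B + (y - S - B) * ((β - 1) / 2)) +
      2 * α * (1 - β) * (S + α * B) * (S + 2 * B + (y - S - 2 * B) * (α * β - 2)) +
      2 * β * (α - 1) * (S + B + (y - S - B) * ((β - 1) / 2)) *
        (S + 2 * B + (y - S - 2 * B) * (α * β - 2)) -
      β * (α - 1) * (β - 1) * (α * β - 2) *
        ((y : L) ^ 2 - (2 * (S + 2 * B) ^ 2 - (S + B) ^ 2)) = 0 := by
    have h2' : α ^ 3 = 2 * α := by linear_combination α * h2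
    have h3' : β ^ 3 = 3 * β := by linear_combination β * h3
    ring_nf
    simp only [h2, h3, h2', h3']
    ring
  linear_combination key + β * (α - 1) * (β - 1) * (α * β - 2) * hh

lemma cubeVal_x₁ {a b y : ℤ} (hab : IsCoprime a b)
    (h : y ^ 2 = a ^ 6 + 18 * a ^ 5 * b + 75 * a ^ 4 * b ^ 2 + 120 * a ^ 3 * b ^ 3 +
    120 * a ^ 2 * b ^ 4 + 72 * a * b ^ 5 + 28 * b ^ 6) :
    CubeVal (x₁ a b y) := by
  have h' := congrArg (Int.cast : ℤ → L) h
  push_cast at h'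
  have h3 := β_sq
  have hu : CubeVal ((y : L) + β * (a ^ 3 + 3 * a ^ 2 * b + 6 * a * b ^ 2 + 2 * b ^ 3)) := by
    refine cubeVal_of_factor (u' := -y + β * (a ^ 3 + 3 * a ^ 2 * b + 6 * a * b ^ 2 + 2 * b ^ 3))
      (e := 1) (c := 2) (d := 2 * β) hab (Or.inl rfl)
      ⟨y + be * (a ^ 3 + 3 * a ^ 2 * b + 6 * a * b ^ 2 + 2 * b ^ 3), ?_⟩
      ⟨-y + be * (a ^ 3 + 3 * a ^ 2 * b + 6 * a * b ^ 2 + 2 * b ^ 3), ?_⟩ (fun P hP => valuation_two hP) ?_ ?_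
      ⟨a + 3 * b, ?_⟩
    · simp only [map_add, map_mul, map_pow, map_intCast, map_ofNat]; rfl
    · simp only [map_add, map_mul, map_pow, map_intCast, map_ofNat, map_neg]; rfl
    · linear_combination (a ^ 3 + 3 * a ^ 2 * b + 6 * a * b ^ 2 + 2 * b ^ 3 : L) ^ 2 * h3 - h'
    · intro P hP
      have e (n : ℕ) [n.AtLeastTwo] : toL (OfNat.ofNat n * be) = OfNat.ofNat n * β := by
        rw [map_mul, map_ofNat]; rfl
      have := valuation_eq_one_of_mul_eq_pow (a := 2 * be) (b := 6 * be) hP (n := 2) (by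
        rw [e, e]; linear_combination 12 * h3)
      rwa [e] at this
    · push_cast; ring
  have h1 : CubeVal (1 + β) := CubeVal.of_mul_eq_pow (n := 1) ⟨1 + be, by rw [map_add, map_one]; rfl⟩
    (y := 3 * (β - 1)) ⟨3 * (be - 1), by simp only [map_mul, map_sub, map_one, map_ofNat]; rfl⟩
    (by linear_combination 3 * h3)
  have h0 : (1 + β) * (β - 1) = 2 := by linear_combination h3
  have h0' : 1 + β ≠ 0 := left_ne_zero_of_mul (h0.trans_ne two_ne_zero)
  have : x₁ a b y = (y + β * (a ^ 3 + 3 * a ^ 2 * b + 6 * a * b ^ 2 + 2 * b ^ 3)) / (1 + β) := by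
    rw [x₁, eq_div_iff h0']
    linear_combination (y - (a ^ 3 + 3 * a ^ 2 * b + 6 * a * b ^ 2 + 2 * b ^ 3 : L)) / 2 * h0
  rw [this]
  exact hu.div h1

lemma cubeVal_x₂ {a b y : ℤ} (hab : IsCoprime a b)
    (h : y ^ 2 = a ^ 6 + 18 * a ^ 5 * b + 75 * a ^ 4 * b ^ 2 + 120 * a ^ 3 * b ^ 3 +
    120 * a ^ 2 * b ^ 4 + 72 * a * b ^ 5 + 28 * b ^ 6) :
    CubeVal (x₂ a b y) := by
  have h' := congrArg (Int.cast : ℤ → L) h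
  push_cast at h'
  have h2 := α_sq
  have h3 := β_sq
  have hu : CubeVal (3 * (a ^ 3 + 6 * a ^ 2 * b + 6 * a * b ^ 2 + 4 * b ^ 3) + α * β * (y : L)) := by
    refine cubeVal_of_factor (u' := 3 * (a ^ 3 + 6 * a ^ 2 * b + 6 * a * b ^ 2 + 4 * b ^ 3) - α * β * (y : L))
      (e := 2) (c := 3) (d := 6) hab (Or.inr rfl)
      ⟨3 * (a ^ 3 + 6 * a ^ 2 * b + 6 * a * b ^ 2 + 4 * b ^ 3) + al * be * y, ?_⟩
      ⟨3 * (a ^ 3 + 6 * a ^ 2 * b + 6 * a * b ^ 2 + 4 * b ^ 3) - al * be * y, ?_⟩ (fun P hP => ?_) ?_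
      (fun P hP => hP) ⟨a + 6 * b, ?_⟩
    · simp only [map_add, map_mul, map_pow, map_intCast, map_ofNat]; rfl
    · simp only [map_add, map_sub, map_mul, map_pow, map_intCast, map_ofNat]; rfl
    · have := valuation_eq_one_of_mul_eq_pow (a := 3) (b := 2) hP (n := 1) (by
        simp only [map_ofNat]; norm_num)
      simpa only [map_ofNat] using this
    · linear_combination -(α ^ 2 * h3 + 3 * h2) * (y : L) ^ 2 - 6 * h'
    · push_cast; ring
  have h1 : CubeVal (3 + α * β) := CubeVal.of_mul_eq_pow (n := 1) ⟨3 + al * be, by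
      simp only [map_add, map_mul, map_ofNat]; rfl⟩
    (y := 2 * (3 - α * β)) ⟨2 * (3 - al * be), by simp only [map_mul, map_sub, map_ofNat]; rfl⟩
    (by linear_combination -2 * α ^ 2 * h3 - 6 * h2)
  have h0 : (3 + α * β) * (3 - α * β) = 3 := by linear_combination - α ^ 2 * h3 - 3 * h2
  have h0' : 3 + α * β ≠ 0 := left_ne_zero_of_mul (h0.trans_ne three_ne_zero)
  have : x₂ a b y = (3 * (a ^ 3 + 6 * a ^ 2 * b + 6 * a * b ^ 2 + 4 * b ^ 3) + α * β * (y : L)) / (3 + α * β) := by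
    rw [x₂, eq_div_iff h0']
    linear_combination (y - (a ^ 3 + 6 * a ^ 2 * b + 6 * a * b ^ 2 + 4 * b ^ 3 : L)) * (α ^ 2 * h3 + 3 * h2)
  rw [this]
  exact hu.div h1

/-- An element which is a cube locally everywhere and near a cube at the chosen prime above three
is a cube, of an element near a conjugate of the given root. -/
lemma exists_cube_root_near {x u r : L} {s : A} {m : ℕ} (hσ : conjL x = x) (hQ : CubeVal x)
    (hx : x = u ^ 3 + 3 ^ (m + 3) * r) (hu : Cg u s) (hs : IsUnit s) (hr : v r ≤ 1) :
    ∃ (c : L) (j : Fin 3) (e : L), conjL c = c ∧ x = c ^ 3 ∧ v e ≤ 1 ∧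
      c = ω ^ j.1 * u + 3 ^ (m + 2) * e := by
  have h9 := A.nine_eq_zero
  obtain ⟨t, ht⟩ := exists_Cg hr
  have hxs : Cg x (s ^ 3) := ((hu.pow 3).add (((Cg.ofNat 3).pow (m + 3)).mul ht)).congr hx.symm (by
    linear_combination 3 ^ (m + 1) * t * h9)
  obtain ⟨c, hc, hxc⟩ := exists_eq_cube hσ (hxs.v_eq_one_iff.2 (hs.pow 3)) hQ (hxs.pow 8) (by
    rw [← pow_mul]; exact A.pow_24 hs)
  obtain ⟨j, hj⟩ := exists_close_root c (hu.v_eq_one_iff.2 hs)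
  have h3 : v 3 ≠ 0 := by rw [v_three]; exact WithZero.exp_ne_zero
  have h : v (c - ω ^ j.1 * u) ≤ v (3 ^ (m + 2)) := by
    have h : c ^ 3 - u ^ 3 = 3 ^ (m + 2) * 3 * r := by rw [← hxc, hx]; ring
    rw [h, map_mul, map_mul] at hj
    refine le_of_mul_le_mul_right (hj.trans (mul_le_of_le_one_right' hr)) (zero_lt_iff.2 h3)
  obtain ⟨e, he, hce⟩ := exists_eq_mul_of_v_le h
  exact ⟨c, j, e, hc, hxc, he, by linear_combination hce⟩

/-- The reduction of `α`. -/
def aA : A := ⟨0, 1, 0, 0⟩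

namespace A

/-- The reduction of the denominator of the map from the cubic, as a function of the reductions of
the three cube roots. -/
def den (s₀ s₁ s₂ : A) : A :=
  2 * aA * (1 - bA) * (s₀ * s₂) ^ 2 - 2 * (bA - aA) * (s₀ * s₁) * (s₁ * s₂) -
    (2 * (bA - aA) * (s₀ * s₁) ^ 2 - 2 * aA * (1 - bA) * (s₀ * s₂) * (s₁ * s₂))

lemma den_congr {s₀ s₁ s₂ t₀ t₁ t₂ : A} (h₀ : Eqv 3 s₀ t₀) (h₁ : Eqv 3 s₁ t₁) (h₂ : Eqv 3 s₂ t₂) :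
    Eqv 3 (den s₀ s₁ s₂) (den t₀ t₁ t₂) :=
  (((Eqv.rfl.mul ((h₀.mul h₂).pow 2))).sub ((Eqv.rfl.mul (h₀.mul h₁)).mul (h₁.mul h₂))).sub
    ((Eqv.rfl.mul ((h₀.mul h₁).pow 2)).sub ((Eqv.rfl.mul (h₀.mul h₂)).mul (h₁.mul h₂)))

lemma den_omA (j l : Fin 3) : 3 * bA * den 1 (omA ^ j.1) (omA ^ l.1) = 3 * bA * (8 * aA) := by
  revert j l; decide +kernel

lemma isUnit_eight_mul_aA : IsUnit (8 * aA) := IsUnit.of_mul_eq_one (4 * aA) (by decide +kernel)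

lemma den_of_ne : ∀ j l : Fin 3, (j.1 + l.1) % 3 ≠ 0 →
    3 * bA * (omA ^ j.1 * omA ^ l.1 * (omA ^ j.1 * omA ^ l.1 - 1)) = 0 ∧
    (3 * (-2 * (omA ^ j.1 * omA ^ l.1 * (omA ^ j.1 * omA ^ l.1 - 1))) = 3 * bA * (8 * aA) ∨
      3 * (-2 * (omA ^ j.1 * omA ^ l.1 * (omA ^ j.1 * omA ^ l.1 - 1))) = -(3 * bA * (8 * aA))) := by
  decide +kernel

lemma den_of_eq : ∀ j l : Fin 3, (j.1 + l.1) % 3 = 0 →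
    3 * (-2 * (omA ^ j.1 * omA ^ l.1) * (bA + aA * bA - 2 * aA)) =
        3 * den 1 (omA ^ j.1) (omA ^ l.1) ∨
      3 * (-2 * (omA ^ j.1 * omA ^ l.1) * (bA + aA * bA - 2 * aA)) =
        -(3 * den 1 (omA ^ j.1) (omA ^ l.1)) := by
  decide +kernel

end A

lemma exists_eq_of_dvd {a b' y : ℤ} {m : ℕ} (ha : a % 3 = 1) (hy : y % 3 = 1)
    (h : y ^ 2 = a ^ 6 + 18 * a ^ 5 * (3 ^ (m + 1) * b') + 75 * a ^ 4 * (3 ^ (m + 1) * b') ^ 2 +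
      120 * a ^ 3 * (3 ^ (m + 1) * b') ^ 3 + 120 * a ^ 2 * (3 ^ (m + 1) * b') ^ 4 +
      72 * a * (3 ^ (m + 1) * b') ^ 5 + 28 * (3 ^ (m + 1) * b') ^ 6) :
    ∃ e, y = a ^ 3 + 6 * a * (3 ^ (m + 1) * b') ^ 2 +
      3 * (3 * a ^ 2 * (3 ^ (m + 1) * b') + 2 * (3 ^ (m + 1) * b') ^ 3) + 3 ^ (m + 2) * 3 ^ (m + 2) * e := by
  have hc : IsCoprime ((3 : ℤ) ^ (m + 2) * 3 ^ (m + 2))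
      (y + (a ^ 3 + 6 * a * (3 ^ (m + 1) * b') ^ 2 +
        3 * (3 * a ^ 2 * (3 ^ (m + 1) * b') + 2 * (3 ^ (m + 1) * b') ^ 3))) := by
    rw [← pow_add]
    refine IsCoprime.pow_left ?_
    rw [Int.isCoprime_iff_gcd_eq_one]
    obtain ⟨p, hp⟩ : ∃ p, a = 3 * p + 1 := ⟨a / 3, by omega⟩
    obtain ⟨q, hq⟩ : ∃ q, y = 3 * q + 1 := ⟨y / 3, by omega⟩
    refine (Int.isCoprime_iff_gcd_eq_one).1 ⟨1 + (q + (9 * p ^ 3 + 9 * p ^ 2 + 3 * p) + 2 * a * (3 ^ (m + 1) * b') ^ 2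
      + (3 * a ^ 2 * (3 ^ (m + 1) * b') + 2 * (3 ^ (m + 1) * b') ^ 3)), -1, ?_⟩
    rw [hq, hp]; ring
  have hd : (3 : ℤ) ^ (m + 2) * 3 ^ (m + 2) ∣ (y + (a ^ 3 + 6 * a * (3 ^ (m + 1) * b') ^ 2 +
        3 * (3 * a ^ 2 * (3 ^ (m + 1) * b') + 2 * (3 ^ (m + 1) * b') ^ 3))) *
      (y - (a ^ 3 + 6 * a * (3 ^ (m + 1) * b') ^ 2 +
        3 * (3 * a ^ 2 * (3 ^ (m + 1) * b') + 2 * (3 ^ (m + 1) * b') ^ 3))) :=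
    ⟨-2 * (b' * (a ^ 2 + 6 * 3 ^ m * 3 ^ m * b' ^ 2)) ^ 2, by
      rw [show ∀ p q : ℤ, (p + q) * (p - q) = p ^ 2 - q ^ 2 by intros; ring, h]; ring⟩
  obtain ⟨e, he⟩ := hc.dvd_of_dvd_mul_left hd
  exact ⟨e, by linear_combination he⟩

lemma A.three_mul_intCast {a : ℤ} (h : a % 3 = 1) : 3 * (a : A) = 3 := by
  obtain ⟨p, rfl⟩ : ∃ p, a = 3 * p + 1 := ⟨a / 3, by omega⟩
  push_cast
  linear_combination (p : A) * A.nine_eq_zero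

lemma A.three_mul_intCast' {b : ℤ} (h : b % 3 ≠ 0) : 3 * (b : A) = 3 ∨ 3 * (b : A) = -3 := by
  rcases (by omega : b % 3 = 1 ∨ -b % 3 = 1) with h | h
  · exact Or.inl (A.three_mul_intCast h)
  · have := A.three_mul_intCast h
    push_cast at this
    exact Or.inr (by linear_combination -this)

theorem false_of_three_dvd {a b' y : ℤ} {m : ℕ} (hab : IsCoprime a (3 ^ (m + 1) * b'))
    (hb' : b' % 3 ≠ 0) (ha : a % 3 = 1) (hy : y % 3 = 1)
    (h : y ^ 2 = a ^ 6 + 18 * a ^ 5 * (3 ^ (m + 1) * b') + 75 * a ^ 4 * (3 ^ (m + 1) * b') ^ 2 +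
      120 * a ^ 3 * (3 ^ (m + 1) * b') ^ 3 + 120 * a ^ 2 * (3 ^ (m + 1) * b') ^ 4 +
      72 * a * (3 ^ (m + 1) * b') ^ 5 + 28 * (3 ^ (m + 1) * b') ^ 6) : False := by
  have h9 := A.nine_eq_zero
  have hα := α_sq
  have hβ := β_sq
  have β0 := β_ne_zero
  obtain ⟨e, hye⟩ := exists_eq_of_dvd ha hy h
  have hQ₁ := cubeVal_x₁ hab h
  have hQ₂ := cubeVal_x₂ hab h
  have hrel := cubic_relation h
  have ca : Cg (a : L) (a : A) := Cg.intCast a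
  have cb' : Cg (b' : L) (b' : A) := Cg.intCast b'
  have ce : Cg (e : L) (e : A) := Cg.intCast e
  have c3 : Cg (3 ^ m : L) (3 ^ m) := (Cg.ofNat 3).pow m
  have ha3 := A.three_mul_intCast ha
  obtain ⟨b, hb⟩ : ∃ b : ℤ, b = 3 ^ (m + 1) * b' := ⟨_, rfl⟩
  rw [← hb] at hQ₁ hQ₂ hrel hye
  have hbL : (b : L) = 3 * (3 ^ m * b') := by rw [hb]; push_cast; ring
  have hbA : (b : A) = 3 * (3 ^ m * b') := by rw [hb]; push_cast; ring
  have cb : Cg (b : L) (b : A) := Cg.intCast b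
  have hyL : (y : L) = a ^ 3 + 6 * a * b ^ 2 + 3 * (3 * a ^ 2 * b + 2 * b ^ 3) +
      3 ^ (m + 2) * 3 ^ (m + 2) * e := by rw [hye]; push_cast; ring
  have cb1 : Cg ((β - 1) / 2) (5 * (bA - 1)) := (((Cg.ofNat 2).inv (t := 5) (by decide +kernel)).mul
    (Cg.β.sub Cg.one)).congr (by ring) rfl
  have cu : ∀ {x : L} {s : A}, Cg x s → Cg (a + x * b) (a + s * b) := fun hx => ca.add (hx.mul cb)
  have hu : ∀ s : A, 3 * (a + s * b) = 3 := fun s => by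
    rw [hbA]; linear_combination ha3 + s * (3 ^ m * b') * h9
  have hunit : ∀ s : A, IsUnit ((a : A) + s * b) := fun s =>
    A.isUnit_of_congr (y := 1) (by linear_combination bA * hu s) isUnit_one
  obtain ⟨g₁, j, e₁, hg₁, hx₁, he₁, hge₁⟩ := exists_cube_root_near (u := a + β * b) (m := m)
    (r := 3 * 3 ^ m * e * ((β - 1) / 2) - a * 3 ^ m * b' ^ 2 - β * (3 ^ m * 3 ^ m) * b' ^ 3)
    (conj_x₁ a b y) hQ₁ (by
      rw [x₁, hyL, hbL]
      linear_combination (-(3 * a * (3 * (3 ^ m * b')) ^ 2) - β * (3 * (3 ^ m * b')) ^ 3 : L) * hβ)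
    (cu Cg.β) (hunit _) ((((((Cg.ofNat 3).mul c3).mul ce).mul cb1).sub ((ca.mul c3).mul (cb'.pow 2))).sub
      ((Cg.β.mul (c3.mul c3)).mul (cb'.pow 3))).v_le_one
  obtain ⟨g₂, l, e₂, hg₂, hx₂, he₂, hge₂⟩ := exists_cube_root_near (u := a + α * β * b) (m := m)
    (r := 3 * 3 ^ m * e * (α * β - 2) - 4 * a * 3 ^ m * b' ^ 2 - 4 * α * β * (3 ^ m * 3 ^ m) * b' ^ 3)
    (conj_x₂ a b y) hQ₂ (by
      rw [x₂, hyL, hbL]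
      linear_combination (-(3 * a * (3 * (3 ^ m * b')) ^ 2) - α * β * (3 * (3 ^ m * b')) ^ 3 : L) *
        (α ^ 2 * hβ + 3 * hα))
    (cu (Cg.α.mul Cg.β)) (hunit _) ((((((Cg.ofNat 3).mul c3).mul ce).mul ((Cg.α.mul Cg.β).sub (Cg.ofNat 2))).sub
      ((((Cg.ofNat 4).mul ca).mul c3).mul (cb'.pow 2))).sub
      (((((Cg.ofNat 4).mul Cg.α).mul Cg.β).mul (c3.mul c3)).mul (cb'.pow 3))).v_le_one
  obtain ⟨q₁, hq₁⟩ := exists_Cg he₁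
  obtain ⟨q₂, hq₂⟩ := exists_Cg he₂
  obtain ⟨s₀, hs₀⟩ : ∃ s : A, s = a + aA * b := ⟨_, rfl⟩
  have hg₀s : Cg (a + α * b) s₀ := (cu Cg.α).congr rfl hs₀.symm
  have hs₀3 : 3 * s₀ = 3 := by rw [hs₀]; exact hu _
  have cω : ∀ j : Fin 3, Cg (ω ^ j.1) (omA ^ j.1) := fun j => Cg.ω.pow j.1
  obtain ⟨s₁, hs₁⟩ : ∃ s : A, s = omA ^ j.1 * (a + bA * b) := ⟨_, rfl⟩
  have hg₁s : Cg g₁ s₁ := (((cω j).mul (cu Cg.β)).add (((Cg.ofNat 3).pow (m + 2)).mul hq₁)).congr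
    hge₁.symm (by rw [hs₁]; change omA ^ j.1 * (a + bA * b) + _ = _; linear_combination 3 ^ m * q₁ * h9)
  have hs₁3 : 3 * s₁ = 3 * omA ^ j.1 := by rw [hs₁]; linear_combination omA ^ j.1 * hu bA
  obtain ⟨s₂, hs₂⟩ : ∃ s : A, s = omA ^ l.1 * (a + aA * bA * b) := ⟨_, rfl⟩
  have hg₂s : Cg g₂ s₂ := (((cω l).mul (cu (Cg.α.mul Cg.β))).add (((Cg.ofNat 3).pow (m + 2)).mul hq₂)).congr
    hge₂.symm (by
      rw [hs₂]; change omA ^ l.1 * (a + aA * bA * b) + _ = _; linear_combination 3 ^ m * q₂ * h9)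
  have hs₂3 : 3 * s₂ = 3 * omA ^ l.1 := by rw [hs₂]; linear_combination omA ^ l.1 * hu (aA * bA)
  obtain ⟨g₀, hg₀⟩ : ∃ g : L, g = a + α * b := ⟨_, rfl⟩
  have hg₀σ : conjL g₀ = g₀ := by
    rw [hg₀]; simp only [map_add, map_mul, map_intCast, conj_α]
  rw [← hg₀] at hg₀s hrel
  rw [hx₁, hx₂] at hrel
  obtain ⟨X, hX⟩ : ∃ X, X = 2 * α * (1 - β) * (g₀ * g₂) ^ 2 - 2 * (β - α) * (g₀ * g₁) * (g₁ * g₂) :=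
    ⟨_, rfl⟩
  obtain ⟨Y, hY⟩ : ∃ Y, Y = 2 * (β - α) * (g₀ * g₁) ^ 2 - 2 * α * (1 - β) * (g₀ * g₂) * (g₁ * g₂) :=
    ⟨_, rfl⟩
  have hXσ : conjL X = X := by
    rw [hX]; simp only [map_sub, map_mul, map_pow, map_one, map_ofNat, conj_α, conj_β, hg₀σ, hg₁, hg₂]
  have hYσ : conjL Y = Y := by
    rw [hY]; simp only [map_sub, map_mul, map_pow, map_one, map_ofNat, conj_α, conj_β, hg₀σ, hg₁, hg₂]
  have k1 : Cg (2 * (β - α)) (2 * (bA - aA)) := (Cg.ofNat 2).mul (Cg.β.sub Cg.α)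
  have k2 : Cg (2 * α * (1 - β)) (2 * aA * (1 - bA)) := ((Cg.ofNat 2).mul Cg.α).mul (Cg.one.sub Cg.β)
  obtain ⟨d, hd⟩ : ∃ d, d = A.den s₀ s₁ s₂ := ⟨_, rfl⟩
  have hDs : Cg (X - Y) d := by
    rw [hX, hY, hd]
    exact ((k2.mul ((hg₀s.mul hg₂s).pow 2)).sub ((k1.mul (hg₀s.mul hg₁s)).mul (hg₁s.mul hg₂s))).sub
      ((k1.mul ((hg₀s.mul hg₁s).pow 2)).sub ((k2.mul (hg₀s.mul hg₂s)).mul (hg₁s.mul hg₂s)))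
  have hd3 : 3 * d = 3 * A.den 1 (omA ^ j.1) (omA ^ l.1) := by
    rw [hd]
    exact A.den_congr (hs₀3.trans (mul_one 3).symm) hs₁3 hs₂3
  have hdb : 3 * bA * d = 3 * bA * (8 * aA) := by
    rw [← A.den_omA j l]; linear_combination bA * hd3
  have hdu : IsUnit d := A.isUnit_of_congr hdb A.isUnit_eight_mul_aA
  obtain ⟨d', hd'⟩ := hdu.exists_right_inv
  have hD0 := hDs.ne_zero hdu
  have hE := curve_of_cubic (c := 2 * β * (α - 1)) (w := 1) hX hY (by ring) (by
    rw [δ, η]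
    linear_combination (8 * β - 8 * β * α + 8 * β ^ 2 * α - 8 * β ^ 3) * hα +
      (8 * α - 16) * β * hβ) (by linear_combination hrel) hD0
  have hgσ : conjL ((X + Y) / ((X - Y) * β)) = (X + Y) / ((X - Y) * β) := by
    simp only [map_div₀, map_add, map_sub, map_mul, conj_β, hXσ, hYσ]
  by_cases hjl : (j.1 + l.1) % 3 = 0
  · obtain ⟨ζ, hζ⟩ : ∃ ζ : L, ζ = a * b' * (β + α * β - 2 * α) + 3 * 3 ^ m * b' ^ 2 * (3 * α - 2) +
      3 * (ω ^ j.1 * (a + β * b) * e₂ + ω ^ l.1 * (a + α * β * b) * e₁ + 3 ^ m * 9 * e₁ * e₂) :=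
      ⟨_, rfl⟩
    obtain ⟨k, hk⟩ : ∃ k : A, k = bA + aA * bA - 2 * aA := ⟨_, rfl⟩
    obtain ⟨f, hζf, hf⟩ : ∃ f, Cg ζ f ∧ 3 * f = 3 * b' * k := by
      obtain ⟨p, hp⟩ : ∃ p, Cg (ω ^ j.1 * (a + β * b) * e₂ + ω ^ l.1 * (a + α * β * b) * e₁ +
          3 ^ m * 9 * e₁ * e₂) p :=
        ⟨_, ((((cω j).mul (cu Cg.β)).mul hq₂).add (((cω l).mul (cu (Cg.α.mul Cg.β))).mul hq₁)).add
          (((c3.mul (Cg.ofNat 9)).mul hq₁).mul hq₂)⟩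
      rw [hζ]
      refine ⟨_, (((ca.mul cb').mul ((Cg.β.add (Cg.α.mul Cg.β)).sub ((Cg.ofNat 2).mul Cg.α))).add
        ((((Cg.ofNat 3).mul c3).mul (cb'.pow 2)).mul (((Cg.ofNat 3).mul Cg.α).sub (Cg.ofNat 2)))).add
        ((Cg.ofNat 3).mul hp), ?_⟩
      change 3 * (a * b' * (bA + aA * bA - 2 * aA) + 3 * 3 ^ m * (b' : A) ^ 2 * (3 * aA - 2) + 3 * p) = _
      rw [← hk]
      linear_combination b' * k * ha3 + (p + 3 ^ m * (b' : A) ^ 2 * (3 * aA - 2)) * h9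
    have hjω : ω ^ j.1 * ω ^ l.1 = 1 := by
      obtain ⟨n, hn⟩ := Nat.dvd_of_mod_eq_zero hjl
      rw [← pow_add, hn, pow_mul, ω_cube, one_pow]
    have hT : g₁ * g₂ - g₀ ^ 2 = 3 * 3 ^ m * ζ := by
      rw [hge₁, hge₂, hg₀, hζ, hbL]
      linear_combination ((a + β * (3 * (3 ^ m * b'))) * (a + α * β * (3 * (3 ^ m * b')))) * hjω +
        α * (3 * (3 ^ m * b') : L) ^ 2 * hβ - (3 * (3 ^ m * b') : L) ^ 2 * hα
    obtain ⟨z₀, hz₀⟩ : ∃ z₀, z₀ = -2 * (g₁ * g₂) * ζ / (X - Y) := ⟨_, rfl⟩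
    have hz₀s : Cg z₀ (-2 * (s₁ * s₂) * f * d') := by
      rw [hz₀, div_eq_mul_inv]
      exact (((Cg.ofNat 2).neg.mul (hg₁s.mul hg₂s)).mul hζf).mul (hDs.inv hd')
    refine false_of_level m (z₀ := z₀) hgσ ?_ hE ?_ hz₀s ?_
    · simp only [map_div₀, map_sub, map_mul, map_neg, map_one, map_pow, map_ofNat, conj_β, hXσ, hYσ, hg₀σ, hg₁, hg₂]
    · rw [show (g₁ * g₂) ^ 2 - g₀ * g₁ * (g₀ * g₂) = g₁ * g₂ * (g₁ * g₂ - g₀ ^ 2) by ring, hT, hz₀]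
      field_simp
      linear_combination (g₁ * g₂ * ζ) * hβ
    · have h3 : 3 * (-2 * (s₁ * s₂) * f * d') =
          3 * (-2 * (omA ^ j.1 * omA ^ l.1) * (bA + aA * bA - 2 * aA)) * b' * d' := by
        rw [← hk]
        linear_combination -2 * s₁ * s₂ * d' * hf - 2 * b' * k * d' * s₂ * hs₁3 -
          2 * b' * k * d' * omA ^ j.1 * hs₂3
      have h4 : 3 * (-2 * (s₁ * s₂) * f * d') = 3 * b' ∨ 3 * (-2 * (s₁ * s₂) * f * d') = -(3 * b') := by
        rcases A.den_of_eq j l hjl with H | H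
        · exact Or.inl (by linear_combination h3 + b' * d' * H - b' * d' * hd3 + 3 * b' * hd')
        · exact Or.inr (by linear_combination h3 + b' * d' * H + b' * d' * hd3 - 3 * b' * hd')
      rcases h4 with h4 | h4 <;> rcases A.three_mul_intCast' hb' with h5 | h5 <;> rw [h4, h5]
      · exact Or.inl rfl
      · exact Or.inr rfl
      · exact Or.inr rfl
      · exact Or.inl (neg_neg 3)
  · obtain ⟨hn, hs⟩ := A.den_of_ne j l hjl
    have hT := ((hg₁s.mul hg₂s).pow 2).sub ((hg₀s.mul hg₁s).mul (hg₀s.mul hg₂s))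
    have hτ : 3 * ((s₁ * s₂) ^ 2 - s₀ * s₁ * (s₀ * s₂)) =
        3 * (omA ^ j.1 * omA ^ l.1 * (omA ^ j.1 * omA ^ l.1 - 1)) := by
      have h0 : A.Eqv 3 s₀ 1 := hs₀3.trans (mul_one 3).symm
      have h1 : A.Eqv 3 s₁ _ := hs₁3
      have h2 : A.Eqv 3 s₂ _ := hs₂3
      have h3 := ((h1.mul h2).pow 2).sub ((h0.mul h1).mul (h0.mul h2))
      unfold A.Eqv at h3
      rw [h3]
      ring
    obtain ⟨q, hTq, hq⟩ := hT.div_β (A.not_isUnit_of_congr (by rw [← hn]; linear_combination bA * hτ))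
    refine no_unit_point (t := -2 * q * d') hgσ hE
      ((((Cg.ofNat 2).neg.mul hTq).mul (hDs.inv hd')).congr (by field_simp) rfl) ?_
    rcases hs with H | H
    · exact Or.inl (by
        linear_combination -6 * d' * hq - 2 * d' * hτ + d' * H - d' * hdb + 3 * bA * hd')
    · exact Or.inr (by
        linear_combination -6 * d' * hq - 2 * d' * hτ + d' * H + d' * hdb - 3 * bA * hd')

lemma A.cube_ne (r : A) : r ^ 3 ≠ ⟨1, 0, 0, 6⟩ := by
  intro h
  have h9 := A.nine_eq_zero
  have hr : ¬ IsUnit (r - 1) := fun hu => by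
    have hu3 := hu.pow 3
    rw [show (r - 1) ^ 3 = bA * (bA * (r - r ^ 2) + ⟨0, 6, 0, 0⟩) by
      have : (⟨1, 0, 0, 6⟩ : A) = 1 + bA * ⟨0, 6, 0, 0⟩ := by decide +kernel
      rw [this] at h
      linear_combination h - (r - r ^ 2) * bA_sq] at hu3
    exact A.not_isUnit_bA_mul _ hu3
  obtain ⟨q, hq⟩ := A.not_isUnit_iff.1 hr
  obtain rfl : r = 1 + bA * q := by linear_combination hq
  have h' : 3 * bA * q + bA * (3 * q ^ 3) = ⟨0, 0, 0, 6⟩ := by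
    have : (⟨1, 0, 0, 6⟩ : A) = 1 + ⟨0, 0, 0, 6⟩ := by decide +kernel
    rw [this] at h
    linear_combination h - (3 * q ^ 2 + bA * q ^ 3) * bA_sq - q ^ 2 * h9
  obtain ⟨a, b, c, d⟩ := q
  have hq' : 3 * bA * (⟨a, b, c, d⟩ : A) = 3 * bA * ⟨a, b, 0, 0⟩ := by
    rw [A.ext_iff_mul a b c d]
    linear_combination 3 * ⟨c, d, 0, 0⟩ * bA_sq + ⟨c, d, 0, 0⟩ * h9
  rw [A.three_mul_pow_three hq', hq'] at h'
  clear hq' h hq hr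
  revert a b
  decide +kernel

lemma false_of_three_dvd_left {a b y : ℤ} (hab : IsCoprime a b) (ha : a % 3 = 0) (hb : b % 3 = 1)
    (hy : y % 9 = 1)
    (h : y ^ 2 = a ^ 6 + 18 * a ^ 5 * b + 75 * a ^ 4 * b ^ 2 + 120 * a ^ 3 * b ^ 3 +
      120 * a ^ 2 * b ^ 4 + 72 * a * b ^ 5 + 28 * b ^ 6) : False := by
  have h9 := A.nine_eq_zero
  have hs : Cg (x₂ a b y) ⟨1, 0, 0, 6⟩ := by
    have ca : Cg (a : L) (a : A) := Cg.intCast a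
    have cb : Cg (b : L) (b : A) := Cg.intCast b
    have cT : Cg (a ^ 3 + 6 * a ^ 2 * b + 6 * a * b ^ 2 + 4 * b ^ 3 : L) 4 :=
      (((((ca.pow 3).add (((Cg.ofNat 6).mul (ca.pow 2)).mul cb)).add
        (((Cg.ofNat 6).mul ca).mul (cb.pow 2))).add ((Cg.ofNat 4).mul (cb.pow 3)))).congr rfl (by
        obtain ⟨p, rfl⟩ : ∃ p, a = 3 * p := ⟨a / 3, by omega⟩
        obtain ⟨q, rfl⟩ : ∃ q, b = 3 * q + 1 := ⟨b / 3, by omega⟩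
        push_cast
        linear_combination (3 * p ^ 3 + 6 * p ^ 2 * (3 * q + 1) + 2 * p * (3 * q + 1) ^ 2 +
          4 * (3 * q ^ 3 + 3 * q ^ 2 + q) : A) * h9)
    have cy : Cg (y : L) 1 := (Cg.intCast y).congr rfl (by
      obtain ⟨q, rfl⟩ : ∃ q, y = 9 * q + 1 := ⟨y / 9, by omega⟩
      push_cast
      linear_combination (q : A) * h9)
    exact (cT.add ((cy.sub cT).mul ((Cg.α.mul Cg.β).sub (Cg.ofNat 2)))).congr rfl (by decide +kernel)
  have hu : IsUnit (⟨1, 0, 0, 6⟩ : A) := IsUnit.of_mul_eq_one ⟨1, 0, 0, 3⟩ (by decide +kernel)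
  obtain ⟨c, -, hc⟩ := exists_eq_cube (conj_x₂ a b y) (hs.v_eq_one_iff.2 hu) (cubeVal_x₂ hab h)
    (hs.pow 8) (by decide +kernel)
  have vc : v c = 1 := v_eq_one_of_pow (n := 3) three_ne_zero (by
    rw [← hc]; exact hs.v_eq_one_iff.2 hu)
  obtain ⟨r, hr⟩ := exists_Cg vc.le
  exact A.cube_ne r (((hr.pow 3).congr hc.symm rfl).unique hs)

lemma false_of_int {a b y : ℤ} (hab : IsCoprime a b) (hb0 : b ≠ 0)
    (h : y ^ 2 = a ^ 6 + 18 * a ^ 5 * b + 75 * a ^ 4 * b ^ 2 + 120 * a ^ 3 * b ^ 3 +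
      120 * a ^ 2 * b ^ 4 + 72 * a * b ^ 5 + 28 * b ^ 6) : False := by
  have z3 : ∀ n : ℤ, (n : ZMod 3) = 0 ↔ n % 3 = 0 := fun n => by
    rw [ZMod.intCast_zmod_eq_zero_iff_dvd]; exact Int.dvd_iff_emod_eq_zero
  by_cases hb : b % 3 = 0
  · have ha : a % 3 ≠ 0 := fun ha => by
      have := hab.isUnit_of_dvd' (Int.dvd_of_emod_eq_zero ha) (Int.dvd_of_emod_eq_zero hb)
      revert this; decide
    have hy : y % 3 ≠ 0 := by
      rw [Ne, ← z3] at ha ⊢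
      rw [← z3] at hb
      have h' := congrArg (Int.cast : ℤ → ZMod 3) h
      push_cast at h'
      rw [hb] at h'
      intro hy
      rw [hy] at h'
      generalize (a : ZMod 3) = x at *
      revert h' ha; revert x; decide
    have hfin : FiniteMultiplicity 3 b := FiniteMultiplicity.of_prime_left Int.prime_three hb0
    obtain ⟨b', hbb, hb'⟩ := hfin.exists_eq_pow_mul_and_not_dvd
    generalize multiplicity 3 b = n at hbb
    subst hbb
    obtain _ | m := n
    · exact (hb' (Int.dvd_of_emod_eq_zero (by simpa using hb))).elim
    have hb1 : b' % 3 ≠ 0 := fun hb1 => hb' (Int.dvd_of_emod_eq_zero hb1)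
    obtain ⟨c, hc, hcy⟩ : ∃ c : ℤ, c % 3 = 1 ∧ c ^ 2 = y ^ 2 := by
      rcases (by omega : y % 3 = 1 ∨ -y % 3 = 1) with hy | hy
      · exact ⟨y, hy, rfl⟩
      · exact ⟨-y, hy, neg_sq y⟩
    rcases (by omega : a % 3 = 1 ∨ -a % 3 = 1) with ha | ha
    · exact false_of_three_dvd hab hb1 ha hc (hcy.trans h)
    · exact false_of_three_dvd (b' := -b') (by rw [mul_neg]; exact hab.neg_neg) (by omega) ha hc
        (by rw [hcy, h]; ring)
  · have ha : a % 3 = 0 := by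
      rw [← z3] at hb ⊢
      have h' := congrArg (Int.cast : ℤ → ZMod 3) h
      push_cast at h'
      generalize (a : ZMod 3) = p, (b : ZMod 3) = q, (y : ZMod 3) = r at *
      revert h' hb; revert p q r; decide +kernel
    have hy : y % 9 = 1 ∨ -y % 9 = 1 := by
      have h' := congrArg (Int.cast : ℤ → ZMod 9) h
      obtain ⟨p, rfl⟩ : ∃ p, a = 3 * p := ⟨a / 3, by omega⟩
      have z9 : ∀ n : ℤ, n % 9 = 1 ↔ (n : ZMod 9) = 1 := fun n => by
        rw [show (1 : ZMod 9) = ((1 : ℤ) : ZMod 9) by norm_num, ZMod.intCast_eq_intCast_iff']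
        norm_num
      have hb3 : 3 * (b : ZMod 9) ≠ 0 := fun hb3 => hb (by
        have : ((3 * b : ℤ) : ZMod 9) = 0 := by exact_mod_cast hb3
        rw [ZMod.intCast_zmod_eq_zero_iff_dvd] at this
        push_cast at this
        omega)
      push_cast at h'
      rw [z9, z9]
      push_cast
      have hn : (9 : ZMod 9) = 0 := by decide
      have h1 : (y : ZMod 9) ^ 2 = 28 * (b : ZMod 9) ^ 6 := by
        rw [h']
        linear_combination (81 * (p : ZMod 9) ^ 6 + 486 * p ^ 5 * b + 675 * p ^ 4 * b ^ 2 +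
          360 * p ^ 3 * b ^ 3 + 120 * p ^ 2 * b ^ 4 + 24 * p * b ^ 5) * hn
      clear h' h hab hb0 hb z3 z9
      generalize (b : ZMod 9) = q, (y : ZMod 9) = r at *
      revert h1 hb3; revert q r; decide +kernel
    obtain ⟨c, hc, hcy⟩ : ∃ c : ℤ, c % 9 = 1 ∧ c ^ 2 = y ^ 2 := by
      rcases hy with hy | hy
      · exact ⟨y, hy, rfl⟩
      · exact ⟨-y, hy, neg_sq y⟩
    rcases (by omega : b % 3 = 1 ∨ -b % 3 = 1) with hb | hb
    · exact false_of_three_dvd_left hab ha hb hc (hcy.trans h)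
    · exact false_of_three_dvd_left (a := -a) hab.neg_neg (by omega) hb hc (by rw [hcy, h]; ring)

end C1

/-- The genus-two hyperelliptic curve
`C₁ : Y² = X⁶ + 18X⁵ + 75X⁴ + 120X³ + 120X² + 72X + 28` has no affine rational
points (its only rational points are the two points at infinity). -/
theorem no_rational_points_C1 (X Y : ℚ) :
    Y ^ 2 ≠ X ^ 6 + 18 * X ^ 5 + 75 * X ^ 4 + 120 * X ^ 3 + 120 * X ^ 2 + 72 * X + 28 := by
  intro h
  have hsq : IsSquare ((X.num ^ 6 + 18 * X.num ^ 5 * X.den + 75 * X.num ^ 4 * X.den ^ 2 +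
      120 * X.num ^ 3 * X.den ^ 3 + 120 * X.num ^ 2 * X.den ^ 4 + 72 * X.num * X.den ^ 5 +
      28 * X.den ^ 6 : ℤ) : ℚ) := by
    refine ⟨Y * X.den ^ 3, ?_⟩
    rw [show Y * X.den ^ 3 * (Y * X.den ^ 3) = Y ^ 2 * X.den ^ 6 by ring, h]
    push_cast
    rw [← Rat.mul_den_eq_num X]
    ring
  obtain ⟨y, hy⟩ := Rat.isSquare_intCast_iff.1 hsq
  exact C1.false_of_int (a := X.num) (b := X.den) (y := y) (Int.isCoprime_iff_nat_coprime.2 (by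
    simpa using X.reduced)) (by exact_mod_cast X.den_ne_zero) (by rw [hy]; ring)
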